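/- Let α_1,…,α_d be real algebraic numbers such that 1, α_1,…,α_d are linearly independent over ℚ. Then for every ε > 0 there exists a constant C > 0 such that the discrepancy D_N of the Kronecker sequence z_n = ({nα_1},…,{nα_d}) satisfies D_N ≤ C · N^{ε−1} for all N ≥ 1. -/

import Mathlib

open Real

/-- The discrepancy of the first `N` points of a sequence `z` in `[0,1)^ι`. -/
noncomputable def disc {ι : Type*} [Fintype ι] (z : ℕ → ι → ℝ) (N : ℕ) : ℝ :=
  sSup { r : ℝ | ∃ u v : ι → ℝ,
    (∀ i, 0 ≤ u i ∧ u i ≤ v i ∧ v i ≤ 1) ∧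
    r = |(Nat.card {n : ℕ // n < N ∧ ∀ i, u i ≤ z n i ∧ z n i < v i} : ℝ) / N
          - ∏ i, (v i - u i)| }

/-- The `p`-th compound matrix, whose entries are the minors of order `p`. -/
noncomputable def compound {R : Type*} [CommRing R] {n : ℕ} (p : ℕ)
    (A : Matrix (Fin n) (Fin n) R) :
    Matrix (Set.powersetCard (Fin n) p) (Set.powersetCard (Fin n) p) R :=
  Matrix.of fun s t =>
    (A.submatrix (Set.powersetCard.ofFinEmbEquiv.symm s)
      (Set.powersetCard.ofFinEmbEquiv.symm t)).det

lemma compound_eq_toMatrix {R : Type*} [CommRing R] {n : ℕ} (p : ℕ)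
    (A : Matrix (Fin n) (Fin n) R) :
    compound p A = LinearMap.toMatrix ((Pi.basisFun R (Fin n)).exteriorPower p)
      ((Pi.basisFun R (Fin n)).exteriorPower p) (exteriorPower.map p (Matrix.toLin' A)) := by
  ext s t
  rw [LinearMap.toMatrix_apply, exteriorPower.basis_repr_apply, exteriorPower.basis_apply,
    exteriorPower.map_apply_ιMulti_family, exteriorPower.ιMulti_family,
    exteriorPower.ιMultiDual_apply_ιMulti, ← Matrix.det_transpose]
  simp only [compound, Matrix.of_apply]
  congr 1
  ext i j
  simp

lemma compound_mul {R : Type*} [CommRing R] {n : ℕ} (p : ℕ) (A B : Matrix (Fin n) (Fin n) R) :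
    compound p (A * B) = compound p A * compound p B := by
  rw [compound_eq_toMatrix, compound_eq_toMatrix, compound_eq_toMatrix, Matrix.toLin'_mul,
    exteriorPower.map_comp, LinearMap.toMatrix_comp _ ((Pi.basisFun R (Fin n)).exteriorPower p)]

lemma compound_one {R : Type*} [CommRing R] {n : ℕ} (p : ℕ) :
    compound p (1 : Matrix (Fin n) (Fin n) R) = 1 := by
  rw [compound_eq_toMatrix, Matrix.toLin'_one, exteriorPower.map_id, LinearMap.toMatrix_id]

lemma compound_map {R S : Type*} [CommRing R] [CommRing S] {n : ℕ} (p : ℕ)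
    (A : Matrix (Fin n) (Fin n) R) (f : R →+* S) :
    compound p (A.map f) = (compound p A).map f := by
  ext s t
  simp [compound, RingHom.map_det, Matrix.submatrix_map, RingHom.mapMatrix_apply]

lemma compound_mul_compound_of_mul_eq_one {R : Type*} [CommRing R] {n : ℕ} (p : ℕ)
    {A B : Matrix (Fin n) (Fin n) R} (h : A * B = 1) : compound p A * compound p B = 1 := by
  rw [← compound_mul, h, compound_one]

/-- The set of the last `p` indices. -/
def lastIndices {n : ℕ} (p : ℕ) (hp : p ≤ n) : Set.powersetCard (Fin n) p :=
  Set.powersetCard.ofFinEmbEquiv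
    (OrderEmbedding.ofStrictMono (fun i : Fin p => (⟨n - p + i, by omega⟩ : Fin n)) fun i j h => by
      simpa using h)

lemma lastIndices_symm_apply {n : ℕ} (p : ℕ) (hp : p ≤ n) (i : Fin p) :
    Set.powersetCard.ofFinEmbEquiv.symm (lastIndices p hp) i = ⟨n - p + i, by omega⟩ := by
  simp [lastIndices]
  rfl

/-- If, among the minors of maximal order of the last `p` rows, only the one of the last `p` columns
is nonzero, then the remaining entries of these rows vanish. -/
lemma eq_zero_of_compound_row {K : Type*} [Field K] {n p : ℕ} (hp : p ≤ n)
    (Z : Matrix (Fin n) (Fin n) K)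
    (h0 : compound p Z (lastIndices p hp) (lastIndices p hp) ≠ 0)
    (h : ∀ t, t ≠ lastIndices p hp → compound p Z (lastIndices p hp) t = 0)
    (i j : Fin n) (hi : n - p ≤ i) (hj : (j : ℕ) < n - p) : Z i j = 0 := by
  set rows : Fin p → Fin n := ⇑(Set.powersetCard.ofFinEmbEquiv.symm (lastIndices p hp)) with hrows
  set D : Matrix (Fin p) (Fin p) K := Z.submatrix rows rows with hD
  set z : Fin p → K := fun a => Z (rows a) j with hz
  have hrow : ∀ a, rows a = ⟨n - p + a, by omega⟩ := fun a => lastIndices_symm_apply p hp a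
  have hjr : ∀ a, rows a ≠ j := by
    intro a ha
    have h1 := hrow a
    rw [ha, Fin.ext_iff] at h1
    simp only at h1
    omega
  have hdet : IsUnit D.det := isUnit_iff_ne_zero.mpr h0
  have hcr : ∀ a, (D.updateCol a z).det = 0 := by
    intro a
    have hinj : Function.Injective (Function.update rows a j) := by
      intro x y hxy
      by_cases hx : x = a <;> by_cases hy : y = a
      · rw [hx, hy]
      · subst hx
        rw [Function.update_self, Function.update_of_ne hy] at hxy
        exact absurd hxy.symm (hjr y)
      · subst hy
        rw [Function.update_self, Function.update_of_ne hx] at hxy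
        exact absurd hxy (hjr x)
      · rw [Function.update_of_ne hx, Function.update_of_ne hy] at hxy
        exact (Set.powersetCard.ofFinEmbEquiv.symm (lastIndices p hp)).injective hxy
    set t : Set.powersetCard (Fin n) p := Set.powersetCard.ofFinEmb p (Fin n) ⟨_, hinj⟩ with ht
    have hmem : ∀ x, Function.update rows a j x ∈ t := by
      intro x
      rw [Set.powersetCard.mem_ofFinEmb_iff_mem_range]
      exact ⟨x, rfl⟩
    have hne : t ≠ lastIndices p hp := by
      intro he
      have := hmem a
      rw [Function.update_self, he, ← Set.powersetCard.mem_range_ofFinEmbEquiv_symm_iff_mem] at this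
      obtain ⟨b, hb⟩ := this
      exact hjr b hb
    have h1 := h t hne
    have hx : ∀ x, ∃ y, Set.powersetCard.ofFinEmbEquiv.symm t y = Function.update rows a j x := by
      intro x
      exact (Set.powersetCard.mem_range_ofFinEmbEquiv_symm_iff_mem _ _).mpr (hmem x)
    choose f hf using hx
    have hfi : Function.Injective f := by
      intro x y hxy
      apply hinj
      rw [← hf, ← hf, hxy]
    have hfb : Function.Bijective f := Finite.injective_iff_bijective.mp hfi
    have h2 : D.updateCol a z = ((Z.submatrix rows
        (Set.powersetCard.ofFinEmbEquiv.symm t)).submatrix id (Equiv.ofBijective f hfb)) := by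
      ext x y
      simp only [Matrix.submatrix_apply, id, Equiv.ofBijective_apply, hf, Matrix.updateCol_apply,
        Function.update_apply]
      split_ifs <;> rfl
    rw [h2, Matrix.det_permute']
    rw [show (Z.submatrix rows (Set.powersetCard.ofFinEmbEquiv.symm t)).det = 0 from h1, mul_zero]
  have hmul : D.mulVec (D.cramer z) = D.det • z := Matrix.mulVec_cramer D z
  have hc0 : D.cramer z = 0 := by
    ext a
    rw [Matrix.cramer_apply]
    exact hcr a
  rw [hc0, Matrix.mulVec_zero] at hmul
  have := congrFun hmul.symm ⟨i - (n - p), by omega⟩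
  simp only [Pi.smul_apply, smul_eq_mul, Pi.zero_apply, mul_eq_zero] at this
  rcases this with h3 | h3
  · exact absurd h3 h0
  · rw [hz] at h3
    simp only [hrow] at h3
    convert h3 using 2
    simp only [Fin.ext_iff]
    omega

lemma exists_pos_le_norm_mulVec_intCast {n : ℕ} (A : Matrix (Fin n) (Fin n) ℝ) (hA : A.det ≠ 0) :
    ∃ c > 0, ∀ x : Fin n → ℤ, x ≠ 0 → c ≤ ‖A.mulVec (fun k => (x k : ℝ))‖ := by
  set K : ℝ := ∑ i, ∑ j, |A⁻¹ i j| with hK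
  have hK0 : 0 ≤ K := Finset.sum_nonneg fun i _ => Finset.sum_nonneg fun j _ => abs_nonneg _
  refine ⟨1 / (K + 1), by positivity, fun x hx => ?_⟩
  obtain ⟨i, hi⟩ := Function.ne_iff.mp hx
  set v := A.mulVec (fun k => (x k : ℝ)) with hv
  have h1 : (A⁻¹.mulVec v) i = x i := by
    rw [hv, Matrix.mulVec_mulVec, Matrix.nonsing_inv_mul _ (isUnit_iff_ne_zero.mpr hA),
      Matrix.one_mulVec]
  have h2 : (1 : ℝ) ≤ |(x i : ℝ)| := by
    have : (1 : ℤ) ≤ |x i| := Int.one_le_abs hi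
    exact_mod_cast this
  rw [← h1] at h2
  have h3 : |(A⁻¹.mulVec v) i| ≤ K * ‖v‖ := by
    calc |(A⁻¹.mulVec v) i| ≤ ∑ j, |A⁻¹ i j * v j| := by
          rw [Matrix.mulVec, dotProduct]; exact Finset.abs_sum_le_sum_abs _ _
      _ ≤ ∑ j, |A⁻¹ i j| * ‖v‖ := by
          refine Finset.sum_le_sum fun j _ => ?_
          rw [abs_mul]
          exact mul_le_mul_of_nonneg_left (norm_le_pi_norm v j) (abs_nonneg _)
      _ = (∑ j, |A⁻¹ i j|) * ‖v‖ := by rw [Finset.sum_mul]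
      _ ≤ K * ‖v‖ := by
          refine mul_le_mul_of_nonneg_right ?_ (norm_nonneg _)
          exact Finset.single_le_sum (f := fun i => ∑ j, |A⁻¹ i j|)
            (fun i _ => Finset.sum_nonneg fun j _ => abs_nonneg _) (Finset.mem_univ i)
  rw [div_le_iff₀ (by positivity)]
  nlinarith [norm_nonneg v]

lemma Matrix.det_eq_pivot_mul_schur {n : ℕ} (B : Matrix (Fin (n + 1)) (Fin (n + 1)) ℝ)
    (r : Fin (n + 1)) (hr : B r 0 ≠ 0) :
    |B.det| = |B r 0| * |(Matrix.of fun (i j : Fin n) =>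
      B (r.succAbove i) j.succ - B (r.succAbove i) 0 * B r j.succ / B r 0).det| := by
  set B2 : Matrix (Fin (n + 1)) (Fin (n + 1)) ℝ := Matrix.of fun i j =>
    Fin.cases (B i 0) (fun j' => B i j'.succ - B i 0 * B r j'.succ / B r 0) j with hB2
  have h1 : B.det = B2.det := by
    rw [← Matrix.det_transpose B, ← Matrix.det_transpose B2]
    refine Matrix.det_eq_of_forall_row_eq_smul_add_const
      (Fin.cases 0 (fun j' => B r j'.succ / B r 0)) 0 (by simp) ?_
    intro i j
    refine Fin.cases ?_ (fun i' => ?_) i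
    · simp [hB2]
    · simp only [hB2, Matrix.transpose_apply, Matrix.of_apply, Fin.cases_succ, Fin.cases_zero]
      ring
  rw [h1, Matrix.det_succ_row B2 r, Finset.sum_eq_single 0]
  · have : B2.submatrix r.succAbove (Fin.succAbove 0) = (Matrix.of fun (i j : Fin n) =>
      B (r.succAbove i) j.succ - B (r.succAbove i) 0 * B r j.succ / B r 0) := by
      ext i j
      simp [hB2]
    rw [this, abs_mul, abs_mul, abs_pow, abs_neg, abs_one, one_pow, one_mul]
    simp [hB2]
  · intro j _ hj
    obtain ⟨j', rfl⟩ := Fin.exists_succ_eq.mpr hj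
    have : B2 r j'.succ = 0 := by
      simp only [hB2, Matrix.of_apply, Fin.cases_succ]
      field_simp
      ring
    simp [this]
  · simp

/-- The unimodular matrices with first column `e_0`, given by the rest of the first row and the
lower right block. -/
def unimodularBlock {n : ℕ} (k : Fin n → ℤ) (U : Matrix (Fin n) (Fin n) ℤ) :
    Matrix (Fin (n + 1)) (Fin (n + 1)) ℤ :=
  Matrix.of fun i j => Fin.cases (Fin.cases 1 k j) (fun i' => Fin.cases 0 (fun j' => U i' j') j) i

lemma det_unimodularBlock {n : ℕ} (k : Fin n → ℤ) (U : Matrix (Fin n) (Fin n) ℤ) :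
    (unimodularBlock k U).det = U.det := by
  rw [Matrix.det_succ_column_zero, Finset.sum_eq_single 0]
  · have : (unimodularBlock k U).submatrix (Fin.succAbove 0) Fin.succ = U := by
      ext i j
      simp [unimodularBlock]
    rw [this]
    simp [unimodularBlock]
  · intro i _ hi
    obtain ⟨i', rfl⟩ := Fin.exists_succ_eq.mpr hi
    simp [unimodularBlock]
  · simp

/-- A lattice basis adapted to the coordinate axes: up to a permutation of the coordinates, the
basis `A * U` of the lattice spanned by the columns of `A` is of triangular size. -/
theorem exists_reduced_basis (n : ℕ) : ∃ C : ℝ, 1 ≤ C ∧ ∀ A : Matrix (Fin n) (Fin n) ℝ, A.det ≠ 0 →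
    ∃ (U : Matrix (Fin n) (Fin n) ℤ) (τ : Equiv.Perm (Fin n)) (b : Fin n → ℝ),
      IsUnit U.det ∧ (∀ i, 0 < b i) ∧ ∏ i, b i = |A.det| ∧ (∀ i j, i ≤ j → b i ≤ C * b j) ∧
      (∀ i j, |(A * U.map (Int.cast : ℤ → ℝ)) (τ i) j| ≤ C * b (min i j)) ∧
      ∀ x : Fin n → ℤ, x ≠ 0 → ∀ h : 0 < n, ∃ i,
        b ⟨0, h⟩ ≤ C * |A.mulVec (fun k => (x k : ℝ)) i| := by
  induction n with
  | zero =>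
    refine ⟨1, le_rfl, fun A hA => ⟨1, 1, 1, by simp, fun i => i.elim0, by simp,
      fun i => i.elim0, fun i => i.elim0, fun x hx h => absurd h (lt_irrefl _)⟩⟩
  | succ n ih =>
    obtain ⟨C, hC1, hC⟩ := ih
    have hCC : C ≤ C ^ 2 := by nlinarith
    have hC3 : C ^ 2 ≤ C ^ 3 := pow_le_pow_right₀ hC1 (by norm_num)
    refine ⟨12 * C ^ 3, by nlinarith, fun A hA => ?_⟩
    set fn : Matrix (Fin (n + 1)) (Fin (n + 1)) ℤ → ℝ :=
      fun U => ‖A.mulVec (fun k => (U k 0 : ℝ))‖ with hfn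
    have hcol : ∀ (U : Matrix (Fin (n + 1)) (Fin (n + 1)) ℤ) (i j : Fin (n + 1)),
        A.mulVec (fun k => (U k j : ℝ)) i = (A * U.map (Int.cast : ℤ → ℝ)) i j := by
      intro U i j
      simp [Matrix.mulVec, Matrix.mul_apply, dotProduct]
    obtain ⟨c, hc0, hc⟩ := exists_pos_le_norm_mulVec_intCast A hA
    have hcU : ∀ U : Matrix (Fin (n + 1)) (Fin (n + 1)) ℤ, IsUnit U.det → c ≤ fn U := by
      intro U hU
      refine hc (fun k => U k 0) ?_
      intro h0
      have : U.det = 0 := Matrix.det_eq_zero_of_column_eq_zero 0 (fun i => congrFun h0 i)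
      rw [this] at hU
      exact not_isUnit_zero hU
    set S : Set ℝ := fn '' {U | IsUnit U.det} with hS
    have hSb : BddBelow S := ⟨c, by rintro _ ⟨U, hU, rfl⟩; exact hcU U hU⟩
    have hSn : S.Nonempty := ⟨fn 1, 1, by simp, rfl⟩
    have hSc : c ≤ sInf S := le_csInf hSn (by rintro _ ⟨U, hU, rfl⟩; exact hcU U hU)
    obtain ⟨_, ⟨U, hU, rfl⟩, hUm⟩ := Real.lt_sInf_add_pos hSn (show 0 < sInf S / 2 by linarith)
    have hmin : ∀ U' : Matrix (Fin (n + 1)) (Fin (n + 1)) ℤ, IsUnit U'.det →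
        2 / 3 * fn U ≤ fn U' := by
      intro U' hU'
      have := csInf_le hSb ⟨U', hU', rfl⟩
      linarith
    set B : Matrix (Fin (n + 1)) (Fin (n + 1)) ℝ := A * U.map (Int.cast : ℤ → ℝ) with hB
    set b0 : ℝ := fn U with hb0
    have hb0p : 0 < b0 := lt_of_lt_of_le hc0 (hcU U hU)
    have hBle : ∀ i, |B i 0| ≤ b0 := by
      intro i
      rw [hB, ← hcol]
      exact norm_le_pi_norm (A.mulVec (fun k => (U k 0 : ℝ))) i
    obtain ⟨r, hr⟩ : ∃ r, |B r 0| = b0 := by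
      obtain ⟨r, _, hr⟩ := Finset.exists_max_image Finset.univ (fun i => |B i 0|)
        Finset.univ_nonempty
      refine ⟨r, le_antisymm (hBle r) ?_⟩
      rw [hb0, hfn]
      simp only
      rw [pi_norm_le_iff_of_nonneg (abs_nonneg _)]
      intro i
      rw [hcol]
      exact hr i (Finset.mem_univ _)
    have hr0 : B r 0 ≠ 0 := by
      intro h
      rw [h, abs_zero] at hr
      linarith
    have hUabs : |((U.det : ℤ) : ℝ)| = 1 := by
      have := Int.isUnit_iff.mp hU
      rcases this with h | h <;> rw [h] <;> simp
    have hmapdet : ∀ V : Matrix (Fin (n + 1)) (Fin (n + 1)) ℤ,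
        (V.map (Int.cast : ℤ → ℝ)).det = (V.det : ℝ) := by
      intro V
      exact ((Int.castRingHom ℝ).map_det V).symm
    have hBdet : |B.det| = |A.det| := by
      rw [hB, Matrix.det_mul, abs_mul, hmapdet, hUabs, mul_one]
    set B' : Matrix (Fin n) (Fin n) ℝ := Matrix.of fun (i j : Fin n) =>
      B (r.succAbove i) j.succ - B (r.succAbove i) 0 * B r j.succ / B r 0 with hB'
    have hschur : |B.det| = b0 * |B'.det| := by
      rw [← hr]; exact Matrix.det_eq_pivot_mul_schur B r hr0
    have hB'det : B'.det ≠ 0 := by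
      intro h
      rw [h, abs_zero, mul_zero, hBdet] at hschur
      exact hA (abs_eq_zero.mp hschur)
    obtain ⟨U', τ', b', hU', hb'p, hb'prod, hb'mono, hb'e, hb'x⟩ := hC B' hB'det
    set k : Fin n → ℤ := fun j =>
      -round ((∑ l, B r (Fin.succ l) * (U' l j : ℝ)) / B r 0) with hk
    set W := unimodularBlock k U' with hW
    have hWdet : IsUnit W.det := by rw [hW, det_unimodularBlock]; exact hU'
    have hUWdet : IsUnit (U * W).det := by rw [Matrix.det_mul]; exact hU.mul hWdet
    set D : Matrix (Fin (n + 1)) (Fin (n + 1)) ℝ := A * (U * W).map (Int.cast : ℤ → ℝ) with hD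
    have hDB : D = B * W.map (Int.cast : ℤ → ℝ) := by
      rw [hD, hB, Matrix.mul_assoc]
      congr 1
      exact Matrix.map_mul (f := Int.castRingHom ℝ)
    have hD0 : ∀ i, D i 0 = B i 0 := by
      intro i
      rw [hDB, Matrix.mul_apply, Fin.sum_univ_succ]
      simp [hW, unimodularBlock]
    have hDs : ∀ i j, D i (Fin.succ j) = B i 0 * k j + ∑ l, B i (Fin.succ l) * (U' l j : ℝ) := by
      intro i j
      rw [hDB, Matrix.mul_apply, Fin.sum_univ_succ]
      simp [hW, unimodularBlock]
    have hDr : ∀ j, |D r (Fin.succ j)| ≤ b0 / 2 := by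
      intro j
      rw [hDs]
      set t : ℝ := ∑ l, B r (Fin.succ l) * (U' l j : ℝ) with ht
      have h1 : B r 0 * (k j : ℝ) + t = B r 0 * (t / B r 0 - round (t / B r 0)) := by
        simp only [hk, ← ht]
        push_cast
        field_simp
        ring
      rw [h1, abs_mul, hr]
      have := abs_sub_round (t / B r 0)
      nlinarith
    have hDi : ∀ i j, D (r.succAbove i) (Fin.succ j) =
        (B' * U'.map (Int.cast : ℤ → ℝ)) i j +
          B (r.succAbove i) 0 / B r 0 * D r (Fin.succ j) := by
      intro i j
      have h2 : (B' * U'.map (Int.cast : ℤ → ℝ)) i j =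
          (∑ l, B (r.succAbove i) (Fin.succ l) * (U' l j : ℝ)) -
            B (r.succAbove i) 0 / B r 0 * ∑ l, B r (Fin.succ l) * (U' l j : ℝ) := by
        rw [Matrix.mul_apply, Finset.mul_sum, ← Finset.sum_sub_distrib]
        refine Finset.sum_congr rfl fun l _ => ?_
        simp only [hB', Matrix.of_apply, Matrix.map_apply]
        ring
      rw [hDs, hDs, h2]
      field_simp
      ring
    have hratio : ∀ i, |B i 0 / B r 0| ≤ 1 := by
      intro i
      rw [abs_div, hr]
      exact (div_le_one hb0p).mpr (hBle i)
    have hDile : ∀ i j, |D (r.succAbove (τ' i)) (Fin.succ j)| ≤ C * b' (min i j) + b0 / 2 := by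
      intro i j
      rw [hDi]
      refine (abs_add_le _ _).trans (add_le_add (hb'e i j) ?_)
      rw [abs_mul]
      have h1 := hratio (r.succAbove (τ' i))
      have h2 := hDr j
      nlinarith [abs_nonneg (D r (Fin.succ j))]
    have hrow : ∀ i, i = r ∨ ∃ i', i = r.succAbove (τ' i') := by
      intro i
      by_cases h : i = r
      · exact Or.inl h
      · obtain ⟨z, hz⟩ := Fin.exists_succAbove_eq h
        exact Or.inr ⟨τ'.symm z, by simp [hz]⟩
    have hmono0 : ∀ j, b0 ≤ 6 * C ^ 2 * b' j := by
      intro j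
      have hn : 0 < n := lt_of_le_of_lt (Nat.zero_le _) j.2
      set z : Fin n := ⟨0, hn⟩ with hz
      have hzj : z ≤ j := by simp [hz, Fin.le_def]
      have h1 := hmin ((U * W).submatrix id (Equiv.swap 0 (Fin.succ z))) (by
        rw [Matrix.det_permute']
        exact (Units.isUnit _).map (Int.castRingHom ℤ) |>.mul hUWdet)
      have h2 : fn ((U * W).submatrix id (Equiv.swap 0 (Fin.succ z))) ≤ C * b' z + b0 / 2 := by
        have hp := hb'p z
        rw [hfn]
        simp only
        rw [pi_norm_le_iff_of_nonneg (by positivity)]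
        intro i
        have : A.mulVec (fun k => (((U * W).submatrix id (Equiv.swap 0 (Fin.succ z))) k 0 : ℝ)) i
            = D i (Fin.succ z) := by
          rw [hD, ← hcol]
          simp
        rw [this]
        rcases hrow i with rfl | ⟨i', rfl⟩
        · have := hDr z
          rw [Real.norm_eq_abs]
          have : 0 ≤ C * b' z := by positivity
          linarith [hDr z]
        · have h3 := hDile i' z
          rwa [min_eq_right (by simp [hz, Fin.le_def])] at h3
      have h3 := hb'mono z j hzj
      have h4 : C * b' z ≤ C * (C * b' j) := mul_le_mul_of_nonneg_left h3 (by linarith)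
      nlinarith
    have hinj : Function.Injective (Fin.cons r (fun i => r.succAbove (τ' i)) :
        Fin (n + 1) → Fin (n + 1)) := by
      rw [Fin.cons_injective_iff]
      refine ⟨?_, fun x y h => τ'.injective (Fin.succAbove_right_injective h)⟩
      rintro ⟨x, hx⟩
      exact Fin.succAbove_ne _ _ hx
    refine ⟨U * W, Equiv.ofBijective _ (Finite.injective_iff_bijective.mp hinj),
      Fin.cons b0 b', hUWdet, ?_, ?_, ?_, ?_, ?_⟩
    · intro i
      refine Fin.cases ?_ (fun i' => ?_) i
      · simpa using hb0p
      · simpa using hb'p i'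
    · rw [Fin.prod_univ_succ]
      simp only [Fin.cons_zero, Fin.cons_succ]
      rw [hb'prod, ← hschur, hBdet]
    · intro i j
      refine Fin.cases ?_ (fun i' => ?_) i
      · refine Fin.cases ?_ (fun j' => ?_) j
        · intro _
          simp only [Fin.cons_zero]
          nlinarith
        · intro _
          simp only [Fin.cons_zero, Fin.cons_succ]
          nlinarith [hmono0 j', hb'p j']
      · refine Fin.cases ?_ (fun j' => ?_) j
        · intro h
          exact absurd h (by simp)
        · intro h
          simp only [Fin.cons_succ]
          have := hb'mono i' j' (Fin.succ_le_succ_iff.mp h)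
          nlinarith [hb'p j']
    · intro i j
      rw [← hD]
      refine Fin.cases ?_ (fun j' => ?_) j
      · have : min i 0 = 0 := by simp
        rw [this, hD0]
        simp only [Fin.cons_zero]
        have := hBle (Equiv.ofBijective _ (Finite.injective_iff_bijective.mp hinj) i)
        nlinarith
      · refine Fin.cases ?_ (fun i' => ?_) i
        · simp only [Equiv.ofBijective_apply, Fin.cons_zero]
          have h1 : min 0 j'.succ = 0 := by simp
          rw [h1]
          simp only [Fin.cons_zero]
          have := hDr j'
          nlinarith
        · simp only [Equiv.ofBijective_apply, Fin.cons_succ]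
          have h1 : min i'.succ j'.succ = (min i' j').succ := by
            rcases le_total i' j' with h | h
            · rw [min_eq_left h, min_eq_left (Fin.succ_le_succ_iff.mpr h)]
            · rw [min_eq_right h, min_eq_right (Fin.succ_le_succ_iff.mpr h)]
          rw [h1]
          simp only [Fin.cons_succ]
          have h2 := hDile i' j'
          have h3 := hmono0 (min i' j')
          have h4 := hb'p (min i' j')
          nlinarith
    · intro x hx _
      set y : Fin (n + 1) → ℤ := U⁻¹.mulVec x with hy
      have hUy : U.mulVec y = x := by
        rw [hy, Matrix.mulVec_mulVec, Matrix.mul_nonsing_inv _ hU, Matrix.one_mulVec]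
      have hAx : A.mulVec (fun k => (x k : ℝ)) = B.mulVec (fun k => (y k : ℝ)) := by
        rw [hB, ← Matrix.mulVec_mulVec]
        congr 1
        ext k
        rw [← hUy]
        simp [Matrix.mulVec, dotProduct]
      rw [hAx]
      set v := B.mulVec (fun k => (y k : ℝ)) with hv
      have hvi : ∀ i, v i = B i 0 * y 0 + ∑ l, B i (Fin.succ l) * (y l.succ : ℝ) := by
        intro i
        rw [hv, Matrix.mulVec, dotProduct, Fin.sum_univ_succ]
      have hz : (⟨0, Nat.succ_pos n⟩ : Fin (n + 1)) = 0 := rfl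
      rw [hz]
      simp only [Fin.cons_zero]
      by_cases hy' : (fun l : Fin n => y l.succ) = 0
      · refine ⟨r, ?_⟩
        have h1 : v r = B r 0 * y 0 := by
          rw [hvi, Finset.sum_eq_zero, add_zero]
          intro l _
          have : y l.succ = 0 := congrFun hy' l
          rw [this]; simp
        have h2 : y 0 ≠ 0 := by
          intro h0
          apply hx
          rw [← hUy]
          have : y = 0 := by
            ext i
            refine Fin.cases h0 (fun l => ?_) i
            exact congrFun hy' l
          rw [this, Matrix.mulVec_zero]
        have h3 : (1 : ℝ) ≤ |(y 0 : ℝ)| := by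
          have : (1 : ℤ) ≤ |y 0| := Int.one_le_abs h2
          exact_mod_cast this
        rw [h1, abs_mul, hr]
        have : b0 ≤ b0 * |(y 0 : ℝ)| := by nlinarith
        nlinarith
      · have hn : 0 < n := by
          rcases Nat.eq_zero_or_pos n with h | h
          · subst h
            exact absurd (Subsingleton.elim _ _) hy'
          · exact h
        obtain ⟨i, hi⟩ := hb'x _ hy' hn
        have h1 : B'.mulVec (fun k => (y k.succ : ℝ)) i =
            v (r.succAbove i) - B (r.succAbove i) 0 / B r 0 * v r := by
          rw [hvi, hvi]
          have : B'.mulVec (fun k => (y k.succ : ℝ)) i =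
            (∑ l, B (r.succAbove i) (Fin.succ l) * (y l.succ : ℝ)) -
            B (r.succAbove i) 0 / B r 0 * ∑ l, B r (Fin.succ l) * (y l.succ : ℝ) := by
            rw [Matrix.mulVec, dotProduct, Finset.mul_sum, ← Finset.sum_sub_distrib]
            refine Finset.sum_congr rfl fun l _ => ?_
            simp only [hB', Matrix.of_apply]
            ring
          rw [this]
          field_simp
          ring
        have h2 : |B'.mulVec (fun k => (y k.succ : ℝ)) i| ≤ |v (r.succAbove i)| + |v r| := by
          rw [h1]
          refine (abs_sub _ _).trans (add_le_add le_rfl ?_)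
          rw [abs_mul]
          nlinarith [hratio (r.succAbove i), abs_nonneg (v r)]
        have h3 : ∀ j, b0 ≤ 6 * C ^ 2 * b' j := hmono0
        have h4 : b0 ≤ 6 * C ^ 3 * (|v (r.succAbove i)| + |v r|) := by
          refine (hmono0 ⟨0, hn⟩).trans ?_
          have : b' ⟨0, hn⟩ ≤ C * (|v (r.succAbove i)| + |v r|) :=
            hi.trans (by rw [h1]; exact mul_le_mul_of_nonneg_left (h1 ▸ h2) (by linarith))
          calc 6 * C ^ 2 * b' ⟨0, hn⟩ ≤ 6 * C ^ 2 * (C * (|v (r.succAbove i)| + |v r|)) :=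
                mul_le_mul_of_nonneg_left this (by positivity)
            _ = _ := by ring
        have hC3p : 0 < C ^ 3 := by positivity
        rcases le_total |v (r.succAbove i)| |v r| with h | h
        · exact ⟨r, by nlinarith⟩
        · exact ⟨r.succAbove i, by nlinarith⟩

namespace MvPolynomial

variable {σ R : Type*} [CommRing R]

/-- The Taylor expansion `F ↦ F(x + t)` as a polynomial in `t` over the polynomials in `x`. -/
noncomputable def taylorExp : MvPolynomial σ R →+* MvPolynomial σ (MvPolynomial σ R) :=
  eval₂Hom (C.comp C) fun i => C (X i) + X i

/-- The Hasse derivative. -/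
noncomputable def hasse (a : σ →₀ ℕ) (F : MvPolynomial σ R) : MvPolynomial σ R :=
  coeff a (taylorExp F)

/-- The product of the binomial coefficients of `c + a` over `a`. -/
def multichoose (c a : σ →₀ ℕ) : ℕ := a.prod fun i k => (c i + k).choose k

lemma multichoose_eq (c a : σ →₀ ℕ) (S : Finset σ) (hS : a.support ⊆ S) :
    multichoose c a = ∏ i ∈ S, (c i + a i).choose (a i) :=
  Finsupp.prod_of_support_subset _ hS _ (by simp)

@[simp] lemma multichoose_zero (c : σ →₀ ℕ) : multichoose c 0 = 1 := by simp [multichoose]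

lemma multichoose_pascal [DecidableEq σ] (c a : σ →₀ ℕ) (i : σ) (h : c i + a i ≠ 0) :
    multichoose c a = (if c i = 0 then 0 else multichoose (c - Finsupp.single i 1) a) +
      (if a i = 0 then 0 else multichoose c (a - Finsupp.single i 1)) := by
  set S := insert i a.support with hS
  have hi : i ∈ S := by simp [hS]
  have h1 : a.support ⊆ S := by simp [hS]
  have h2 : (a - Finsupp.single i 1).support ⊆ S :=
    (Finsupp.support_mono tsub_le_self).trans h1
  rw [multichoose_eq c a S h1, multichoose_eq _ a S h1, multichoose_eq c _ S h2,
    ← Finset.mul_prod_erase _ _ hi, ← Finset.mul_prod_erase _ _ hi, ← Finset.mul_prod_erase _ _ hi]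
  have e1 : ∏ x ∈ S.erase i, ((c - Finsupp.single i 1 : σ →₀ ℕ) x + a x).choose (a x) =
      ∏ x ∈ S.erase i, (c x + a x).choose (a x) :=
    Finset.prod_congr rfl fun x hx => by
      rw [Finsupp.tsub_apply, Finsupp.single_eq_of_ne (Finset.ne_of_mem_erase hx), tsub_zero]
  have e2 : ∏ x ∈ S.erase i, (c x + (a - Finsupp.single i 1 : σ →₀ ℕ) x).choose
      ((a - Finsupp.single i 1 : σ →₀ ℕ) x) = ∏ x ∈ S.erase i, (c x + a x).choose (a x) :=
    Finset.prod_congr rfl fun x hx => by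
      rw [Finsupp.tsub_apply, Finsupp.single_eq_of_ne (Finset.ne_of_mem_erase hx), tsub_zero]
  rw [e1, e2]
  simp only [Finsupp.tsub_apply, Finsupp.single_eq_same]
  rcases hc : c i with _ | c' <;> rcases ha : a i with _ | a'
  · simp [hc, ha] at h
  · simp
  · simp
  · simp only [Nat.add_eq_zero_iff, one_ne_zero, and_false, if_false, Nat.add_sub_cancel]
    rw [← add_mul, show c' + 1 + (a' + 1) = (c' + 1 + a') + 1 by ring, Nat.choose_succ_succ,
      show c' + (a' + 1) = c' + 1 + a' by ring]
    ring

lemma coeff_hasse (a c : σ →₀ ℕ) (F : MvPolynomial σ R) :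
    coeff c (hasse a F) = multichoose c a * coeff (c + a) F := by
  classical
  induction F using MvPolynomial.induction_on generalizing a c with
  | C z =>
    simp only [hasse, taylorExp, coe_eval₂Hom, eval₂_C, RingHom.comp_apply, coeff_C]
    by_cases ha : 0 = a
    · subst ha
      simp [coeff_C]
    · have : 0 ≠ c + a := by
        intro h
        exact ha (by simpa using (add_eq_zero.mp h.symm).2.symm)
      simp [ha, this]
  | add p q hp hq =>
    have : hasse a (p + q) = hasse a p + hasse a q := by simp [hasse]
    rw [this, coeff_add, coeff_add, hp, hq]
    ring
  | mul_X p i hp =>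
    have h1 : hasse a (p * X i) = hasse a p * X i +
        if a i = 0 then 0 else hasse (a - Finsupp.single i 1) p := by
      have : taylorExp (X i : MvPolynomial σ R) = C (X i) + X i := by simp [taylorExp]
      rw [hasse, map_mul, this, mul_add, coeff_add, mul_comm _ (C (X i)), coeff_C_mul,
        mul_comm (X i), coeff_mul_X']
      simp only [hasse, Finsupp.mem_support_iff]
      split_ifs <;> first | rfl | contradiction
    rw [h1, coeff_add, coeff_mul_X', coeff_mul_X']
    simp only [Finsupp.mem_support_iff, Finsupp.add_apply, ne_eq, hp, apply_ite (coeff c),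
      coeff_zero]
    by_cases h : c i + a i = 0
    · have h3 : c i = 0 := by omega
      have h4 : a i = 0 := by omega
      simp [h3, h4]
    · rw [multichoose_pascal c a i h]
      by_cases h3 : c i = 0 <;> by_cases h4 : a i = 0
      · omega
      · have : c + a - Finsupp.single i 1 = c + (a - Finsupp.single i 1) := by
          rw [add_tsub_assoc_of_le]
          simpa [Finsupp.single_le_iff] using Nat.one_le_iff_ne_zero.mpr h4
        simp [h3, h4, this]
      · have : c + a - Finsupp.single i 1 = (c - Finsupp.single i 1) + a := by
          rw [tsub_add_eq_add_tsub]
          simpa [Finsupp.single_le_iff] using Nat.one_le_iff_ne_zero.mpr h3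
        simp [h3, h4, this]
      · have t1 : c + a - Finsupp.single i 1 = c + (a - Finsupp.single i 1) := by
          rw [add_tsub_assoc_of_le]
          simpa [Finsupp.single_le_iff] using Nat.one_le_iff_ne_zero.mpr h4
        have t2 : (c - Finsupp.single i 1) + a = c + (a - Finsupp.single i 1) := by
          rw [← t1, tsub_add_eq_add_tsub]
          simpa [Finsupp.single_le_iff] using Nat.one_le_iff_ne_zero.mpr h3
        simp [h3, h4, t1, t2]
        ring

lemma hasse_sum {ι : Type*} (a : σ →₀ ℕ) (s : Finset ι) (F : ι → MvPolynomial σ R) :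
    hasse a (∑ i ∈ s, F i) = ∑ i ∈ s, hasse a (F i) := by
  simp [hasse, coeff_sum]

lemma hasse_zero_left (F : MvPolynomial σ R) : hasse 0 F = F := by
  ext c
  simp [coeff_hasse]

lemma hasse_smul (a : σ →₀ ℕ) (z : R) (F : MvPolynomial σ R) :
    hasse a (z • F) = z • hasse a F := by
  ext c
  simp only [coeff_hasse, coeff_smul, smul_eq_mul]
  ring

lemma hasse_mul [DecidableEq σ] (a : σ →₀ ℕ) (F G : MvPolynomial σ R) :
    hasse a (F * G) = ∑ x ∈ Finset.HasAntidiagonal.antidiagonal a, hasse x.1 F * hasse x.2 G := by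
  rw [hasse, map_mul, coeff_mul]
  rfl

lemma map_hasse {S : Type*} [CommRing S] (f : R →+* S) (a : σ →₀ ℕ) (F : MvPolynomial σ R) :
    map f (hasse a F) = hasse a (map f F) := by
  ext c
  simp [coeff_hasse, coeff_map]

lemma multichoose_mul (a b c : σ →₀ ℕ) :
    multichoose c b * multichoose (c + b) a = multichoose b a * multichoose c (a + b) := by
  classical
  set S := a.support ∪ b.support with hS
  rw [multichoose_eq c b S Finset.subset_union_right,
    multichoose_eq (c + b) a S Finset.subset_union_left,
    multichoose_eq b a S Finset.subset_union_left, multichoose_eq c (a + b) S Finsupp.support_add,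
    ← Finset.prod_mul_distrib, ← Finset.prod_mul_distrib]
  refine Finset.prod_congr rfl fun i _ => ?_
  simp only [Finsupp.add_apply]
  have h1 := Nat.add_choose_mul_factorial_mul_factorial (c i) (b i)
  have h2 := Nat.add_choose_mul_factorial_mul_factorial (c i + b i) (a i)
  have h3 := Nat.add_choose_mul_factorial_mul_factorial (b i) (a i)
  have h4 := Nat.add_choose_mul_factorial_mul_factorial (c i) (a i + b i)
  rw [add_comm (a i) (b i), ← add_assoc] at h4 ⊢
  have p1 := Nat.factorial_pos (c i)
  have p2 := Nat.factorial_pos (b i)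
  have p3 := Nat.factorial_pos (a i)
  apply Nat.eq_of_mul_eq_mul_right (mul_pos (mul_pos p1 p2) p3)
  calc _ = (c i + b i + a i).choose (a i) * ((c i + b i).choose (b i) * (c i).factorial *
        (b i).factorial) * (a i).factorial := by ring
    _ = (c i + b i + a i).choose (b i + a i) * (c i).factorial * ((b i + a i).choose (a i) *
        (b i).factorial * (a i).factorial) := by rw [h1, h2, h3, h4]
    _ = _ := by ring

lemma multichoose_comm (a b : σ →₀ ℕ) : multichoose a b = multichoose b a := by
  classical
  rw [multichoose_eq a b (a.support ∪ b.support) Finset.subset_union_right,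
    multichoose_eq b a (a.support ∪ b.support) Finset.subset_union_left]
  refine Finset.prod_congr rfl fun i _ => ?_
  rw [add_comm (b i), Nat.choose_symm_add]

lemma multichoose_single (a : σ →₀ ℕ) (i : σ) : multichoose a (Finsupp.single i 1) = a i + 1 := by
  simp [multichoose]

lemma hasse_hasse (a b : σ →₀ ℕ) (F : MvPolynomial σ R) :
    hasse b (hasse a F) = multichoose b a * hasse (a + b) F := by
  ext c
  rw [coeff_hasse, coeff_hasse, ← map_natCast C, coeff_C_mul, coeff_hasse, ← mul_assoc,
    ← mul_assoc, ← Nat.cast_mul, ← Nat.cast_mul, multichoose_mul, add_comm a b, add_assoc]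

lemma pderiv_hasse (i : σ) (a : σ →₀ ℕ) (F : MvPolynomial σ R) :
    pderiv i (hasse a F) = (a i + 1 : ℕ) * hasse (a + Finsupp.single i 1) F := by
  ext c
  have h := multichoose_mul a (Finsupp.single i 1) c
  rw [multichoose_single, multichoose_comm (Finsupp.single i 1), multichoose_single] at h
  rw [coeff_pderiv, coeff_hasse, ← map_natCast C, coeff_C_mul, coeff_hasse, ← mul_assoc,
    ← Nat.cast_mul, ← h, add_assoc, add_comm (Finsupp.single i 1) a]
  push_cast
  ring

end MvPolynomial

namespace MvPolynomial

/-- The translation `F ↦ F(x + p)`. -/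
noncomputable def translate {σ R : Type*} [CommRing R] (p : σ → R) :
    MvPolynomial σ R →+* MvPolynomial σ R :=
  eval₂Hom C fun i => X i + C (p i)

lemma coeff_translate {σ R : Type*} [CommRing R] (p : σ → R) (a : σ →₀ ℕ) (F : MvPolynomial σ R) :
    coeff a (translate p F) = eval p (hasse a F) := by
  have : translate p = (map (eval p)).comp (taylorExp (σ := σ) (R := R)) := by
    refine ringHom_ext (fun r => ?_) fun i => ?_
    · simp [translate, taylorExp]
    · simp [translate, taylorExp, add_comm]
  rw [this, RingHom.comp_apply, coeff_map]
  rfl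

lemma translate_injective {σ R : Type*} [CommRing R] (p : σ → R) :
    Function.Injective (translate p) := by
  have : (translate (-p)).comp (translate p) = RingHom.id _ := by
    refine ringHom_ext (fun r => ?_) fun i => ?_ <;> simp [translate]
  exact Function.LeftInverse.injective (g := translate (-p)) fun F => RingHom.congr_fun this F

section Wronskian

variable {σ ι : Type*} (f : ι → MvPolynomial σ ℚ)

/-- The vector of the Hasse derivatives of a family of polynomials over the function field. -/
noncomputable def hasseVec (a : σ →₀ ℕ) : ι → FractionRing (MvPolynomial σ ℚ) :=
  fun j => algebraMap _ _ (hasse a (f j))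

variable [Fintype ι] in
lemma span_range_hasseVec (hf : LinearIndependent ℚ f) :
    Submodule.span (FractionRing (MvPolynomial σ ℚ)) (Set.range (hasseVec f)) = ⊤ := by
  classical
  by_contra hne
  obtain ⟨φ, hφ0, hφ⟩ := Submodule.exists_le_ker_of_lt_top _ (lt_top_iff_ne_top.mpr hne)
  obtain ⟨⟨b, hb⟩, hbm⟩ := IsLocalization.exist_integer_multiples_of_finite
    (nonZeroDivisors (MvPolynomial σ ℚ)) (fun j => φ (Pi.single j 1))
  choose μ hμ using hbm
  have hb0 : b ≠ 0 := nonZeroDivisors.ne_zero hb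
  obtain ⟨j, hj⟩ : ∃ j, μ j ≠ 0 := by
    by_contra! h
    apply hφ0
    refine LinearMap.pi_ext' fun j => LinearMap.ext_ring ?_
    have := hμ j
    rw [h j, map_zero, Algebra.smul_def] at this
    have hb' : algebraMap (MvPolynomial σ ℚ) (FractionRing (MvPolynomial σ ℚ)) b ≠ 0 := by
      simpa using hb0
    simpa [hb'] using this.symm
  have hrel : ∀ a, ∑ j, μ j * hasse a (f j) = 0 := by
    intro a
    apply IsFractionRing.injective (MvPolynomial σ ℚ) (FractionRing (MvPolynomial σ ℚ))
    have h1 : φ (hasseVec f a) = 0 := hφ (Submodule.subset_span ⟨a, rfl⟩)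
    rw [LinearMap.pi_apply_eq_sum_univ] at h1
    rw [map_sum, map_zero]
    have h2 := congrArg (fun z => algebraMap (MvPolynomial σ ℚ)
      (FractionRing (MvPolynomial σ ℚ)) b * z) h1
    simp only [mul_zero, Finset.mul_sum] at h2
    rw [← h2]
    refine Finset.sum_congr rfl fun j _ => ?_
    rw [map_mul, hμ j, Algebra.smul_def, smul_eq_mul, hasseVec]
    have : (fun j_1 => if j = j_1 then (1 : FractionRing (MvPolynomial σ ℚ)) else 0) =
        Pi.single j 1 := by
      ext k; simp [Pi.single_apply, eq_comm]
    rw [this]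
    ring
  obtain ⟨p, hp⟩ : ∃ p, eval p (μ j) ≠ 0 := by
    by_contra! h
    exact hj (funext fun x => by rw [h x, map_zero])
  have h0 : ∑ j, eval p (μ j) • f j = 0 := by
    apply translate_injective p
    rw [map_zero]
    ext a
    rw [coeff_translate, coeff_zero, hasse_sum, map_sum]
    have := congrArg (eval p) (hrel a)
    rw [map_sum, map_zero] at this
    rw [← this]
    exact Finset.sum_congr rfl fun j _ => by rw [hasse_smul, smul_eval, map_mul]
  exact hp (Fintype.linearIndependent_iff.mp hf _ h0 j)

/-- The span of the vectors of Hasse derivatives of bounded order. -/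
noncomputable def hasseSpan (n : ℕ) : Submodule (FractionRing (MvPolynomial σ ℚ))
    (ι → FractionRing (MvPolynomial σ ℚ)) :=
  Submodule.span _ (hasseVec f '' {a | a.degree ≤ n})

lemma hasseSpan_mono {m n : ℕ} (h : m ≤ n) : hasseSpan f m ≤ hasseSpan f n :=
  Submodule.span_mono (Set.image_mono fun _ ha => le_trans ha h)

lemma hasseVec_mem_of_hasseSpan_eq {n : ℕ} [Fintype ι]
    (h : hasseSpan f (n + 1) = hasseSpan f n) (a : σ →₀ ℕ) : hasseVec f a ∈ hasseSpan f n := by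
  classical
  have hclear : ∀ v ∈ hasseSpan f n, ∃ q : (MvPolynomial σ ℚ), q ≠ 0 ∧ ∃ w : ι → (MvPolynomial σ ℚ),
      w ∈ Submodule.span (MvPolynomial σ ℚ) ((fun a j => hasse a (f j)) '' {a | a.degree ≤ n}) ∧
      ∀ j, algebraMap (MvPolynomial σ ℚ) (FractionRing (MvPolynomial σ ℚ)) q * v j =
        algebraMap (MvPolynomial σ ℚ) (FractionRing (MvPolynomial σ ℚ)) (w j) := by
    intro v hv
    refine Submodule.span_induction ?_ ?_ ?_ ?_ hv
    · rintro _ ⟨b, hb, rfl⟩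
      exact ⟨1, one_ne_zero, _, Submodule.subset_span ⟨b, hb, rfl⟩, fun j => by simp [hasseVec]⟩
    · exact ⟨1, one_ne_zero, 0, Submodule.zero_mem _, fun j => by simp⟩
    · rintro x y _ _ ⟨q, hq, w, hw, hx⟩ ⟨q', hq', w', hw', hy⟩
      refine ⟨q * q', mul_ne_zero hq hq', q' • w + q • w', Submodule.add_mem _
        (Submodule.smul_mem _ _ hw) (Submodule.smul_mem _ _ hw'), fun j => ?_⟩
      simp only [Pi.add_apply, Pi.smul_apply, smul_eq_mul, map_add, map_mul, ← hx, ← hy]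
      ring
    · rintro c x _ ⟨q, hq, w, hw, hx⟩
      obtain ⟨u, t, ht, rfl⟩ := IsFractionRing.div_surjective (A := (MvPolynomial σ ℚ)) c
      have ht0 : algebraMap (MvPolynomial σ ℚ) (FractionRing (MvPolynomial σ ℚ)) t ≠ 0 := by
        rw [Ne, IsFractionRing.to_map_eq_zero_iff]
        exact nonZeroDivisors.ne_zero ht
      refine ⟨t * q, mul_ne_zero (nonZeroDivisors.ne_zero ht) hq, u • w,
        Submodule.smul_mem _ _ hw, fun j => ?_⟩
      simp only [Pi.smul_apply, smul_eq_mul, map_mul, ← hx]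
      field_simp
  have hderiv : ∀ i, ∀ w ∈ Submodule.span (MvPolynomial σ ℚ)
      ((fun a j => hasse a (f j)) '' {a | a.degree ≤ n}),
      (fun j => algebraMap (MvPolynomial σ ℚ) (FractionRing (MvPolynomial σ ℚ)) (pderiv i (w j))) ∈
        hasseSpan f (n + 1) := by
    intro i w hw
    refine Submodule.span_induction ?_ ?_ ?_ ?_ hw
    · rintro _ ⟨b, hb, rfl⟩
      have : (fun j => algebraMap (MvPolynomial σ ℚ) (FractionRing (MvPolynomial σ ℚ))
          (pderiv i (hasse b (f j)))) =
          algebraMap (MvPolynomial σ ℚ) (FractionRing (MvPolynomial σ ℚ))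
            ((b i + 1 : ℕ) : (MvPolynomial σ ℚ)) • hasseVec f (b + Finsupp.single i 1) := by
        ext j
        rw [pderiv_hasse, map_mul]
        rfl
      simp only
      rw [this]
      refine Submodule.smul_mem _ _ (Submodule.subset_span ⟨_, ?_, rfl⟩)
      have hb' : b.degree ≤ n := hb
      simpa using hb'
    · convert Submodule.zero_mem _ using 1
      ext j
      simp
    · intro x y _ _ hx hy
      convert Submodule.add_mem _ hx hy using 1
      ext j
      simp
    · intro c x hxs hx
      have h2 : (fun j => algebraMap (MvPolynomial σ ℚ) (FractionRing (MvPolynomial σ ℚ)) (x j)) ∈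
          hasseSpan f (n + 1) := by
        refine hasseSpan_mono f n.le_succ ?_
        refine Submodule.span_induction ?_ ?_ ?_ ?_ hxs
        · rintro _ ⟨b, hb, rfl⟩
          exact Submodule.subset_span ⟨b, hb, rfl⟩
        · convert Submodule.zero_mem _ using 1
          ext j
          simp
        · intro x y _ _ hx hy
          convert Submodule.add_mem _ hx hy using 1
          ext j
          simp
        · intro c x _ hx
          convert Submodule.smul_mem _
            (algebraMap (MvPolynomial σ ℚ) (FractionRing (MvPolynomial σ ℚ)) c) hx using 1
          ext j
          simp
      convert Submodule.add_mem _
        (Submodule.smul_mem _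
          (algebraMap (MvPolynomial σ ℚ) (FractionRing (MvPolynomial σ ℚ)) c) hx)
        (Submodule.smul_mem _
          (algebraMap (MvPolynomial σ ℚ) (FractionRing (MvPolynomial σ ℚ)) (pderiv i c)) h2) using 1
      ext j
      simp only [Pi.add_apply, Pi.smul_apply, smul_eq_mul, Derivation.leibniz, map_add, map_mul]
      ring
  induction hN : a.degree generalizing a with
  | zero => exact Submodule.subset_span ⟨a, by simp [hN], rfl⟩
  | succ N ih =>
    obtain ⟨i, hi⟩ : ∃ i, a i ≠ 0 := by
      by_contra! h0
      have : a = 0 := Finsupp.ext h0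
      simp [this] at hN
    set a' := a - Finsupp.single i 1 with ha'
    have haa : a = a' + Finsupp.single i 1 := by
      rw [ha', tsub_add_cancel_of_le]
      simpa [Finsupp.single_le_iff] using Nat.one_le_iff_ne_zero.mpr hi
    have hN' : a'.degree = N := by
      rw [haa, map_add] at hN
      simpa using hN
    obtain ⟨q, hq, w, hw, hqw⟩ := hclear _ (ih a' hN')
    have h1 := hderiv i w hw
    rw [h] at h1
    have hw2 : ∀ j, w j = q * hasse a' (f j) := by
      intro j
      apply IsFractionRing.injective (MvPolynomial σ ℚ) (FractionRing (MvPolynomial σ ℚ))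
      rw [← hqw j, map_mul]
      rfl
    have h3 : (fun j => algebraMap (MvPolynomial σ ℚ) (FractionRing (MvPolynomial σ ℚ))
        (pderiv i (w j))) =
        algebraMap (MvPolynomial σ ℚ) (FractionRing (MvPolynomial σ ℚ)) (pderiv i q) •
          hasseVec f a' +
          algebraMap (MvPolynomial σ ℚ) (FractionRing (MvPolynomial σ ℚ)) (q * (a' i + 1 : ℕ)) •
            hasseVec f a := by
      ext j
      rw [hw2, Derivation.leibniz, pderiv_hasse, ← haa]
      simp only [Pi.add_apply, Pi.smul_apply, smul_eq_mul, map_add, map_mul, hasseVec]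
      ring
    rw [h3, Submodule.add_mem_iff_right _ (Submodule.smul_mem _ _ (ih a' hN'))] at h1
    have h4 : algebraMap (MvPolynomial σ ℚ) (FractionRing (MvPolynomial σ ℚ)) (q * (a' i + 1 : ℕ))
        ≠ 0 := by
      rw [Ne, IsFractionRing.to_map_eq_zero_iff]
      exact mul_ne_zero hq (Nat.cast_ne_zero.mpr (Nat.succ_ne_zero _))
    exact (Submodule.smul_mem_iff _ h4).mp h1

variable [Fintype ι]

lemma le_finrank_hasseSpan (hf : LinearIndependent ℚ f) (n : ℕ) (hn : n < Fintype.card ι) :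
    n + 1 ≤ Module.finrank (FractionRing (MvPolynomial σ ℚ)) (hasseSpan f n) := by
  have hall : ∀ n, hasseSpan f (n + 1) = hasseSpan f n → hasseSpan f n = ⊤ := by
    intro n h
    rw [eq_top_iff, ← span_range_hasseVec f hf, Submodule.span_le]
    rintro _ ⟨a, rfl⟩
    exact hasseVec_mem_of_hasseSpan_eq f h a
  induction n with
  | zero =>
    rw [zero_add, Nat.one_le_iff_ne_zero, Ne, Submodule.finrank_eq_zero]
    intro h0
    obtain ⟨j⟩ := Fintype.card_pos_iff.mp hn
    have : hasseVec f 0 ∈ hasseSpan f 0 := Submodule.subset_span ⟨0, by simp, rfl⟩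
    rw [h0, Submodule.mem_bot] at this
    have := congrFun this j
    rw [hasseVec, hasse_zero_left, Pi.zero_apply, IsFractionRing.to_map_eq_zero_iff] at this
    exact hf.ne_zero j this
  | succ n ih =>
    have h1 := ih (by omega)
    by_cases h : hasseSpan f (n + 1) = hasseSpan f n
    · rw [h, hall n h, finrank_top, Module.finrank_fintype_fun_eq_card]
      omega
    · have := Submodule.finrank_lt_finrank_of_lt
        (lt_of_le_of_ne (hasseSpan_mono f (Nat.le_add_right n 1)) (Ne.symm h))
      omega

/-- Hasse derivatives of order less than the number of polynomials detect linear independence. -/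
lemma hasseSpan_eq_top (hf : LinearIndependent ℚ f) {n : ℕ} (hn : Fintype.card ι ≤ n + 1) :
    hasseSpan f n = ⊤ := by
  rcases Nat.eq_zero_or_pos (Fintype.card ι) with h0 | hpos
  · have := Fintype.card_eq_zero_iff.mp h0
    exact Subsingleton.elim _ _
  apply Submodule.eq_top_of_finrank_eq
  rw [Module.finrank_fintype_fun_eq_card]
  have h1 := le_finrank_hasseSpan f hf (Fintype.card ι - 1) (by omega)
  have h2 := Submodule.finrank_mono (hasseSpan_mono f (show Fintype.card ι - 1 ≤ n by omega))
  have h3 := Submodule.finrank_le (hasseSpan f n)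
  rw [Module.finrank_fintype_fun_eq_card] at h3
  omega

/-- The generalized Wronskian: linearly independent polynomials have a nonvanishing determinant
of Hasse derivatives of small order. -/
theorem exists_det_hasse_ne_zero {s : ℕ} (f : Fin s → MvPolynomial σ ℚ)
    (hf : LinearIndependent ℚ f) : ∃ a : Fin s → σ →₀ ℕ, Function.Injective a ∧
      (∀ i, (a i).degree < s) ∧ (Matrix.of fun i j => hasse (a i) (f j)).det ≠ 0 := by
  set K := FractionRing (MvPolynomial σ ℚ)
  rcases Nat.eq_zero_or_pos s with rfl | hs
  · exact ⟨fun i => i.elim0, fun i => i.elim0, fun i => i.elim0, by simp⟩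
  have htop := hasseSpan_eq_top f hf (n := s - 1) (by simp; omega)
  obtain ⟨κ, e, he, hspan, hli⟩ := exists_linearIndependent' K
    (fun a : {a : σ →₀ ℕ // a.degree ≤ s - 1} => hasseVec f a)
  have htop' : Submodule.span K (Set.range ((fun a : {a : σ →₀ ℕ // a.degree ≤ s - 1} =>
      hasseVec f a) ∘ e)) = ⊤ := by
    rw [hspan, ← htop, hasseSpan, Set.image_eq_range]
    rfl
  let B := Module.Basis.mk hli htop'.ge
  have : Fintype κ := FiniteDimensional.fintypeBasisIndex B
  have hcard : Fintype.card κ = s := by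
    rw [← Module.finrank_eq_card_basis B, Module.finrank_fintype_fun_eq_card, Fintype.card_fin]
  let E : Fin s ≃ κ := (Fintype.equivFinOfCardEq hcard).symm
  refine ⟨fun i => (e (E i)).1, fun x y h => E.injective (he (Subtype.ext h)),
    fun i => lt_of_le_of_lt (e (E i)).2 (by omega), fun h0 => ?_⟩
  have h1 : (Matrix.of fun i => hasseVec f (e (E i)).1).det = 0 := by
    have := (algebraMap (MvPolynomial σ ℚ) K).map_det
      (Matrix.of fun i j => hasse (e (E i)).1 (f j))
    rw [h0, map_zero] at this
    exact this.symm
  have h2 : LinearIndependent K (Matrix.of fun i => hasseVec f (e (E i)).1).row :=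
    hli.comp E E.injective
  rw [Matrix.linearIndependent_rows_iff_isUnit, Matrix.isUnit_iff_isUnit_det, h1] at h2
  exact not_isUnit_zero h2

end Wronskian

end MvPolynomial

namespace MvPolynomial

section LOneNorm

variable {σ R : Type*} [NormedCommRing R]

/-- The sum of the norms of the coefficients. -/
noncomputable def lOne (F : MvPolynomial σ R) : ℝ := ∑ c ∈ F.support, ‖coeff c F‖

lemma lOne_eq_sum (F : MvPolynomial σ R) (S : Finset (σ →₀ ℕ)) (h : F.support ⊆ S) :
    lOne F = ∑ c ∈ S, ‖coeff c F‖ :=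
  Finset.sum_subset h fun c _ hc => by rw [notMem_support_iff.mp hc, norm_zero]

lemma lOne_nonneg (F : MvPolynomial σ R) : 0 ≤ lOne F := Finset.sum_nonneg fun _ _ => norm_nonneg _

lemma norm_coeff_le_lOne (F : MvPolynomial σ R) (c : σ →₀ ℕ) : ‖coeff c F‖ ≤ lOne F := by
  by_cases hc : c ∈ F.support
  · exact Finset.single_le_sum (f := fun c => ‖coeff c F‖) (fun _ _ => norm_nonneg _) hc
  · rw [notMem_support_iff.mp hc, norm_zero]
    exact lOne_nonneg F

@[simp] lemma lOne_zero : lOne (0 : MvPolynomial σ R) = 0 := by simp [lOne]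

lemma lOne_monomial (c : σ →₀ ℕ) (z : R) : lOne (monomial c z) = ‖z‖ := by
  classical
  rw [lOne_eq_sum _ {c} support_monomial_subset]
  simp

lemma lOne_one [NormOneClass R] : lOne (1 : MvPolynomial σ R) = 1 := by
  have := lOne_monomial (σ := σ) 0 (1 : R)
  rwa [monomial_zero', C_1, norm_one] at this

lemma lOne_add_le (F G : MvPolynomial σ R) : lOne (F + G) ≤ lOne F + lOne G := by
  classical
  rw [lOne_eq_sum _ _ support_add, lOne_eq_sum F (F.support ∪ G.support) Finset.subset_union_left,
    lOne_eq_sum G (F.support ∪ G.support) Finset.subset_union_right, ← Finset.sum_add_distrib]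
  exact Finset.sum_le_sum fun c _ => by rw [coeff_add]; exact norm_add_le _ _

lemma lOne_sum_le {ι : Type*} (s : Finset ι) (F : ι → MvPolynomial σ R) :
    lOne (∑ i ∈ s, F i) ≤ ∑ i ∈ s, lOne (F i) := by
  classical
  induction s using Finset.induction_on with
  | empty => simp
  | insert i s hi ih =>
    rw [Finset.sum_insert hi, Finset.sum_insert hi]
    exact (lOne_add_le _ _).trans (add_le_add le_rfl ih)

lemma lOne_mul_le (F G : MvPolynomial σ R) : lOne (F * G) ≤ lOne F * lOne G := by
  conv_lhs => rw [F.as_sum, G.as_sum, Finset.sum_mul_sum]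
  refine (lOne_sum_le _ _).trans ?_
  rw [lOne, lOne, Finset.sum_mul_sum]
  refine Finset.sum_le_sum fun c _ => (lOne_sum_le _ _).trans (Finset.sum_le_sum fun d _ => ?_)
  rw [monomial_mul, lOne_monomial]
  exact norm_mul_le _ _

lemma lOne_prod_le [NormOneClass R] {ι : Type*} (s : Finset ι) (F : ι → MvPolynomial σ R) :
    lOne (∏ i ∈ s, F i) ≤ ∏ i ∈ s, lOne (F i) := by
  classical
  induction s using Finset.induction_on with
  | empty => simp [lOne_one]
  | insert i s hi ih =>
    rw [Finset.prod_insert hi, Finset.prod_insert hi]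
    exact (lOne_mul_le _ _).trans (mul_le_mul_of_nonneg_left ih (lOne_nonneg _))

lemma lOne_pow_le [NormOneClass R] (F : MvPolynomial σ R) (n : ℕ) : lOne (F ^ n) ≤ lOne F ^ n := by
  simpa using lOne_prod_le (Finset.range n) fun _ => F

lemma lOne_neg (F : MvPolynomial σ R) : lOne (-F) = lOne F := by
  simp [lOne]

lemma lOne_det_le [NormOneClass R] {n : ℕ} (M : Matrix (Fin n) (Fin n) (MvPolynomial σ R)) (B : ℝ)
    (hM : ∀ i j, lOne (M i j) ≤ B) : lOne M.det ≤ n.factorial * B ^ n := by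
  rw [Matrix.det_apply]
  refine (lOne_sum_le _ _).trans ?_
  have : ∀ τ ∈ (Finset.univ : Finset (Equiv.Perm (Fin n))),
      lOne (Equiv.Perm.sign τ • ∏ i, M (τ i) i) ≤ B ^ n := by
    intro τ _
    have h1 : lOne (Equiv.Perm.sign τ • ∏ i, M (τ i) i) = lOne (∏ i, M (τ i) i) := by
      rcases Int.units_eq_one_or (Equiv.Perm.sign τ) with h | h
      · rw [h, one_smul]
      · rw [h, Units.neg_smul, one_smul, lOne_neg]
    rw [h1]
    refine (lOne_prod_le _ _).trans ?_
    refine (Finset.prod_le_prod (fun i _ => lOne_nonneg _) fun i _ => hM (τ i) i).trans ?_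
    simp
  refine (Finset.sum_le_sum this).trans ?_
  simp [Fintype.card_perm]

lemma multichoose_le (c a : σ →₀ ℕ) : multichoose c a ≤ 2 ^ (c + a).degree := by
  classical
  rw [multichoose_eq c a (c.support ∪ a.support) Finset.subset_union_right, Finsupp.degree_apply,
    Finset.sum_subset (Finsupp.support_add : (c + a).support ⊆ c.support ∪ a.support)
      (fun i _ hi => Finsupp.notMem_support_iff.mp hi), ← Finset.prod_pow_eq_pow_sum]
  exact Finset.prod_le_prod' fun i _ => Nat.choose_le_two_pow _ _

/-- A linear map reindexing monomials by a shift and multiplying by bounded factors. -/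
lemma lOne_le_of_coeff_shift (F G : MvPolynomial σ R) (a : σ →₀ ℕ) (K : ℝ) (hK : 0 ≤ K)
    (h : ∀ c, ‖coeff c G‖ ≤ K * ‖coeff (c + a) F‖) : lOne G ≤ K * lOne F := by
  classical
  calc lOne G ≤ ∑ c ∈ G.support, K * ‖coeff (c + a) F‖ := Finset.sum_le_sum fun c _ => h c
    _ = K * ∑ c ∈ G.support, ‖coeff (c + a) F‖ := by rw [Finset.mul_sum]
    _ = K * ∑ c ∈ G.support.image (· + a), ‖coeff c F‖ := by
        rw [Finset.sum_image fun x _ y _ hxy => add_right_cancel hxy]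
    _ ≤ K * lOne F := by
        refine mul_le_mul_of_nonneg_left ?_ hK
        rw [lOne_eq_sum F (F.support ∪ G.support.image (· + a)) Finset.subset_union_left]
        exact Finset.sum_le_sum_of_subset_of_nonneg Finset.subset_union_right
          fun _ _ _ => norm_nonneg _

lemma lOne_hasse_le (a : σ →₀ ℕ) (F : MvPolynomial σ ℤ) (N : ℕ)
    (hN : ∀ c ∈ F.support, c.degree ≤ N) : lOne (hasse a F) ≤ 2 ^ N * lOne F := by
  refine lOne_le_of_coeff_shift F _ a _ (by positivity) fun c => ?_
  rw [coeff_hasse]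
  by_cases h : coeff (c + a) F = 0
  · simp [h]
  · refine (norm_mul_le _ _).trans (mul_le_mul_of_nonneg_right ?_ (norm_nonneg _))
    have h1 : multichoose c a ≤ 2 ^ N := (multichoose_le c a).trans
      (Nat.pow_le_pow_right (by norm_num) (hN _ (mem_support_iff.mpr h)))
    rw [Int.norm_natCast]
    exact_mod_cast h1

end LOneNorm

section Slice

variable {σ R : Type*} [CommRing R]

/-- The part of `F` divisible by the monomial `d` with quotient satisfying `p`, divided by `d`. -/
noncomputable def slice (d : σ →₀ ℕ) (p : (σ →₀ ℕ) → Prop) (F : MvPolynomial σ R) :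
    MvPolynomial σ R := by
  classical
  exact ∑ b ∈ F.support, if d ≤ b ∧ p (b - d) then monomial (b - d) (coeff b F) else 0

open Classical in
lemma coeff_slice (d c : σ →₀ ℕ) (p : (σ →₀ ℕ) → Prop) (F : MvPolynomial σ R) :
    coeff c (slice d p F) = if p c then coeff (c + d) F else 0 := by
  rw [slice, coeff_sum, Finset.sum_eq_single (c + d)]
  · by_cases h : p c <;> simp [h]
  · intro b _ hb
    split_ifs with h
    · rw [coeff_monomial, if_neg]
      rintro rfl
      exact hb (tsub_add_cancel_of_le h.1).symm
    · simp
  · intro h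
    rw [notMem_support_iff.mp h]
    simp

lemma map_slice {S : Type*} [CommRing S] (f : R →+* S) (d : σ →₀ ℕ) (p : (σ →₀ ℕ) → Prop)
    (F : MvPolynomial σ R) : map f (slice d p F) = slice d p (map f F) := by
  classical
  ext c
  rw [coeff_map, coeff_slice, coeff_slice, coeff_map]
  split_ifs <;> simp

lemma lOne_slice_le {R : Type*} [NormedCommRing R] (d : σ →₀ ℕ) (p : (σ →₀ ℕ) → Prop)
    (F : MvPolynomial σ R) : lOne (slice d p F) ≤ lOne F := by
  classical
  rw [← one_mul (lOne F)]
  refine lOne_le_of_coeff_shift F _ d 1 zero_le_one fun c => ?_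
  rw [coeff_slice]
  split_ifs <;> simp

end Slice

section Disjoint

variable {σ R : Type*} [CommRing R] {S : Set σ}

lemma coeff_eq_zero_of_mem_supported {f : MvPolynomial σ R} (hf : f ∈ supported R S)
    {c : σ →₀ ℕ} {i : σ} (hi : i ∉ S) (hc : c i ≠ 0) : coeff c f = 0 := by
  by_contra h
  rw [mem_supported] at hf
  exact hi (hf (mem_vars_iff_mem_support i |>.mpr
    ⟨c, mem_support_iff.mpr h, Finsupp.mem_support_iff.mpr hc⟩))

lemma mem_supported_of_coeff {f : MvPolynomial σ R}
    (h : ∀ c i, i ∉ S → c i ≠ 0 → coeff c f = 0) : f ∈ supported R S := by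
  rw [mem_supported]
  intro i hi
  obtain ⟨c, hc, hic⟩ := (mem_vars_iff_mem_support i).mp hi
  by_contra hiS
  exact mem_support_iff.mp hc (h c i hiS (Finsupp.mem_support_iff.mp hic))

lemma hasse_mem_supported {f : MvPolynomial σ R} (hf : f ∈ supported R S) (a : σ →₀ ℕ) :
    hasse a f ∈ supported R S :=
  mem_supported_of_coeff fun c i hi hc => by
    rw [coeff_hasse, coeff_eq_zero_of_mem_supported hf hi (by simp [hc]), mul_zero]

lemma hasse_eq_zero_of_mem_supported {f : MvPolynomial σ R} (hf : f ∈ supported R S)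
    {a : σ →₀ ℕ} {i : σ} (hi : i ∉ S) (ha : a i ≠ 0) : hasse a f = 0 := by
  ext c
  rw [coeff_hasse, coeff_eq_zero_of_mem_supported hf hi (by simp [ha]), mul_zero, coeff_zero]

lemma eq_and_eq_of_add_eq_add {a b x y : σ →₀ ℕ} (ha : ∀ i ∉ S, a i = 0) (hb : ∀ i ∈ S, b i = 0)
    (hx : ∀ i ∉ S, x i = 0) (hy : ∀ i ∈ S, y i = 0) (h : x + y = a + b) : x = a ∧ y = b := by
  constructor <;> ext i <;> have := DFunLike.congr_fun h i <;>
    simp only [Finsupp.add_apply] at this <;> by_cases hi : i ∈ S <;>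
    simp_all

lemma hasse_add_mul {f g : MvPolynomial σ R} (hf : f ∈ supported R S) (hg : g ∈ supported R Sᶜ)
    {a b : σ →₀ ℕ} (ha : ∀ i ∉ S, a i = 0) (hb : ∀ i ∈ S, b i = 0) :
    hasse (a + b) (f * g) = hasse a f * hasse b g := by
  classical
  rw [hasse_mul, Finset.sum_eq_single (a, b)]
  · rintro ⟨x, y⟩ hxy hne
    rw [Finset.HasAntidiagonal.mem_antidiagonal] at hxy
    by_cases hx : ∀ i ∉ S, x i = 0
    · by_cases hy : ∀ i ∈ S, y i = 0
      · obtain ⟨rfl, rfl⟩ := eq_and_eq_of_add_eq_add ha hb hx hy hxy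
        exact absurd rfl hne
      · push Not at hy
        obtain ⟨i, hi, hyi⟩ := hy
        rw [hasse_eq_zero_of_mem_supported hg (i := i) (by simpa using hi) hyi, mul_zero]
    · push Not at hx
      obtain ⟨i, hi, hxi⟩ := hx
      rw [hasse_eq_zero_of_mem_supported hf hi hxi, zero_mul]
  · intro h
    exact absurd (by simp) h

lemma coeff_add_mul {f g : MvPolynomial σ R} (hf : f ∈ supported R S) (hg : g ∈ supported R Sᶜ)
    {a b : σ →₀ ℕ} (ha : ∀ i ∉ S, a i = 0) (hb : ∀ i ∈ S, b i = 0) :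
    coeff (a + b) (f * g) = coeff a f * coeff b g := by
  have hz : ∀ (a : σ →₀ ℕ) (F : MvPolynomial σ R), coeff 0 (hasse a F) = coeff a F := by
    intro a F
    rw [coeff_hasse, multichoose_comm]
    simp
  rw [← hz, hasse_add_mul hf hg ha hb, ← hz a, ← hz b]
  simp only [← constantCoeff_eq, map_mul]

lemma slice_mul {f g : MvPolynomial σ R} (hf : f ∈ supported R S) (hg : g ∈ supported R Sᶜ)
    {d : σ →₀ ℕ} (hd : ∀ i ∈ S, d i = 0) :
    slice d (fun c => ∀ i ∉ S, c i = 0) (f * g) = C (coeff d g) * f := by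
  classical
  ext c
  rw [coeff_slice, coeff_C_mul]
  split_ifs with h
  · rw [coeff_add_mul hf hg h hd, mul_comm]
  · push Not at h
    obtain ⟨i, hi, hc⟩ := h
    rw [coeff_eq_zero_of_mem_supported hf hi hc, mul_zero]

end Disjoint

section Index

variable {σ R : Type*} [CommRing R]

/-- `F` has weighted index at least `θ` at the point `ξ`. -/
def IndexGE (w : σ → ℝ) (ξ : σ → R) (θ : ℝ) (F : MvPolynomial σ R) : Prop :=
  ∀ a : σ →₀ ℕ, Finsupp.weight w a < θ → eval ξ (hasse a F) = 0

variable {w : σ → ℝ} {ξ : σ → R} {θ θ' : ℝ} {F G : MvPolynomial σ R}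

lemma weight_nonneg (hw : ∀ i, 0 ≤ w i) (a : σ →₀ ℕ) : 0 ≤ Finsupp.weight w a := by
  rw [Finsupp.weight_apply]
  exact Finset.sum_nonneg fun i _ => by
    exact nsmul_nonneg (hw i) (a i)

lemma IndexGE.of_nonpos (hw : ∀ i, 0 ≤ w i) (hθ : θ ≤ 0) : IndexGE w ξ θ F := fun a ha =>
  absurd ha (not_lt.mpr (hθ.trans (weight_nonneg hw a)))

lemma IndexGE.sum {ι : Type*} {s : Finset ι} {F : ι → MvPolynomial σ R}
    (h : ∀ i ∈ s, IndexGE w ξ θ (F i)) : IndexGE w ξ θ (∑ i ∈ s, F i) := by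
  intro a ha
  rw [hasse_sum, map_sum]
  exact Finset.sum_eq_zero fun i hi => h i hi a ha

lemma IndexGE.mul (hF : IndexGE w ξ θ F) (hG : IndexGE w ξ θ' G) :
    IndexGE w ξ (θ + θ') (F * G) := by
  classical
  intro a ha
  rw [hasse_mul, map_sum]
  refine Finset.sum_eq_zero fun x hx => ?_
  rw [Finset.HasAntidiagonal.mem_antidiagonal] at hx
  rw [map_mul]
  rw [← hx, map_add] at ha
  rcases lt_or_ge (Finsupp.weight w x.1) θ with h | h
  · rw [hF _ h, zero_mul]
  · rw [hG _ (by linarith), mul_zero]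

lemma IndexGE.prod (hw : ∀ i, 0 ≤ w i) {ι : Type*} {s : Finset ι} {F : ι → MvPolynomial σ R}
    {θ : ι → ℝ} (h : ∀ i ∈ s, IndexGE w ξ (θ i) (F i)) :
    IndexGE w ξ (∑ i ∈ s, θ i) (∏ i ∈ s, F i) := by
  classical
  induction s using Finset.induction_on with
  | empty => exact IndexGE.of_nonpos hw (by simp)
  | insert i s hi ih =>
    rw [Finset.sum_insert hi, Finset.prod_insert hi]
    exact (h i (Finset.mem_insert_self _ _)).mul
      (ih fun j hj => h j (Finset.mem_insert_of_mem hj))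

lemma IndexGE.det (hw : ∀ i, 0 ≤ w i) {n : ℕ} {M : Matrix (Fin n) (Fin n) (MvPolynomial σ R)}
    {θ : Fin n → ℝ} (h : ∀ i j, IndexGE w ξ (θ j) (M i j)) : IndexGE w ξ (∑ j, θ j) M.det := by
  rw [Matrix.det_apply]
  refine IndexGE.sum fun τ _ => ?_
  have h1 : IndexGE w ξ (∑ j, θ j) (∏ i, M (τ i) i) := IndexGE.prod hw fun i _ => h (τ i) i
  rcases Int.units_eq_one_or (Equiv.Perm.sign τ) with h2 | h2
  · rwa [h2, one_smul]
  · rw [h2, Units.neg_smul, one_smul]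
    intro a ha
    have h3 : hasse a (-∏ i, M (τ i) i) = -hasse a (∏ i, M (τ i) i) := by simp [hasse]
    rw [h3, map_neg, h1 a ha, neg_zero]

lemma IndexGE.hasse (hF : IndexGE w ξ θ F) (b : σ →₀ ℕ) :
    IndexGE w ξ (θ - Finsupp.weight w b) (hasse b F) := by
  intro a ha
  rw [hasse_hasse, map_mul, hF _ (by rw [map_add]; linarith), mul_zero]

lemma IndexGE.mono (hF : IndexGE w ξ θ F) (h : θ' ≤ θ) : IndexGE w ξ θ' F :=
  fun a ha => hF a (ha.trans_le h)

end Index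

section OneVariable

/-- The height of a rational number. -/
def ratHeight (x : ℚ) : ℝ := max x.num.natAbs x.den

lemma one_le_ratHeight (x : ℚ) : 1 ≤ ratHeight x :=
  le_max_of_le_right (by exact_mod_cast x.den_pos)

lemma Polynomial.ratHeight_pow_le (u : Polynomial ℤ) (hu : u ≠ 0) (x : ℚ) (k : ℕ)
    (hk : (Polynomial.X - Polynomial.C x) ^ k ∣ u.map (Int.castRingHom ℚ)) :
    ∃ i, ratHeight x ^ k ≤ |(u.coeff i : ℝ)| := by
  set l : Polynomial ℤ := Polynomial.C (x.den : ℤ) * Polynomial.X + Polynomial.C (-x.num) with hl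
  have hden : (x.den : ℤ) ≠ 0 := by exact_mod_cast x.den_ne_zero
  have hprim : l.IsPrimitive := by
    intro r hr
    rw [Polynomial.C_dvd_iff_dvd_coeff] at hr
    have h0 : r ∣ x.num := by simpa [hl] using hr 0
    have h1 : r ∣ (x.den : ℤ) := by
      simpa [hl, Polynomial.coeff_X, Polynomial.coeff_C, -map_neg, -eq_intCast] using hr 1
    have hc : IsCoprime x.num (x.den : ℤ) := by
      rw [Int.isCoprime_iff_gcd_eq_one]
      exact x.reduced
    exact hc.isUnit_of_dvd' h0 h1
  have hprimk : (l ^ k).IsPrimitive := by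
    clear hk
    induction k with
    | zero => simp
    | succ k ih => rw [pow_succ]; exact ih.mul hprim
  have hlmap : l.map (Int.castRingHom ℚ) =
      Polynomial.C (x.den : ℚ) * (Polynomial.X - Polynomial.C x) := by
    have : (x.num : ℚ) = x.den * x := (Rat.den_mul_eq_num x).symm
    rw [hl, Polynomial.map_add, Polynomial.map_mul, Polynomial.map_C, Polynomial.map_C,
      Polynomial.map_X]
    simp only [eq_intCast (Int.castRingHom ℚ)]
    rw [Int.cast_neg, Int.cast_natCast, this]
    rw [Polynomial.C_neg, Polynomial.C_mul]
    ring
  have hdvd : l ^ k ∣ u := by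
    rw [Polynomial.IsPrimitive.Int.dvd_iff_map_cast_dvd_map_cast _ _ hprimk, Polynomial.map_pow,
      hlmap, mul_pow]
    refine (IsUnit.mul_left_dvd ?_).mpr hk
    exact (Polynomial.isUnit_C.mpr (isUnit_iff_ne_zero.mpr (by exact_mod_cast hden))).pow k
  obtain ⟨g, rfl⟩ := hdvd
  have hg : g ≠ 0 := right_ne_zero_of_mul hu
  rcases le_total (x.num.natAbs : ℝ) x.den with h | h
  · refine ⟨_, (?_ : _ ≤ |((l ^ k * g).leadingCoeff : ℝ)|)⟩
    have h1 : l.leadingCoeff = x.den := Polynomial.leadingCoeff_linear hden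
    rw [Polynomial.leadingCoeff_mul, Polynomial.leadingCoeff_pow, h1, ratHeight, max_eq_right h]
    have h2 : (1 : ℝ) ≤ |(g.leadingCoeff : ℝ)| := by
      exact_mod_cast Int.one_le_abs (Polynomial.leadingCoeff_ne_zero.mpr hg)
    push_cast
    rw [abs_mul, abs_of_nonneg (by positivity : (0 : ℝ) ≤ (x.den : ℝ) ^ k)]
    exact le_mul_of_one_le_right (by positivity) h2
  · have hnum : x.num ≠ 0 := by
      rintro h0
      rw [h0] at h
      simp at h
    refine ⟨_, (?_ : _ ≤ |((l ^ k * g).trailingCoeff : ℝ)|)⟩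
    have h1 : l.trailingCoeff = -x.num := by
      rw [Polynomial.trailingCoeff, Polynomial.natTrailingDegree_eq_zero.mpr (Or.inr _)]
      · simp [hl]
      · simpa [hl] using hnum
    have htp : (l ^ k).trailingCoeff = (-x.num) ^ k := by
      clear hk hprimk hu
      induction k with
      | zero => simp [Polynomial.trailingCoeff]
      | succ k ih => rw [pow_succ, Polynomial.trailingCoeff_mul, ih, h1, pow_succ]
    rw [Polynomial.trailingCoeff_mul, htp, ratHeight, max_eq_left h]
    have h2 : (1 : ℝ) ≤ |(g.trailingCoeff : ℝ)| := by
      exact_mod_cast Int.one_le_abs (Polynomial.trailingCoeff_nonzero_iff_nonzero.mpr hg)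
    push_cast
    rw [abs_mul, abs_pow, abs_neg, Nat.cast_natAbs, Int.cast_abs]
    exact le_mul_of_one_le_right (by positivity) h2

lemma coeff_single_aeval_X {σ R : Type*} [CommRing R] (m : σ) (u : Polynomial R) (k : ℕ) :
    coeff (Finsupp.single m k) (Polynomial.aeval (X m) u : MvPolynomial σ R) = u.coeff k := by
  classical
  rw [Polynomial.aeval_eq_sum_range, coeff_sum]
  simp only [coeff_smul, coeff_X_pow, smul_eq_mul, mul_ite, mul_one, mul_zero,
    (Finsupp.single_injective m).eq_iff]
  rw [Finset.sum_ite_eq']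
  split_ifs with h
  · rfl
  · rw [Polynomial.coeff_eq_zero_of_natDegree_lt]
    simpa using h

/-- Roth's lemma in one variable. -/
lemma exists_hasse_ne_zero_of_mem_supported_singleton {σ : Type*} (m : σ)
    (U : MvPolynomial σ ℤ) (hU : U ∈ supported ℤ {m}) (hU0 : U ≠ 0) (ξ : σ → ℚ) :
    ∃ k : ℕ, eval ξ (hasse (Finsupp.single m k) (map (Int.castRingHom ℚ) U)) ≠ 0 ∧
      ratHeight (ξ m) ^ k ≤ lOne U := by
  rw [supported_eq_adjoin_X, Set.image_singleton, Algebra.adjoin_singleton_eq_range_aeval] at hU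
  obtain ⟨u, hu' : Polynomial.aeval (X m) u = U⟩ := hU
  subst hu'
  have hu : u ≠ 0 := by rintro rfl; simp at hU0
  set v := u.map (Int.castRingHom ℚ) with hv
  have hv0 : v ≠ 0 := (Polynomial.map_ne_zero_iff (RingHom.injective_int _)).mpr hu
  set k := v.rootMultiplicity (ξ m) with hk
  refine ⟨k, ?_, ?_⟩
  · have h1 : translate ξ (map (Int.castRingHom ℚ) (Polynomial.aeval (X m) u)) =
        Polynomial.aeval (X m) (v.comp (Polynomial.X + Polynomial.C (ξ m))) := by
      have : ((translate ξ).comp (map (Int.castRingHom ℚ))).comp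
          (Polynomial.aeval (X m : MvPolynomial σ ℤ) : Polynomial ℤ →ₐ[ℤ] _).toRingHom =
          ((Polynomial.aeval (X m : MvPolynomial σ ℚ) : Polynomial ℚ →ₐ[ℚ] _).toRingHom.comp
            (Polynomial.compRingHom (Polynomial.X + Polynomial.C (ξ m)))).comp
            (Polynomial.mapRingHom (Int.castRingHom ℚ)) := by
        refine Polynomial.ringHom_ext (fun a => ?_) ?_
        · simp
        · simp [translate]
      exact RingHom.congr_fun this u
    rw [← coeff_translate, h1, coeff_single_aeval_X]
    obtain ⟨q, hq, hq0⟩ :=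
      Polynomial.exists_eq_pow_rootMultiplicity_mul_and_not_dvd v hv0 (ξ m)
    rw [Polynomial.dvd_iff_isRoot, Polynomial.IsRoot.def] at hq0
    rw [hq, Polynomial.mul_comp, Polynomial.pow_comp, Polynomial.sub_comp, Polynomial.X_comp,
      Polynomial.C_comp, add_sub_cancel_right, ← hk, Polynomial.coeff_X_pow_mul',
      if_pos le_rfl, Nat.sub_self, Polynomial.coeff_zero_eq_eval_zero]
    simpa using hq0
  · obtain ⟨i, hi⟩ := Polynomial.ratHeight_pow_le u hu (ξ m) k
      (Polynomial.pow_rootMultiplicity_dvd v (ξ m))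
    refine hi.trans ?_
    have := norm_coeff_le_lOne (Polynomial.aeval (X m) u : MvPolynomial σ ℤ) (Finsupp.single m i)
    rw [coeff_single_aeval_X] at this
    exact this

end OneVariable

end MvPolynomial

namespace MvPolynomial

lemma exists_sum_mul_of_degree_le (m r : ℕ) (F : MvPolynomial ℕ ℚ) (hF0 : F ≠ 0)
    (hF : F ∈ supported ℚ (Set.Iio (m + 1))) (hr : ∀ c ∈ F.support, c m ≤ r) :
    ∃ s, 0 < s ∧ s ≤ r + 1 ∧ ∃ f g : Fin s → MvPolynomial ℕ ℚ,
      LinearIndependent ℚ f ∧ LinearIndependent ℚ g ∧ (∀ j, f j ∈ supported ℚ (Set.Iio m)) ∧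
      (∀ j, g j ∈ supported ℚ {m}) ∧ F = ∑ j, f j * g j := by
  classical
  set Fl : Fin (r + 1) → MvPolynomial ℕ ℚ :=
    fun l => slice (Finsupp.single m (l : ℕ)) (fun c => c m = 0) F with hFl
  have hFsum : F = ∑ l, Fl l * X m ^ (l : ℕ) := by
    ext c
    rw [coeff_sum]
    simp only [X_pow_eq_monomial, coeff_mul_monomial', mul_one, hFl, coeff_slice]
    by_cases hc : c m ≤ r
    · rw [Finset.sum_eq_single (⟨c m, by omega⟩ : Fin (r + 1))]
      · rw [if_pos (by simp), if_pos (by simp), tsub_add_cancel_of_le (by simp)]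
      · intro l _ hl
        split_ifs with h1 h2
        · rw [Finsupp.single_le_iff] at h1
          simp only [Finsupp.tsub_apply, Finsupp.single_eq_same] at h2
          exact absurd (Fin.ext (by simp; omega)) hl
        · rfl
        · rfl
      · simp
    · rw [notMem_support_iff.mp fun h => hc (hr c h)]
      refine (Finset.sum_eq_zero fun l _ => ?_).symm
      split_ifs with h1 h2
      · simp only [Finsupp.tsub_apply, Finsupp.single_eq_same] at h2
        omega
      · rfl
      · rfl
  obtain ⟨κ, e, he, hspan, hli⟩ := exists_linearIndependent' ℚ Fl
  have : Finite κ := Finite.of_injective e he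
  have : Fintype κ := Fintype.ofFinite κ
  set s := Fintype.card κ with hs
  let q : Fin s ≃ κ := (Fintype.equivFin κ).symm
  set f : Fin s → MvPolynomial ℕ ℚ := fun j => Fl (e (q j)) with hf
  have hlif : LinearIndependent ℚ f := hli.comp q q.injective
  have hspanf : Submodule.span ℚ (Set.range f) = Submodule.span ℚ (Set.range Fl) := by
    rw [← hspan, ← q.surjective.range_comp (Fl ∘ e)]
    rfl
  have hex : ∀ l, ∃ c : Fin s → ℚ, ∑ j, c j • f j = Fl l := fun l => by
    rw [← Submodule.mem_span_range_iff_exists_fun, hspanf]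
    exact Submodule.subset_span ⟨l, rfl⟩
  choose c hc using hex
  set g : Fin s → MvPolynomial ℕ ℚ := fun j => ∑ l, c l j • X m ^ (l : ℕ) with hg
  have hFfg : F = ∑ j, f j * g j := by
    rw [hFsum]
    simp only [hg, Finset.mul_sum]
    rw [Finset.sum_comm]
    refine Finset.sum_congr rfl fun l _ => ?_
    rw [← hc l, Finset.sum_mul]
    exact Finset.sum_congr rfl fun j _ => by rw [smul_mul_assoc, mul_smul_comm]
  have hcδ : ∀ i j, c (e (q i)) j = if i = j then 1 else 0 := by
    intro i j
    have h1 : ∑ j, c (e (q i)) j • f j = ∑ j, (if i = j then (1 : ℚ) else 0) • f j := by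
      rw [hc]
      simp [hf]
    have h2 : ∑ j, (c (e (q i)) j - if i = j then (1 : ℚ) else 0) • f j = 0 := by
      simp only [sub_smul, Finset.sum_sub_distrib]
      rw [h1, sub_self]
    exact sub_eq_zero.mp (Fintype.linearIndependent_iff.mp hlif _ h2 j)
  have hgcoeff : ∀ j (l : Fin (r + 1)), coeff (Finsupp.single m (l : ℕ)) (g j) = c l j := by
    intro j l
    rw [hg, coeff_sum]
    simp only [coeff_smul, coeff_X_pow, smul_eq_mul, mul_ite, mul_one, mul_zero,
      (Finsupp.single_injective m).eq_iff, Fin.val_inj]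
    simp
  refine ⟨s, ?_, ?_, f, g, hlif, ?_, fun j => ?_, fun j => ?_, hFfg⟩
  · rcases Nat.eq_zero_or_pos s with h | h
    · exfalso
      have : IsEmpty (Fin s) := by rw [h]; infer_instance
      exact hF0 (by rw [hFfg, Finset.univ_eq_empty, Finset.sum_empty])
    · exact h
  · simpa using Fintype.card_le_of_injective e he
  · rw [Fintype.linearIndependent_iff]
    intro x hx i
    have := congrArg (coeff (Finsupp.single m (e (q i) : ℕ))) hx
    simpa [coeff_sum, hgcoeff, hcδ] using this
  · refine mem_supported_of_coeff fun b i hi hb => ?_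
    simp only [hf, hFl, coeff_slice]
    split_ifs with h
    · refine coeff_eq_zero_of_mem_supported hF (i := i) ?_ (by simp [hb])
      have : i ≠ m := by rintro rfl; exact hb h
      simp only [Set.mem_Iio] at hi ⊢
      omega
    · rfl
  · have hX : (X m : MvPolynomial ℕ ℚ) ∈ supported ℚ ({m} : Set ℕ) := X_mem_supported.mpr rfl
    exact sum_mem fun l _ => Subalgebra.smul_mem _ (pow_mem hX _) _

lemma sum_max_sub_div_ge (r s : ℕ) (θ : ℝ) (hθ : 0 < θ) (hθ1 : θ ≤ 1) (hr : 0 < r)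
    (hs : s ≤ r + 1) : s * θ ^ 2 / 8 ≤ ∑ k ∈ Finset.range s, max 0 (θ - (k : ℝ) / r) := by
  have hr' : (1 : ℝ) ≤ r := by exact_mod_cast hr
  set K := min s (⌊r * θ / 2⌋₊ + 1) with hK
  have hKs : (s : ℝ) * θ / 4 ≤ K := by
    rw [hK, Nat.cast_min]
    refine le_min (by nlinarith [(Nat.cast_nonneg s : (0 : ℝ) ≤ s)]) ?_
    have h1 := Nat.lt_floor_add_one (r * θ / 2 : ℝ)
    have h2 : (s : ℝ) ≤ r + 1 := by exact_mod_cast hs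
    push_cast
    nlinarith
  calc s * θ ^ 2 / 8 = (s * θ / 4) * (θ / 2) := by ring
    _ ≤ K * (θ / 2) := by gcongr
    _ = ∑ k ∈ Finset.range K, θ / 2 := by simp
    _ ≤ ∑ k ∈ Finset.range K, max 0 (θ - (k : ℝ) / r) := by
        refine Finset.sum_le_sum fun k hk => le_max_of_le_right ?_
        have h1 : k ≤ ⌊r * θ / 2⌋₊ := by
          have := Finset.mem_range.mp hk
          omega
        have h2 : (k : ℝ) ≤ r * θ / 2 := (Nat.le_floor_iff (by positivity)).mp h1
        have h3 : (k : ℝ) / r ≤ θ / 2 := by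
          rw [div_le_iff₀ (by positivity)]
          linarith
        linarith
    _ ≤ _ := Finset.sum_le_sum_of_subset_of_nonneg
        (Finset.range_mono (min_le_left _ _)) fun _ _ _ => le_max_left _ _

lemma degreeOf_det_le {σ R : Type*} [CommRing R] {n : ℕ}
    (M : Matrix (Fin n) (Fin n) (MvPolynomial σ R)) (i : σ) (d : ℕ)
    (hM : ∀ j k, degreeOf i (M j k) ≤ d) : degreeOf i M.det ≤ n * d := by
  classical
  rw [Matrix.det_apply]
  refine (degreeOf_sum_le _ _ _).trans (Finset.sup_le fun τ _ => ?_)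
  have h1 : degreeOf i (∏ j, M (τ j) j) ≤ n * d := by
    refine (degreeOf_prod_le _ _ _).trans ((Finset.sum_le_sum fun j _ => hM (τ j) j).trans ?_)
    simp
  rcases Int.units_eq_one_or (Equiv.Perm.sign τ) with h | h
  · rwa [h, one_smul]
  · rw [h, Units.neg_smul, one_smul, degreeOf_eq_sup, support_neg, ← degreeOf_eq_sup]
    exact h1

lemma one_le_lOne {σ : Type*} (F : MvPolynomial σ ℤ) (hF : F ≠ 0) : 1 ≤ lOne F := by
  obtain ⟨c, hc⟩ := ne_zero_iff.mp hF
  refine le_trans ?_ (norm_coeff_le_lOne F c)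
  rw [Int.norm_eq_abs]
  exact_mod_cast Int.one_le_abs hc

lemma log_lOne_det_hasse_le {s : ℕ} (F : MvPolynomial ℕ ℤ) (hF : F ≠ 0)
    (a : Fin s → Fin s → ℕ →₀ ℕ) (N : ℕ) (hN : ∀ c ∈ F.support, c.degree ≤ N) (hs : s ≤ N + 1)
    (hW : (Matrix.of fun i j => hasse (a i j) F).det ≠ 0) :
    log (lOne (Matrix.of fun i j => hasse (a i j) F).det) ≤ s * (2 * N + log (lOne F)) := by
  have h1 := lOne_det_le (Matrix.of fun i j => hasse (a i j) F) (2 ^ N * lOne F)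
    fun i j => lOne_hasse_le _ _ _ hN
  have hF1 := one_le_lOne F hF
  rcases Nat.eq_zero_or_pos s with rfl | hs0
  · simp [lOne_one]
  have h2 : (s.factorial : ℝ) ≤ (s : ℝ) ^ s := by exact_mod_cast Nat.factorial_le_pow s
  have hs' : (0 : ℝ) < s := by exact_mod_cast hs0
  have h3 := h1.trans (mul_le_mul_of_nonneg_right h2 (by positivity))
  have h4 := log_le_log (lt_of_lt_of_le one_pos (one_le_lOne _ hW)) h3
  have e1 : log ((s : ℝ) ^ s * (2 ^ N * lOne F) ^ s) =
      s * (log s + (N * log 2 + log (lOne F))) := by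
    rw [log_mul (by positivity) (by positivity), log_pow, log_pow,
      log_mul (by positivity) (by positivity), log_pow]
    ring
  rw [e1] at h4
  refine h4.trans (mul_le_mul_of_nonneg_left ?_ hs'.le)
  have h5 : log s ≤ N := by
    have := log_le_sub_one_of_pos hs'
    have h6 : (s : ℝ) ≤ N + 1 := by exact_mod_cast hs
    linarith
  have h7 : log 2 ≤ 1 := by
    have := log_le_sub_one_of_pos (two_pos)
    linarith
  nlinarith [(Nat.cast_nonneg N : (0 : ℝ) ≤ N)]

end MvPolynomial

namespace MvPolynomial

/-- The conclusion of Roth's lemma in `m` variables with explicit parameters. -/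
def RothBound (m : ℕ) (ε σ : ℝ) : Prop :=
  ∀ (r : ℕ → ℕ) (ξ : ℕ → ℚ) (F : MvPolynomial ℕ ℤ) (R A : ℝ), F ≠ 0 →
    F ∈ supported ℤ (Set.Iio m) → (∀ h < m, 0 < r h) → (∀ h < m, degreeOf h F ≤ r h) →
    (∀ h, h + 1 < m → (r (h + 1) : ℝ) ≤ σ * r h) → ∑ h ∈ Finset.range m, (r h : ℝ) ≤ R →
    log (lOne F) + 2 * m * R ≤ A → (∀ h < m, A ≤ σ * r h * log (ratHeight (ξ h))) →
    ∃ a : ℕ →₀ ℕ, eval ξ (hasse a (map (Int.castRingHom ℚ) F)) ≠ 0 ∧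
      Finsupp.weight (fun h => 1 / (r h : ℝ)) a ≤ ε

lemma weight_single_add {w : ℕ → ℝ} (a : ℕ →₀ ℕ) (m k : ℕ) :
    Finsupp.weight w (a + Finsupp.single m k) = Finsupp.weight w a + k * w m := by
  rw [map_add, Finsupp.weight_single, nsmul_eq_mul]

lemma degree_le_sum_of_mem_supported {F : MvPolynomial ℕ ℤ} {m : ℕ} {r : ℕ → ℕ}
    (hF : F ∈ supported ℤ (Set.Iio m)) (hr : ∀ h < m, degreeOf h F ≤ r h) :
    ∀ c ∈ F.support, c.degree ≤ ∑ h ∈ Finset.range m, r h := by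
  intro c hc
  have hsub : c.support ⊆ Finset.range m := by
    intro i hi
    by_contra h
    exact mem_support_iff.mp hc (coeff_eq_zero_of_mem_supported hF (by simpa using h)
      (Finsupp.mem_support_iff.mp hi))
  rw [Finsupp.degree_apply]
  refine (Finset.sum_le_sum_of_subset hsub).trans (Finset.sum_le_sum fun h hh => ?_)
  exact degreeOf_le_iff.mp (hr h (Finset.mem_range.mp hh)) c hc

lemma degreeOf_hasse_le {σ R : Type*} [CommRing R] (a : σ →₀ ℕ) (F : MvPolynomial σ R) (i : σ) :
    degreeOf i (hasse a F) ≤ degreeOf i F := by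
  rw [degreeOf_le_iff]
  intro c hc
  have h1 : coeff (c + a) F ≠ 0 := by
    intro h
    rw [mem_support_iff, coeff_hasse, h, mul_zero] at hc
    exact hc rfl
  have := degreeOf_le_iff.mp (le_refl (degreeOf i F)) _ (mem_support_iff.mpr h1)
  simp only [Finsupp.add_apply] at this
  omega

lemma degreeOf_slice_le {σ R : Type*} [CommRing R] (d : σ →₀ ℕ) (p : (σ →₀ ℕ) → Prop)
    (F : MvPolynomial σ R) (i : σ) : degreeOf i (slice d p F) ≤ degreeOf i F := by
  classical
  rw [degreeOf_le_iff]
  intro c hc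
  have h1 : coeff (c + d) F ≠ 0 := by
    intro h
    rw [mem_support_iff, coeff_slice, h, ite_self] at hc
    exact hc rfl
  have := degreeOf_le_iff.mp (le_refl (degreeOf i F)) _ (mem_support_iff.mpr h1)
  simp only [Finsupp.add_apply] at this
  omega

lemma slice_mem_supported {σ R : Type*} [CommRing R] {S : Set σ} (d : σ →₀ ℕ)
    (F : MvPolynomial σ R) : slice d (fun c => ∀ i ∉ S, c i = 0) F ∈ supported R S := by
  classical
  refine mem_supported_of_coeff fun c i hi hc => ?_
  rw [coeff_slice, if_neg fun h => hc (h i hi)]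

lemma sum_fin_injective_eq_range {s : ℕ} (k : Fin s → ℕ) (hk : Function.Injective k)
    (hks : ∀ i, k i < s) (φ : ℕ → ℝ) : ∑ i, φ (k i) = ∑ i ∈ Finset.range s, φ i := by
  rw [← Finset.sum_image (s := Finset.univ) (g := k) (f := φ) hk.injOn]
  congr 1
  refine Finset.eq_of_subset_of_card_le (fun x hx => ?_) ?_
  · obtain ⟨i, _, rfl⟩ := Finset.mem_image.mp hx
    exact Finset.mem_range.mpr (hks i)
  · rw [Finset.card_image_of_injective _ hk]
    simp

/-- A generalized Wronskian of `F` splits as a product when one variable is separated. -/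
lemma exists_wronskian (m r : ℕ) (F : MvPolynomial ℕ ℤ) (hF0 : F ≠ 0)
    (hF : F ∈ supported ℤ (Set.Iio (m + 1))) (hr : degreeOf m F ≤ r) :
    ∃ s, 0 < s ∧ s ≤ r + 1 ∧ ∃ (a : Fin s → ℕ →₀ ℕ) (b : Fin s → ℕ) (P Q : MvPolynomial ℕ ℚ),
      (∀ i, ∀ h ∉ Set.Iio m, a i h = 0) ∧ (∀ i, (a i).degree < s) ∧ Function.Injective b ∧
      (∀ i, b i < s) ∧ P ≠ 0 ∧ Q ≠ 0 ∧ P ∈ supported ℚ (Set.Iio m) ∧ Q ∈ supported ℚ {m} ∧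
      map (Int.castRingHom ℚ)
        (Matrix.of fun i k => hasse (a i + Finsupp.single m (b k)) F).det = P * Q := by
  set ι := Int.castRingHom ℚ
  have hι : Function.Injective ι := RingHom.injective_int _
  have hsupp : (map ι F).support = F.support := support_map_of_injective _ hι
  obtain ⟨s, hs0, hsr, f, g, hf, hg, hfS, hgS, hFfg⟩ := exists_sum_mul_of_degree_le m r (map ι F)
    (by rwa [Ne, map_eq_zero_iff _ (map_injective _ hι)])
    (mem_supported_of_coeff fun c i hi hc => by
      rw [coeff_map, coeff_eq_zero_of_mem_supported hF hi hc, map_zero])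
    (fun c hc => degreeOf_le_iff.mp hr c (hsupp ▸ hc))
  obtain ⟨a, -, has, hadet⟩ := exists_det_hasse_ne_zero f hf
  obtain ⟨b, hb, hbs, hbdet⟩ := exists_det_hasse_ne_zero g hg
  have ha0 : ∀ i, ∀ h ∉ Set.Iio m, a i h = 0 := by
    intro i h hh
    by_contra hne
    exact hadet (Matrix.det_eq_zero_of_row_eq_zero i fun j =>
      hasse_eq_zero_of_mem_supported (hfS j) hh hne)
  have hb0 : ∀ i, b i = Finsupp.single m (b i m) := by
    intro i
    ext h
    by_cases hh : h = m
    · rw [hh, Finsupp.single_eq_same]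
    · rw [Finsupp.single_eq_of_ne hh]
      by_contra hne
      exact hbdet (Matrix.det_eq_zero_of_row_eq_zero i fun j =>
        hasse_eq_zero_of_mem_supported (hgS j) (by simpa using hh) hne)
  have hsub : ({m} : Set ℕ) ⊆ (Set.Iio m)ᶜ := by simp
  refine ⟨s, hs0, hsr, a, fun i => b i m, (Matrix.of fun i j => hasse (a i) (f j)).det,
    (Matrix.of fun i j => hasse (b i) (g j)).det, ha0, has, ?_, ?_, hadet, hbdet, ?_, ?_, ?_⟩
  · intro i j hij
    apply hb
    rw [hb0 i, hb0 j]
    exact congrArg _ hij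
  · intro i
    have := hbs i
    rwa [hb0 i, Finsupp.degree_single] at this
  · rw [Matrix.det_apply]
    refine sum_mem fun τ _ => ?_
    rcases Int.units_eq_one_or (Equiv.Perm.sign τ) with h | h <;> rw [h]
    · rw [one_smul]
      exact prod_mem fun i _ => hasse_mem_supported (hfS _) _
    · rw [Units.neg_smul, one_smul]
      exact neg_mem (prod_mem fun i _ => hasse_mem_supported (hfS _) _)
  · rw [Matrix.det_apply]
    refine sum_mem fun τ _ => ?_
    rcases Int.units_eq_one_or (Equiv.Perm.sign τ) with h | h <;> rw [h]
    · rw [one_smul]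
      exact prod_mem fun i _ => hasse_mem_supported (hgS _) _
    · rw [Units.neg_smul, one_smul]
      exact neg_mem (prod_mem fun i _ => hasse_mem_supported (hgS _) _)
  · rw [RingHom.map_det, ← Matrix.det_transpose (Matrix.of fun i j => hasse (b i) (g j)),
      ← Matrix.det_mul]
    congr 1
    ext1 i k
    rw [Matrix.mul_apply]
    simp only [RingHom.mapMatrix_apply, Matrix.map_apply, Matrix.of_apply, Matrix.transpose_apply]
    rw [map_hasse, ← hb0 k, hFfg, hasse_sum]
    refine Finset.sum_congr rfl fun j _ => hasse_add_mul (S := Set.Iio m) (hfS j)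
      (supported_mono hsub (hgS j)) (ha0 i) fun h hh => ?_
    rw [hb0 k, Finsupp.single_eq_of_ne]
    exact (Set.mem_Iio.mp hh).ne

lemma RothBound.succ {m : ℕ} {ε σ' σ : ℝ} (hε : 0 < ε) (hε1 : ε ≤ 1)
    (ih : RothBound m (ε ^ 2 / 32) σ') (hσ0 : 0 < σ) (hσ' : σ ≤ σ') (hσ8 : σ ≤ ε / 8)
    (hσ32 : σ ≤ ε ^ 2 / 32) : RothBound (m + 1) ε σ := by
  intro r ξ F R A hF0 hF hr0 hrd hrσ hR hA hAξ
  have hσ1 : σ ≤ 1 := by linarith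
  obtain ⟨s, hs0, hsr, a, b, P, Q, ha0, has, hb, hbs, hP0, hQ0, hP, hQ, hWPQ⟩ :=
    exists_wronskian m (r m) F hF0 hF (hrd m (by omega))
  set ι := Int.castRingHom ℚ with hι
  have hinj : Function.Injective ι := RingHom.injective_int _
  set W := (Matrix.of fun i k => hasse (a i + Finsupp.single m (b k)) F).det with hW
  have hW0 : W ≠ 0 := by
    intro h
    rw [h, map_zero] at hWPQ
    exact mul_ne_zero hP0 hQ0 hWPQ.symm
  have hs' : (0 : ℝ) < s := by exact_mod_cast hs0
  have hrm : (0 : ℝ) < r m := by exact_mod_cast hr0 m (by omega)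
  have hsum0 : 0 ≤ ∑ h ∈ Finset.range m, (r h : ℝ) := Finset.sum_nonneg fun _ _ => by positivity
  rw [Finset.sum_range_succ] at hR
  push_cast at hA
  have hF1 := one_le_lOne F hF0
  have hlogF : 0 ≤ log (lOne F) := log_nonneg hF1
  have hlogW : log (lOne W) ≤ s * (2 * R + log (lOne F)) := by
    refine (log_lOne_det_hasse_le F hF0 _ _ (degree_le_sum_of_mem_supported hF hrd) ?_ hW0).trans ?_
    · rw [Finset.sum_range_succ]
      omega
    · push_cast
      rw [Finset.sum_range_succ]
      gcongr
  have hRpos : 0 < R := by linarith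
  have hApos : 0 < A := by
    have : 0 ≤ 2 * (m : ℝ) * R := by positivity
    nlinarith
  have hWA : log (lOne W) ≤ s * A := by
    refine hlogW.trans (mul_le_mul_of_nonneg_left ?_ hs'.le)
    have : 0 ≤ 2 * (m : ℝ) * R := by positivity
    nlinarith
  have hWdeg : ∀ h < m, degreeOf h W ≤ s * r h := fun h hh =>
    degreeOf_det_le _ _ _ fun i j => (degreeOf_hasse_le _ _ _).trans (hrd h (by omega))
  -- the factor in the first `m` variables
  obtain ⟨d, hd⟩ := ne_zero_iff.mp hQ0
  have hd0 : ∀ i ∈ Set.Iio m, d i = 0 := by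
    intro i hi
    by_contra h
    exact hd (coeff_eq_zero_of_mem_supported hQ (by simpa using (Set.mem_Iio.mp hi).ne) h)
  set V := slice d (fun c => ∀ i ∉ Set.Iio m, c i = 0) W with hV
  have hVP : map ι V = C (coeff d Q) * P := by
    rw [hV, map_slice, hWPQ]
    exact slice_mul hP (supported_mono (by simp) hQ) hd0
  have hV0 : V ≠ 0 := by
    intro h
    rw [h, map_zero] at hVP
    exact mul_ne_zero (by simpa using hd) hP0 hVP.symm
  -- the factor in the last variable
  obtain ⟨d', hd'⟩ := ne_zero_iff.mp hP0
  have hd'0 : ∀ i ∈ ({m} : Set ℕ), d' i = 0 := by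
    intro i hi
    by_contra h
    exact hd' (coeff_eq_zero_of_mem_supported hP (by simp [Set.mem_singleton_iff.mp hi]) h)
  set U := slice d' (fun c => ∀ i ∉ ({m} : Set ℕ), c i = 0) W with hU
  have hUQ : map ι U = C (coeff d' P) * Q := by
    rw [hU, map_slice, hWPQ, mul_comm P Q]
    refine slice_mul hQ (supported_mono ?_ hP) hd'0
    intro i hi
    simpa using (Set.mem_Iio.mp hi).ne
  have hU0 : U ≠ 0 := by
    intro h
    rw [h, map_zero] at hUQ
    exact mul_ne_zero (by simpa using hd') hQ0 hUQ.symm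
  have hlogV : log (lOne V) ≤ log (lOne W) :=
    log_le_log (lt_of_lt_of_le one_pos (one_le_lOne V hV0)) (lOne_slice_le _ _ _)
  have hlogU : log (lOne U) ≤ log (lOne W) :=
    log_le_log (lt_of_lt_of_le one_pos (one_le_lOne U hU0)) (lOne_slice_le _ _ _)
  obtain ⟨a', ha'ξ, ha'w⟩ := ih (fun h => s * r h) ξ V (s * R) (s * A) hV0
    (slice_mem_supported _ _) (fun h hh => Nat.mul_pos hs0 (hr0 h (by omega)))
    (fun h hh => (degreeOf_slice_le _ _ _ _).trans (hWdeg h hh))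
    (fun h hh => by
      push_cast
      have h1 := hrσ h (by omega)
      have h2 : σ * (r h : ℝ) ≤ σ' * r h := by gcongr
      nlinarith)
    (by
      push_cast
      rw [← Finset.mul_sum]
      exact mul_le_mul_of_nonneg_left (by linarith) hs'.le)
    (by nlinarith)
    (fun h hh => by
      push_cast
      have h1 := hAξ h (by omega)
      have h3 : 0 ≤ (r h : ℝ) * log (ratHeight (ξ h)) :=
        mul_nonneg (by positivity) (log_nonneg (one_le_ratHeight _))
      have h2 : σ * ((r h : ℝ) * log (ratHeight (ξ h))) ≤ σ' * (r h * log (ratHeight (ξ h))) := by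
        gcongr
      have := mul_le_mul_of_nonneg_left (h1.trans (by linarith :
        _ ≤ σ' * (r h * log (ratHeight (ξ h))))) hs'.le
      linarith)
  obtain ⟨k, hkξ, hkH⟩ := exists_hasse_ne_zero_of_mem_supported_singleton m U
    (slice_mem_supported _ _) hU0 ξ
  set w : ℕ → ℝ := fun h => 1 / (r h : ℝ) with hw
  have hw0 : ∀ i, 0 ≤ w i := fun i => by positivity
  have ha'w' : Finsupp.weight w a' ≤ s * (ε ^ 2 / 32) := by
    have : Finsupp.weight w a' = s * Finsupp.weight (fun h => 1 / ((s * r h : ℕ) : ℝ)) a' := by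
      simp only [Finsupp.weight_apply, Finsupp.sum, Finset.mul_sum, nsmul_eq_mul, hw]
      refine Finset.sum_congr rfl fun i _ => ?_
      push_cast
      rcases Nat.eq_zero_or_pos (r i) with h | h
      · simp [h]
      · field_simp
    rw [this]
    gcongr
  have hkw : (k : ℝ) * w m ≤ s * σ := by
    have h1 : k * log (ratHeight (ξ m)) ≤ s * A := by
      rw [← log_pow]
      refine (log_le_log ?_ hkH).trans (hlogU.trans hWA)
      exact pow_pos (lt_of_lt_of_le one_pos (one_le_ratHeight _)) _
    have h2 := hAξ m (by omega)
    have h3 : 0 < log (ratHeight (ξ m)) := by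
      by_contra h
      have h4 : σ * r m * log (ratHeight (ξ m)) ≤ 0 :=
        mul_nonpos_of_nonneg_of_nonpos (by positivity) (not_lt.mp h)
      linarith
    have h4 : k * log (ratHeight (ξ m)) ≤ (s * (σ * r m)) * log (ratHeight (ξ m)) := by
      refine h1.trans ((mul_le_mul_of_nonneg_left h2 hs'.le).trans (le_of_eq (by ring)))
    have h5 := le_of_mul_le_mul_right h4 h3
    rw [hw]
    simp only [mul_one_div]
    rw [div_le_iff₀ hrm]
    linarith
  by_contra! hcon
  have hind : IndexGE w ξ ε (map ι F) := fun c hc => by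
    by_contra hne
    exact absurd (hcon c hne) (not_lt.mpr hc.le)
  have hrle : ∀ h < m, (r m : ℝ) ≤ σ * r h := by
    have key : ∀ j, ∀ h, h + 1 + j = m → (r m : ℝ) ≤ σ * r h := by
      intro j
      induction j with
      | zero =>
        rintro h rfl
        exact hrσ h (by omega)
      | succ j ihj =>
        intro h hh
        have h1 := ihj (h + 1) (by omega)
        have h2 := hrσ h (by omega)
        have h3 : σ * (r (h + 1) : ℝ) ≤ 1 * r (h + 1) := by gcongr
        linarith
    exact fun h hh => key (m - h - 1) h (by omega)
  have haw : ∀ i, Finsupp.weight w (a i) ≤ σ := by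
    intro i
    have h1 : Finsupp.weight w (a i) ≤ (a i).degree * (σ / r m) := by
      rw [Finsupp.weight_apply, Finsupp.sum, Finsupp.degree_apply, Nat.cast_sum, Finset.sum_mul]
      refine Finset.sum_le_sum fun h hh => ?_
      rw [nsmul_eq_mul]
      refine mul_le_mul_of_nonneg_left ?_ (Nat.cast_nonneg _)
      have hhm : h < m := by
        by_contra hne
        exact Finsupp.mem_support_iff.mp hh (ha0 i h (by simpa using hne))
      have hrh : (0 : ℝ) < r h := by exact_mod_cast hr0 h (by omega)
      rw [hw]
      simp only
      rw [div_le_div_iff₀ hrh hrm]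
      linarith [hrle h hhm]
    refine h1.trans ?_
    have h2 : ((a i).degree : ℝ) ≤ r m := by
      have := has i
      exact_mod_cast (by omega : (a i).degree ≤ r m)
    calc (a i).degree * (σ / r m) ≤ r m * (σ / r m) := by gcongr
      _ = σ := by field_simp
  have hentry : ∀ i j, IndexGE w ξ (max 0 ((ε - σ) - (b j : ℝ) / r m))
      (hasse (a i + Finsupp.single m (b j)) (map ι F)) := by
    intro i j
    rcases max_choice 0 ((ε - σ) - (b j : ℝ) / r m) with h | h <;> rw [h]
    · exact IndexGE.of_nonpos hw0 le_rfl
    · refine (hind.hasse _).mono ?_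
      rw [weight_single_add]
      have := haw i
      have h2 : (b j : ℝ) * w m = (b j : ℝ) / r m := by simp [hw, div_eq_mul_inv]
      linarith
  have hWind : IndexGE w ξ (∑ j, max 0 ((ε - σ) - (b j : ℝ) / r m)) (map ι W) := by
    rw [hW, RingHom.map_det]
    refine IndexGE.det hw0 fun i j => ?_
    simp only [RingHom.mapMatrix_apply, Matrix.map_apply, Matrix.of_apply]
    rw [map_hasse]
    exact hentry i j
  have hsumge : s * (ε - σ) ^ 2 / 8 ≤ ∑ j, max 0 ((ε - σ) - (b j : ℝ) / r m) := by
    rw [sum_fin_injective_eq_range b hb hbs fun k => max 0 ((ε - σ) - (k : ℝ) / r m)]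
    exact sum_max_sub_div_ge (r m) s (ε - σ) (by linarith) (by linarith) (hr0 m (by omega)) hsr
  have hPξ : eval ξ (hasse a' P) ≠ 0 := by
    intro h
    rw [hVP, ← smul_eq_C_mul, hasse_smul, smul_eval, h, mul_zero] at ha'ξ
    exact ha'ξ rfl
  have hQξ : eval ξ (hasse (Finsupp.single m k) Q) ≠ 0 := by
    intro h
    rw [hUQ, ← smul_eq_C_mul, hasse_smul, smul_eval, h, mul_zero] at hkξ
    exact hkξ rfl
  have ha'0 : ∀ i ∉ Set.Iio m, a' i = 0 := by
    intro i hi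
    by_contra hne
    exact hPξ (by rw [hasse_eq_zero_of_mem_supported hP hi hne, map_zero])
  have hWξ : eval ξ (hasse (a' + Finsupp.single m k) (map ι W)) ≠ 0 := by
    rw [hWPQ, hasse_add_mul (S := Set.Iio m) hP (supported_mono (by simp) hQ) ha'0
      (fun h hh => Finsupp.single_eq_of_ne (Set.mem_Iio.mp hh).ne), map_mul]
    exact mul_ne_zero hPξ hQξ
  refine hWξ (hWind _ (lt_of_lt_of_le ?_ hsumge))
  rw [weight_single_add]
  have h1 : (7 * ε / 8) ^ 2 ≤ (ε - σ) ^ 2 := by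
    apply pow_le_pow_left₀ (by positivity)
    linarith
  have h2 : s * (ε ^ 2 / 32) + s * σ < s * (ε - σ) ^ 2 / 8 := by
    have : ε ^ 2 / 32 + σ < (ε - σ) ^ 2 / 8 := by nlinarith
    nlinarith
  linarith

lemma RothBound.mono {m : ℕ} {ε ε' σ σ' : ℝ} (h : RothBound m ε σ) (hε : ε ≤ ε')
    (hσ : σ' ≤ σ) : RothBound m ε' σ' := by
  intro r ξ F R A hF0 hF hr0 hrd hrσ hR hA hAξ
  obtain ⟨a, ha, haw⟩ := h r ξ F R A hF0 hF hr0 hrd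
    (fun h hh => (hrσ h hh).trans (by gcongr)) hR hA
    fun h hh => (hAξ h hh).trans (by have := log_nonneg (one_le_ratHeight (ξ h)); gcongr)
  exact ⟨a, ha, haw.trans hε⟩

/-- **Roth's lemma**. -/
theorem exists_rothBound (m : ℕ) : ∀ ε > (0 : ℝ), ∃ σ > 0, σ ≤ 1 ∧ RothBound m ε σ := by
  induction m with
  | zero =>
    refine fun ε hε => ⟨1, one_pos, le_rfl, ?_⟩
    intro r ξ F R A hF0 hF _ _ _ _ _ _
    refine ⟨0, ?_, by simpa using hε.le⟩
    rw [hasse_zero_left]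
    rw [show Set.Iio 0 = (∅ : Set ℕ) by ext; simp, supported_empty] at hF
    obtain ⟨c, rfl⟩ := Algebra.mem_bot.mp hF
    simpa using hF0
  | succ m ih =>
    intro ε hε
    set δ := min ε 1 with hδ
    have hδ0 : 0 < δ := by positivity
    obtain ⟨σ', hσ'0, hσ'1, hσ'⟩ := ih (δ ^ 2 / 32) (by positivity)
    refine ⟨min σ' (min (δ / 8) (δ ^ 2 / 32)), by positivity, (min_le_left _ _).trans hσ'1, ?_⟩
    exact (RothBound.succ hδ0 (min_le_right _ _) hσ' (by positivity) (min_le_left _ _)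
      ((min_le_right _ _).trans (min_le_left _ _))
      ((min_le_right _ _).trans (min_le_right _ _))).mono (min_le_left _ _) le_rfl

end MvPolynomial

section Siegel

attribute [local instance] Matrix.seminormedAddCommGroup in
lemma exists_int_vec_of_two_mul_card_le {α β : Type*} [Fintype α] [Fintype β] (A : Matrix α β ℤ)
    (K : ℝ) (hK : 1 ≤ K) (hA : ∀ i j, |(A i j : ℝ)| ≤ K)
    (hαβ : 2 * Fintype.card α ≤ Fintype.card β) (hβ : 0 < Fintype.card β) :
    ∃ t : β → ℤ, t ≠ 0 ∧ A.mulVec t = 0 ∧ ∀ j, |(t j : ℝ)| ≤ Fintype.card β * K := by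
  have hβ1 : (1 : ℝ) ≤ Fintype.card β := by exact_mod_cast hβ
  rcases Nat.eq_zero_or_pos (Fintype.card α) with h0 | h0
  · have : IsEmpty α := Fintype.card_eq_zero_iff.mp h0
    have : Nonempty β := Fintype.card_pos_iff.mp hβ
    refine ⟨1, one_ne_zero, Subsingleton.elim _ _, fun j => ?_⟩
    simp only [Pi.one_apply, Int.cast_one, abs_one]
    nlinarith
  · obtain ⟨t, ht0, htA, ht⟩ := Int.Matrix.exists_ne_zero_int_vec_norm_le A (by omega) h0
    refine ⟨t, ht0, htA, fun j => ?_⟩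
    have h1 : ‖A‖ ≤ K := (Matrix.norm_le_iff (by linarith)).mpr fun i j => by
      rw [Int.norm_eq_abs]
      exact_mod_cast hA i j
    have h2 : (1 : ℝ) ≤ Fintype.card β * max 1 ‖A‖ :=
      one_le_mul_of_one_le_of_one_le hβ1 (le_max_left _ _)
    have h3 : (Fintype.card α : ℝ) / (Fintype.card β - Fintype.card α) ≤ 1 := by
      have h4 : (2 * Fintype.card α : ℝ) ≤ Fintype.card β := by exact_mod_cast hαβ
      have h5 : (1 : ℝ) ≤ Fintype.card α := by exact_mod_cast h0
      rw [div_le_one (by linarith)]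
      linarith
    have h6 := (norm_le_pi_norm t j).trans (ht.trans (rpow_le_rpow_of_exponent_le h2 h3))
    rw [rpow_one, Int.norm_eq_abs] at h6
    refine h6.trans ?_
    gcongr
    exact max_le hK h1

end Siegel

section Counting

variable {ι : Type*} [Fintype ι] [DecidableEq ι]

lemma card_mul_sum_piAntidiag (r : ℕ) (s : ι) :
    Fintype.card ι * ∑ j ∈ Finset.piAntidiag (Finset.univ : Finset ι) r, j s =
      (Finset.piAntidiag (Finset.univ : Finset ι) r).card * r := by
  have hsymm : ∀ s', ∑ j ∈ Finset.piAntidiag (Finset.univ : Finset ι) r, j s' =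
      ∑ j ∈ Finset.piAntidiag (Finset.univ : Finset ι) r, j s := by
    intro s'
    have hmem : ∀ j ∈ Finset.piAntidiag (Finset.univ : Finset ι) r,
        j ∘ Equiv.swap s s' ∈ Finset.piAntidiag (Finset.univ : Finset ι) r := by
      intro j hj
      rw [Finset.mem_piAntidiag] at hj ⊢
      refine ⟨?_, fun i _ => Finset.mem_univ i⟩
      rw [← hj.1]
      exact Equiv.sum_comp (Equiv.swap s s') j
    refine Finset.sum_nbij' (fun j => j ∘ Equiv.swap s s') (fun j => j ∘ Equiv.swap s s') hmem hmem
      ?_ ?_ ?_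
    · intro j _
      ext i
      simp
    · intro j _
      ext i
      simp
    · intro j _
      simp
  calc _ = ∑ s' : ι, ∑ j ∈ Finset.piAntidiag (Finset.univ : Finset ι) r, j s' := by
        rw [Finset.sum_congr rfl fun s' _ => hsymm s']
        simp
    _ = ∑ j ∈ Finset.piAntidiag (Finset.univ : Finset ι) r, ∑ s' : ι, j s' := Finset.sum_comm
    _ = _ := by
        rw [Finset.sum_congr rfl fun j hj => (Finset.mem_piAntidiag.mp hj).1]
        simp

lemma sum_exp_piAntidiag_le [Nonempty ι] (r : ℕ) (hr : 0 < r) (s : ι) (t : ℝ) (ht : 0 ≤ t)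
    (ht1 : t ≤ 1) :
    ∑ j ∈ Finset.piAntidiag (Finset.univ : Finset ι) r,
      exp (-t * ((j s : ℝ) / r - 1 / Fintype.card ι)) ≤
      (Finset.piAntidiag (Finset.univ : Finset ι) r).card * exp (t ^ 2) := by
  have hr' : (0 : ℝ) < r := by exact_mod_cast hr
  have hN : (1 : ℝ) ≤ Fintype.card ι := by exact_mod_cast Fintype.card_pos
  have hN' : 1 / (Fintype.card ι : ℝ) ≤ 1 := by rw [div_le_one (by linarith)]; exact hN
  set x : (ι → ℕ) → ℝ := fun j => (j s : ℝ) / r - 1 / Fintype.card ι with hx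
  have hsum : ∑ j ∈ Finset.piAntidiag (Finset.univ : Finset ι) r, x j = 0 := by
    have h := card_mul_sum_piAntidiag r s
    have h' : (Fintype.card ι : ℝ) * ∑ j ∈ Finset.piAntidiag (Finset.univ : Finset ι) r, (j s : ℝ) =
      (Finset.piAntidiag (Finset.univ : Finset ι) r).card * r := by exact_mod_cast h
    rw [hx, Finset.sum_sub_distrib, ← Finset.sum_div, Finset.sum_const, nsmul_eq_mul]
    field_simp
    linarith
  calc _ ≤ ∑ j ∈ Finset.piAntidiag (Finset.univ : Finset ι) r, (1 + t ^ 2 - t * x j) := by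
        refine Finset.sum_le_sum fun j hj => ?_
        have h1 : (j s : ℝ) / r ≤ 1 := by
          rw [div_le_one hr']
          have h2 := (Finset.mem_piAntidiag.mp hj).1
          have : j s ≤ r := h2 ▸ Finset.single_le_sum (f := j) (fun _ _ => Nat.zero_le _)
            (Finset.mem_univ s)
          exact_mod_cast this
        have h0 : 0 ≤ (j s : ℝ) / r := by positivity
        have h0' : 0 ≤ 1 / (Fintype.card ι : ℝ) := by positivity
        have hx1 : |x j| ≤ 1 := by
          rw [abs_le]
          constructor <;> simp only [hx] <;> linarith
        have hx2 : x j ^ 2 ≤ 1 := by rwa [sq_le_one_iff_abs_le_one]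
        have h3 : |-t * x j| ≤ 1 := by
          rw [abs_mul, abs_neg, abs_of_nonneg ht]
          exact mul_le_one₀ ht1 (abs_nonneg _) hx1
        have h4 := (abs_le.mp (abs_exp_sub_one_sub_id_le h3)).2
        have h5 : (-t * x j) ^ 2 ≤ t ^ 2 := by
          rw [mul_pow, neg_sq]
          exact mul_le_of_le_one_right (sq_nonneg _) hx2
        change exp (-t * x j) ≤ _
        linarith
    _ = (Finset.piAntidiag (Finset.univ : Finset ι) r).card * (1 + t ^ 2) := by
        rw [Finset.sum_sub_distrib, ← Finset.mul_sum, hsum]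
        simp
        ring
    _ ≤ _ := by
        gcongr
        linarith [add_one_le_exp (t ^ 2)]

/-- Exponents of the multihomogeneous monomials of multidegree `r`. -/
def blockExponents (ι : Type*) [Fintype ι] [DecidableEq ι] {m : ℕ} (r : Fin m → ℕ) :
    Finset (Fin m → ι → ℕ) :=
  Fintype.piFinset fun h => Finset.piAntidiag Finset.univ (r h)

lemma mem_blockExponents {m : ℕ} {r : Fin m → ℕ} {J : Fin m → ι → ℕ} :
    J ∈ blockExponents ι r ↔ ∀ h, ∑ i, J h i = r h := by
  simp [blockExponents, Fintype.mem_piFinset, Finset.mem_piAntidiag]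

lemma card_blockExponents_le {m : ℕ} (r : Fin m → ℕ) :
    ((blockExponents ι r).card : ℝ) ≤ (2 ^ Fintype.card ι) ^ ∑ h, r h := by
  have h1 : blockExponents ι r ⊆
      Fintype.piFinset fun h => Fintype.piFinset fun _ => Finset.range (r h + 1) := by
    intro J hJ
    rw [mem_blockExponents] at hJ
    rw [Fintype.mem_piFinset]
    intro h
    rw [Fintype.mem_piFinset]
    intro i
    rw [Finset.mem_range, ← hJ h, Nat.lt_succ_iff]
    exact Finset.single_le_sum (f := J h) (fun _ _ => Nat.zero_le _) (Finset.mem_univ i)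
  have h2 := Finset.card_le_card h1
  rw [Fintype.card_piFinset] at h2
  have h3 : ∏ h, (Fintype.piFinset fun _ : ι => Finset.range (r h + 1)).card ≤
      (2 ^ Fintype.card ι) ^ ∑ h, r h := by
    rw [← Finset.prod_pow_eq_pow_sum]
    refine Finset.prod_le_prod' fun h _ => ?_
    rw [Fintype.card_piFinset, Finset.prod_const, Finset.card_range, Finset.card_univ, ← pow_mul,
      mul_comm, pow_mul]
    exact Nat.pow_le_pow_left (Nat.lt_two_pow_self) _
  exact_mod_cast h2.trans h3

lemma card_blockExponents_pos [Nonempty ι] {m : ℕ} (r : Fin m → ℕ) :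
    0 < (blockExponents ι r).card := by
  obtain ⟨s⟩ := ‹Nonempty ι›
  refine Finset.card_pos.mpr ⟨fun h => Pi.single s (r h), ?_⟩
  rw [mem_blockExponents]
  intro h
  simp

lemma sum_exp_blockExponents_le [Nonempty ι] {m : ℕ} (r : Fin m → ℕ) (hr : ∀ h, 0 < r h) (s : ι)
    (t : ℝ) (ht : 0 ≤ t) (ht1 : t ≤ 1) :
    ∑ J ∈ blockExponents ι r, exp (-t * ∑ h, ((J h s : ℝ) / r h - 1 / (Fintype.card ι : ℝ))) ≤
      (blockExponents ι r).card * exp (m * t ^ 2) := by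
  simp_rw [Finset.mul_sum, exp_sum]
  rw [blockExponents, ← Finset.prod_univ_sum (fun h => Finset.piAntidiag Finset.univ (r h))
    fun h (j : ι → ℕ) => exp (-t * ((j s : ℝ) / r h - 1 / (Fintype.card ι : ℝ)))]
  refine (Finset.prod_le_prod (fun h _ => Finset.sum_nonneg fun _ _ => (exp_pos _).le)
    fun h _ => sum_exp_piAntidiag_le (r h) (hr h) s t ht ht1).trans (le_of_eq ?_)
  rw [Finset.prod_mul_distrib, Finset.prod_const, Finset.card_univ, Fintype.card_fin,
    ← exp_nat_mul, Fintype.card_piFinset, Nat.cast_prod]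

lemma card_filter_mul_exp_le {κ : Type*} (S : Finset κ) (f : κ → ℝ) (c : ℝ) :
    ((S.filter fun J => c < f J).card : ℝ) * exp c ≤ ∑ J ∈ S, exp (f J) := by
  rw [← nsmul_eq_mul, ← Finset.sum_const]
  refine (Finset.sum_le_sum (g := fun J => exp (f J)) fun J hJ =>
    exp_le_exp.mpr (Finset.mem_filter.mp hJ).2.le).trans
    (Finset.sum_le_sum_of_subset_of_nonneg (Finset.filter_subset _ _)
      fun _ _ _ => (exp_pos _).le)

lemma card_filter_blockExponents_le [Nonempty ι] {m : ℕ} (r : Fin m → ℕ) (hr : ∀ h, 0 < r h)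
    (ε : ℝ) (hε : 0 < ε) (hε1 : ε ≤ 1) (s : ι) :
    (((blockExponents ι r).filter fun J =>
      ∑ h, (J h s : ℝ) / r h < (1 / (Fintype.card ι : ℝ) - ε) * m).card : ℝ) ≤
      exp (-(m * ε ^ 2 / 4)) * (blockExponents ι r).card := by
  have h1 := card_filter_mul_exp_le (blockExponents ι r)
    (fun J => -(ε / 2) * ∑ h, ((J h s : ℝ) / r h - 1 / (Fintype.card ι : ℝ))) (ε / 2 * (m * ε))
  have h2 := sum_exp_blockExponents_le r hr s (ε / 2) (by positivity) (by linarith)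
  have h3 : ∀ J : Fin m → ι → ℕ, ε / 2 * (m * ε) <
      -(ε / 2) * ∑ h, ((J h s : ℝ) / r h - 1 / (Fintype.card ι : ℝ)) ↔
      ∑ h, (J h s : ℝ) / r h < (1 / (Fintype.card ι : ℝ) - ε) * m := by
    intro J
    rw [Finset.sum_sub_distrib, Finset.sum_const, Finset.card_univ, Fintype.card_fin, nsmul_eq_mul,
      neg_mul, ← mul_neg, mul_lt_mul_iff_right₀ (by positivity), sub_mul, mul_comm ε]
    constructor <;> intro h <;> linarith
  rw [Finset.filter_congr fun J _ => h3 J] at h1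
  have h7 : exp (m * (ε / 2) ^ 2) = exp (-(m * ε ^ 2 / 4)) * exp (ε / 2 * (m * ε)) := by
    rw [← exp_add]
    congr 1
    ring
  have h6 := h1.trans h2
  rw [h7] at h6
  refine le_of_mul_le_mul_right (h6.trans (le_of_eq (by ring))) (exp_pos (ε / 2 * (m * ε)))

end Counting

namespace MvPolynomial

section BlockSubst

variable {m : ℕ} {ι R : Type*} [Fintype ι] [CommRing R]

/-- Linear substitution of variables in each block. -/
noncomputable def blockSubst (A : Fin m → Matrix ι ι R) :
    MvPolynomial (Fin m × ι) R →ₐ[R] MvPolynomial (Fin m × ι) R :=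
  aeval fun x => ∑ s, C (A x.1 x.2 s) * X (x.1, s)

lemma blockSubst_X (A : Fin m → Matrix ι ι R) (x : Fin m × ι) :
    blockSubst A (X x) = ∑ s, C (A x.1 x.2 s) * X (x.1, s) := aeval_X _ _

lemma blockSubst_blockSubst (A B : Fin m → Matrix ι ι R) (P : MvPolynomial (Fin m × ι) R) :
    blockSubst B (blockSubst A P) = blockSubst (fun h => A h * B h) P := by
  rw [← AlgHom.comp_apply]
  congr 1
  ext1 x
  simp only [AlgHom.comp_apply, blockSubst_X, map_sum, map_mul, algHom_C, algebraMap_eq,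
    Matrix.mul_apply, Finset.mul_sum, Finset.sum_mul]
  rw [Finset.sum_comm]
  simp only [mul_assoc]

lemma map_blockSubst {S : Type*} [CommRing S] (f : R →+* S) (A : Fin m → Matrix ι ι R)
    (P : MvPolynomial (Fin m × ι) R) :
    map f (blockSubst A P) = blockSubst (fun h => (A h).map f) (map f P) := by
  induction P using MvPolynomial.induction_on with
  | C z => simp only [algHom_C, algebraMap_eq, map_C]
  | add p q hp hq => simp only [map_add, hp, hq]
  | mul_X p x hp => simp only [map_mul, hp, map_X, blockSubst_X, map_sum, map_C, Matrix.map_apply]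

variable (m ι) in
/-- The multidegree with respect to the blocks of variables. -/
noncomputable def blockWeight : Fin m × ι → Fin m → ℕ := fun x => Pi.single x.1 1

lemma weight_blockWeight (c : Fin m × ι →₀ ℕ) (h : Fin m) :
    Finsupp.weight (blockWeight m ι) c h = ∑ i, c (h, i) := by
  rw [Finsupp.weight_apply, Finsupp.sum_fintype _ _ (by simp), Finset.sum_apply,
    Fintype.sum_prod_type, Finset.sum_eq_single h]
  · simp [blockWeight]
  · intro b _ hb
    simp [blockWeight, hb.symm]
  · simp

lemma IsWeightedHomogeneous.blockSubst {P : MvPolynomial (Fin m × ι) R} {r : Fin m → ℕ}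
    (hP : IsWeightedHomogeneous (blockWeight m ι) P r) (A : Fin m → Matrix ι ι R) :
    IsWeightedHomogeneous (blockWeight m ι) (blockSubst A P) r := by
  rw [P.as_sum, map_sum]
  refine IsWeightedHomogeneous.sum _ _ _ fun c hc => ?_
  have hr : Finsupp.weight (blockWeight m ι) c = r := hP (mem_support_iff.mp hc)
  rw [MvPolynomial.blockSubst, aeval_monomial, algebraMap_eq, ← hr, Finsupp.weight_apply]
  refine IsWeightedHomogeneous.C_mul (IsWeightedHomogeneous.prod _ _ _ fun x _ =>
    IsWeightedHomogeneous.pow (IsWeightedHomogeneous.sum _ _ _ fun s _ => ?_) _) _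
  exact IsWeightedHomogeneous.C_mul (isWeightedHomogeneous_X R (blockWeight m ι) (x.1, s)) _

end BlockSubst

section Norm

lemma lOne_aeval_monomial_le {σ τ R : Type*} [NormedCommRing R] [NormOneClass R]
    (g : σ → MvPolynomial τ R) (K : ℝ) (hg : ∀ x, lOne (g x) ≤ K) (c : σ →₀ ℕ) :
    lOne (aeval g (monomial c (1 : R))) ≤ K ^ c.degree := by
  rw [aeval_monomial, map_one, one_mul, Finsupp.degree_apply, ← Finset.prod_pow_eq_pow_sum]
  refine (lOne_prod_le _ _).trans (Finset.prod_le_prod (fun _ _ => lOne_nonneg _) fun x _ => ?_)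
  exact (lOne_pow_le _ _).trans (pow_le_pow_left₀ (lOne_nonneg _) (hg x) _)

lemma lOne_sum_C_mul_X_le {τ R ι : Type*} [NormedCommRing R] [NormOneClass R] [Fintype ι]
    (z : ι → R) (y : ι → τ) : lOne (∑ s, C (z s) * X (y s) : MvPolynomial τ R) ≤ ∑ s, ‖z s‖ := by
  refine (lOne_sum_le _ _).trans (Finset.sum_le_sum fun s _ => ?_)
  rw [C_mul_X_eq_monomial, lOne_monomial]

lemma lOne_blockSubst_monomial_le {m : ℕ} {ι R : Type*} [Fintype ι] [NormedCommRing R]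
    [NormOneClass R] (A : Fin m → Matrix ι ι R) (K : ℝ) (hA : ∀ h i, ∑ s, ‖A h i s‖ ≤ K)
    (c : Fin m × ι →₀ ℕ) : lOne (blockSubst A (monomial c (1 : R))) ≤ K ^ c.degree := by
  have hg : ∀ x : Fin m × ι, lOne (∑ s, C (A x.1 x.2 s) * X (x.1, s)) ≤ K := fun x =>
    (lOne_sum_C_mul_X_le (fun s => A x.1 x.2 s) fun s => (x.1, s)).trans (hA x.1 x.2)
  have h := lOne_aeval_monomial_le (fun x : Fin m × ι => ∑ s, C (A x.1 x.2 s) * X (x.1, s)) K hg c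
  rw [blockSubst]
  exact h

end Norm

end MvPolynomial

section Auxiliary

open MvPolynomial

variable {ι : Type*}

/-- The exponent of a monomial in blocks of variables. -/
noncomputable def blockFinsupp [Fintype ι] {m : ℕ} (J : Fin m → ι → ℕ) : Fin m × ι →₀ ℕ :=
  Finsupp.equivFunOnFinite.symm (Function.uncurry J)

@[simp] lemma blockFinsupp_apply [Fintype ι] {m : ℕ} (J : Fin m → ι → ℕ) (x : Fin m × ι) :
    blockFinsupp J x = J x.1 x.2 := rfl

lemma blockFinsupp_injective [Fintype ι] {m : ℕ} :
    Function.Injective (blockFinsupp : (Fin m → ι → ℕ) → Fin m × ι →₀ ℕ) := fun J J' h => by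
  ext a s
  exact DFunLike.congr_fun h (a, s)

variable [Fintype ι] [DecidableEq ι]

lemma degree_blockFinsupp {m : ℕ} {r : Fin m → ℕ} {J : Fin m → ι → ℕ}
    (hJ : J ∈ blockExponents ι r) : (blockFinsupp J).degree = ∑ h, r h := by
  rw [Finsupp.degree_eq_sum, Fintype.sum_prod_type]
  exact Finset.sum_congr rfl fun h _ => mem_blockExponents.mp hJ h

lemma weight_blockFinsupp {m : ℕ} {r : Fin m → ℕ} {J : Fin m → ι → ℕ} :
    Finsupp.weight (blockWeight m ι) (blockFinsupp J) = r ↔ J ∈ blockExponents ι r := by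
  rw [mem_blockExponents, funext_iff]
  exact forall_congr' fun h => by rw [weight_blockWeight]; rfl

/-- The exponents with small index with respect to one of the coordinates. -/
noncomputable def smallExponents (ι : Type*) [Fintype ι] [DecidableEq ι] {m : ℕ} (r : Fin m → ℕ)
    (ε : ℝ) : Finset (Fin m → ι → ℕ) :=
  Finset.univ.biUnion fun s : ι => (blockExponents ι r).filter fun J =>
    ∑ h, (J h s : ℝ) / r h < (1 / (Fintype.card ι : ℝ) - ε) * m

lemma card_smallExponents_le [Nonempty ι] {m : ℕ} (r : Fin m → ℕ) (hr : ∀ h, 0 < r h)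
    (ε : ℝ) (hε : 0 < ε) (hε1 : ε ≤ 1) :
    ((smallExponents ι r ε).card : ℝ) ≤
      Fintype.card ι * (exp (-(m * ε ^ 2 / 4)) * (blockExponents ι r).card) := by
  have h1 : ((smallExponents ι r ε).card : ℝ) ≤ ∑ s : ι, (((blockExponents ι r).filter fun J =>
    ∑ h, (J h s : ℝ) / r h < (1 / (Fintype.card ι : ℝ) - ε) * m).card : ℝ) := by
    exact_mod_cast Finset.card_biUnion_le
  refine h1.trans ((Finset.sum_le_sum fun s _ =>
    card_filter_blockExponents_le r hr ε hε hε1 s).trans (le_of_eq ?_))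
  simp

lemma exists_two_mul_card_smallExponents_le (ι : Type*) [Fintype ι] [DecidableEq ι] [Nonempty ι]
    (D : ℕ) (ε : ℝ) (hε : 0 < ε) (hε1 : ε ≤ 1) : ∃ m₀ : ℕ, ∀ m, m₀ ≤ m →
      ∀ r : Fin m → ℕ, (∀ h, 0 < r h) →
        2 * ((smallExponents ι r ε).card * (D * D)) ≤ (blockExponents ι r).card := by
  obtain ⟨m₀, hm₀⟩ : ∃ m₀ : ℕ, ∀ m, m₀ ≤ m →
      2 * (Fintype.card ι * (D : ℝ) ^ 2) * exp (-((m : ℝ) * ε ^ 2 / 4)) ≤ 1 := by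
    have : Filter.Tendsto (fun m : ℕ => 2 * (Fintype.card ι * (D : ℝ) ^ 2) *
        exp (-((m : ℝ) * ε ^ 2 / 4))) Filter.atTop
        (nhds (2 * (Fintype.card ι * (D : ℝ) ^ 2) * 0)) := by
      refine Filter.Tendsto.const_mul _ (tendsto_exp_neg_atTop_nhds_zero.comp ?_)
      refine Filter.Tendsto.atTop_div_const (by norm_num) ?_
      exact Filter.Tendsto.atTop_mul_const (by positivity) tendsto_natCast_atTop_atTop
    rw [mul_zero] at this
    obtain ⟨m₀, h⟩ := Filter.eventually_atTop.mp (this.eventually_le_const one_pos)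
    exact ⟨m₀, h⟩
  refine ⟨m₀, fun m hm r hr => ?_⟩
  have h1 := card_smallExponents_le (ι := ι) r hr ε hε hε1
  have h2 := hm₀ m hm
  have h3 : (2 : ℝ) * ((smallExponents ι r ε).card * (D * D)) ≤ (blockExponents ι r).card := by
    calc _ = (smallExponents ι r ε).card * (2 * (D : ℝ) ^ 2) := by ring
      _ ≤ (Fintype.card ι * (exp (-(m * ε ^ 2 / 4)) * (blockExponents ι r).card)) *
        (2 * (D : ℝ) ^ 2) := mul_le_mul_of_nonneg_right h1 (by positivity)
      _ = 2 * (Fintype.card ι * (D : ℝ) ^ 2) * exp (-((m : ℝ) * ε ^ 2 / 4)) *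
        (blockExponents ι r).card := by ring
      _ ≤ 1 * (blockExponents ι r).card := mul_le_mul_of_nonneg_right h2 (by positivity)
      _ = _ := one_mul _
  exact_mod_cast h3

lemma exists_auxiliary_polynomial_of_normed [Nonempty ι] {R κ : Type*} [NormedCommRing R]
    [NormOneClass R] [Fintype κ] [DecidableEq κ] (φ : R →+* Matrix κ κ ℤ)
    (hφ : Function.Injective φ) (hnorm : ∀ x i j, |(φ x i j : ℝ)| ≤ ‖x‖) (a : Matrix ι ι R)
    (ε : ℝ) (hε : 0 < ε) (hε1 : ε ≤ 1) : ∃ m₀ : ℕ, ∃ K : ℝ, 1 ≤ K ∧ ∀ m, m₀ ≤ m →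
      ∀ r : Fin m → ℕ, (∀ h, 0 < r h) → ∃ P : MvPolynomial (Fin m × ι) ℤ, P ≠ 0 ∧
        IsWeightedHomogeneous (blockWeight m ι) P r ∧ lOne P ≤ K ^ ∑ h, r h ∧
        ∀ J ∈ smallExponents ι r ε, coeff (blockFinsupp J)
          (blockSubst (fun _ => a) (map (Int.castRingHom R) P)) = 0 := by
  obtain ⟨B, hB1, hB⟩ : ∃ B : ℝ, 1 ≤ B ∧ ∀ i, ∑ s, ‖a i s‖ ≤ B := by
    refine ⟨1 + ∑ i, ∑ s, ‖a i s‖, ?_, fun i => ?_⟩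
    · have : 0 ≤ ∑ i, ∑ s, ‖a i s‖ := Finset.sum_nonneg fun _ _ => Finset.sum_nonneg fun _ _ =>
        norm_nonneg _
      linarith
    · have := Finset.single_le_sum (f := fun i => ∑ s, ‖a i s‖)
        (fun _ _ => Finset.sum_nonneg fun _ _ => norm_nonneg _) (Finset.mem_univ i)
      linarith
  obtain ⟨m₀, hm₀⟩ :=
    exists_two_mul_card_smallExponents_le ι (Fintype.card κ) ε hε hε1
  set T : ℝ := 2 ^ Fintype.card ι
  have hT : 1 ≤ T := one_le_pow₀ (by norm_num)
  refine ⟨m₀, T * T * B, by nlinarith [mul_le_mul hT hT (by norm_num) (by linarith)],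
    fun m hm r hr => ?_⟩
  set G : (Fin m → ι → ℕ) → MvPolynomial (Fin m × ι) R := fun I =>
    blockSubst (fun _ => a) (monomial (blockFinsupp I) 1) with hG
  have hGn : ∀ I ∈ blockExponents ι r, lOne (G I) ≤ B ^ ∑ h, r h := by
    intro I hI
    have := lOne_blockSubst_monomial_le (fun _ => a) B (fun _ => hB) (blockFinsupp I)
    rwa [degree_blockFinsupp hI] at this
  set A : Matrix (smallExponents ι r ε × κ × κ) (blockExponents ι r) ℤ :=
    fun x I => φ (coeff (blockFinsupp x.1.1) (G I.1)) x.2.1 x.2.2 with hA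
  have hcard : (2 * Fintype.card (smallExponents ι r ε × κ × κ)) ≤
      Fintype.card (blockExponents ι r) := by
    simp only [Fintype.card_prod, Fintype.card_coe]
    exact hm₀ m hm r hr
  obtain ⟨t, ht0, htA, ht⟩ := exists_int_vec_of_two_mul_card_le A (B ^ ∑ h, r h)
    (one_le_pow₀ hB1) (fun x I => (hnorm _ _ _).trans
      ((norm_coeff_le_lOne _ _).trans (hGn I.1 I.2))) hcard
    (by rw [Fintype.card_coe]; exact card_blockExponents_pos r)
  rw [Fintype.card_coe] at ht
  set P : MvPolynomial (Fin m × ι) ℤ := ∑ I : blockExponents ι r, monomial (blockFinsupp I.1) (t I)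
    with hP
  refine ⟨P, ?_, ?_, ?_, ?_⟩
  · obtain ⟨I, hI⟩ := Function.ne_iff.mp ht0
    intro h0
    apply hI
    have := congrArg (coeff (blockFinsupp I.1)) h0
    rw [hP, coeff_sum, Finset.sum_eq_single I, coeff_monomial, if_pos rfl, coeff_zero] at this
    · exact this
    · intro I' _ hne
      rw [coeff_monomial, if_neg fun h => hne (Subtype.ext (blockFinsupp_injective h))]
    · simp
  · exact IsWeightedHomogeneous.sum _ _ _ fun I _ =>
      isWeightedHomogeneous_monomial _ _ _ (weight_blockFinsupp.mpr I.2)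
  · refine (lOne_sum_le _ _).trans ?_
    have hle : ∀ I ∈ (Finset.univ : Finset (blockExponents ι r)),
        lOne (monomial (blockFinsupp I.1) (t I)) ≤ (blockExponents ι r).card * B ^ ∑ h, r h := by
      intro I _
      rw [lOne_monomial, Int.norm_eq_abs]
      exact ht I
    refine (Finset.sum_le_sum hle).trans ?_
    rw [Finset.sum_const, Finset.card_univ, Fintype.card_coe, nsmul_eq_mul, ← mul_assoc, mul_pow,
      mul_pow]
    have := card_blockExponents_le (ι := ι) r
    gcongr
  · intro J hJ
    apply hφ
    rw [map_zero]
    have h1 : coeff (blockFinsupp J) (blockSubst (fun _ => a) (map (Int.castRingHom R) P)) =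
        ∑ I : blockExponents ι r, (t I : R) * coeff (blockFinsupp J) (G I.1) := by
      rw [hP, map_sum, map_sum, coeff_sum]
      refine Finset.sum_congr rfl fun I _ => ?_
      rw [map_monomial, hG, ← coeff_C_mul, eq_intCast]
      congr 1
      have : monomial (blockFinsupp I.1) (t I : R) =
        C (t I : R) * monomial (blockFinsupp I.1) 1 := by rw [C_mul_monomial, mul_one]
      rw [this, map_mul, algHom_C, algebraMap_eq]
    rw [h1, map_sum]
    ext i j
    have h2 := congrFun htA ⟨⟨J, hJ⟩, i, j⟩
    rw [Matrix.mulVec, dotProduct, Pi.zero_apply] at h2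
    rw [Matrix.sum_apply, Matrix.zero_apply, ← h2]
    refine Finset.sum_congr rfl fun I _ => ?_
    rw [map_mul, map_intCast, ← zsmul_eq_mul, Matrix.smul_apply, smul_eq_mul, mul_comm]

attribute [local instance] Matrix.linftyOpNormedRing in
/-- Existence of the auxiliary polynomial. -/
lemma exists_auxiliary_polynomial [Nonempty ι] {R : Type*} [CommRing R] [Nontrivial R]
    [Module.Free ℤ R] [Module.Finite ℤ R] (a : Matrix ι ι R)
    (ε : ℝ) (hε : 0 < ε) (hε1 : ε ≤ 1) : ∃ m₀ : ℕ, ∃ K : ℝ, 1 ≤ K ∧ ∀ m, m₀ ≤ m →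
      ∀ r : Fin m → ℕ, (∀ h, 0 < r h) → ∃ P : MvPolynomial (Fin m × ι) ℤ, P ≠ 0 ∧
        IsWeightedHomogeneous (blockWeight m ι) P r ∧ lOne P ≤ K ^ ∑ h, r h ∧
        ∀ J ∈ smallExponents ι r ε, coeff (blockFinsupp J)
          (blockSubst (fun _ => a) (map (Int.castRingHom R) P)) = 0 := by
  classical
  let b := Module.Free.chooseBasis ℤ R
  let φ : R →+* Matrix (Module.Free.ChooseBasisIndex ℤ R) (Module.Free.ChooseBasisIndex ℤ R) ℤ :=
    (Algebra.leftMulMatrix b).toRingHom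
  have hφ : Function.Injective φ := Algebra.leftMulMatrix_injective b
  have : Nonempty (Module.Free.ChooseBasisIndex ℤ R) := b.index_nonempty
  let _ : NormedCommRing R := NormedCommRing.induced R _ φ hφ
  have : NormOneClass R := NormOneClass.induced R _ φ
  refine exists_auxiliary_polynomial_of_normed φ hφ (fun x i j => ?_) a ε hε hε1
  change _ ≤ ‖φ x‖
  have h1 : ‖φ x i j‖₊ ≤ ∑ j, ‖φ x i j‖₊ :=
    Finset.single_le_sum (f := fun j => ‖φ x i j‖₊) (fun _ _ => bot_le) (Finset.mem_univ j)
  have h2 : ∑ j, ‖φ x i j‖₊ ≤ ‖φ x‖₊ := by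
    rw [Matrix.linfty_opNNNorm_def]
    exact Finset.le_sup (f := fun i => ∑ j, ‖φ x i j‖₊) (Finset.mem_univ i)
  have h3 : ‖φ x i j‖ ≤ ‖φ x‖ := by exact_mod_cast h1.trans h2
  rwa [Int.norm_eq_abs] at h3

end Auxiliary

namespace MvPolynomial

section Extraction

variable {m : ℕ} {ι : Type*}

/-- The exponent collecting one chosen variable of each block. -/
noncomputable def chosenExp (i : Fin m → ι) (I : Fin m × ι →₀ ℕ) : ℕ →₀ ℕ :=
  ∑ h : Fin m, Finsupp.single (h : ℕ) (I (h, i h))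

lemma chosenExp_apply (i : Fin m → ι) (I : Fin m × ι →₀ ℕ) (h : Fin m) :
    chosenExp i I h = I (h, i h) := by
  rw [chosenExp, Finsupp.finsetSum_apply, Finset.sum_eq_single h]
  · simp
  · intro b _ hb
    rw [Finsupp.single_apply, if_neg fun h' => hb (Fin.ext h')]
  · simp

lemma chosenExp_apply_of_le (i : Fin m → ι) (I : Fin m × ι →₀ ℕ) (h : ℕ) (hm : m ≤ h) :
    chosenExp i I h = 0 := by
  rw [chosenExp, Finsupp.finsetSum_apply]
  refine Finset.sum_eq_zero fun b _ => ?_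
  rw [Finsupp.single_apply, if_neg (by omega)]

lemma weight_chosenExp (i : Fin m → ι) (I : Fin m × ι →₀ ℕ) (w : ℕ → ℝ) :
    Finsupp.weight w (chosenExp i I) = ∑ h : Fin m, I (h, i h) * w h := by
  rw [chosenExp, map_sum]
  refine Finset.sum_congr rfl fun h _ => ?_
  rw [Finsupp.weight_single, nsmul_eq_mul]

variable [DecidableEq ι]

/-- The part of an exponent outside of two chosen variables in each block. -/
def otherExp (i j : Fin m → ι) (I : Fin m × ι →₀ ℕ) : Fin m × ι →₀ ℕ :=
  I.filter fun x => x.2 ≠ i x.1 ∧ x.2 ≠ j x.1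

variable [Fintype ι]

lemma eq_of_chosenExp_eq_of_otherExp_eq {i j : Fin m → ι}
    {I I' : Fin m × ι →₀ ℕ}
    (hI : Finsupp.weight (blockWeight m ι) I = Finsupp.weight (blockWeight m ι) I')
    (h1 : chosenExp i I = chosenExp i I') (h2 : otherExp i j I = otherExp i j I') : I = I' := by
  have key : ∀ h s, s ≠ j h → I (h, s) = I' (h, s) := by
    intro h s hs
    by_cases hsi : s = i h
    · rw [hsi, ← chosenExp_apply, ← chosenExp_apply, h1]
    · have := DFunLike.congr_fun h2 (h, s)
      rwa [otherExp, otherExp, Finsupp.filter_apply, Finsupp.filter_apply, if_pos ⟨hsi, hs⟩,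
        if_pos ⟨hsi, hs⟩] at this
  ext ⟨h, s⟩
  by_cases hs : s = j h
  · have h3 := congrFun hI h
    rw [weight_blockWeight, weight_blockWeight,
      ← Finset.add_sum_erase _ (fun s => I (h, s)) (Finset.mem_univ (j h)),
      ← Finset.add_sum_erase _ (fun s => I' (h, s)) (Finset.mem_univ (j h)),
      Finset.sum_congr rfl fun s hs => key h s (Finset.ne_of_mem_erase hs)] at h3
    rw [hs]
    exact Nat.add_right_cancel h3
  · exact key h s hs

/-- Dehomogenization in each block, keeping the other variables. -/
noncomputable def dehom (i j : Fin m → ι) (ξ : ℕ → ℚ) (v : Fin m → ι → ℚ) :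
    MvPolynomial (Fin m × ι) ℚ →+* MvPolynomial (Fin m × ι) (MvPolynomial ℕ ℚ) :=
  eval₂Hom (C.comp C) fun x => if x.2 = i x.1 then
    C (X (x.1 : ℕ) + C (ξ x.1)) -
      ∑ s ∈ (Finset.univ.erase (i x.1)).erase (j x.1), C (C (v x.1 s)) * X (x.1, s)
    else if x.2 = j x.1 then 1 else X x

lemma dehom_linear {i j : Fin m → ι} (hij : ∀ h, i h ≠ j h) {ξ : ℕ → ℚ} {v : Fin m → ι → ℚ}
    (hi : ∀ h, v h (i h) = 1) (hj : ∀ h, v h (j h) = -ξ h) (h : Fin m) :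
    dehom i j ξ v (∑ s, C (v h s) * X (h, s)) = C (X (h : ℕ)) := by
  have hjm : j h ∈ Finset.univ.erase (i h) := Finset.mem_erase.mpr ⟨(hij h).symm, Finset.mem_univ _⟩
  rw [← Finset.add_sum_erase _ _ (Finset.mem_univ (i h)), ← Finset.add_sum_erase _ _ hjm, hi, hj,
    map_add, map_add, map_sum]
  have h1 : dehom i j ξ v (X (h, i h)) = C (X (h : ℕ) + C (ξ h)) -
      ∑ s ∈ (Finset.univ.erase (i h)).erase (j h), C (C (v h s)) * X (h, s) := by
    simp [dehom]
  have h2 : dehom i j ξ v (X (h, j h)) = 1 := by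
    simp [dehom, (hij h).symm]
  have h3 : ∀ s ∈ (Finset.univ.erase (i h)).erase (j h),
      dehom i j ξ v (C (v h s) * X (h, s)) = C (C (v h s)) * X (h, s) := by
    intro s hs
    rw [Finset.mem_erase, Finset.mem_erase] at hs
    simp [dehom, hs.1, hs.2.1]
  have h4 : ∀ z : ℚ, dehom i j ξ v (C z) = C (C z) := fun z => by simp [dehom]
  rw [Finset.sum_congr rfl h3, map_mul, map_mul, h1, h2, h4, h4]
  simp only [C_1, map_add, map_neg, one_mul, mul_one]
  ring

lemma coeff_coeff_dehom_blockSubst {i j : Fin m → ι} (hij : ∀ h, i h ≠ j h) {ξ : ℕ → ℚ}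
    {W : Fin m → Matrix ι ι ℚ} {t : ι} (hi : ∀ h, W h t (i h) = 1) (hj : ∀ h, W h t (j h) = -ξ h)
    (f : MvPolynomial (Fin m × ι) ℚ) (K₀ : Fin m × ι →₀ ℕ) (a : ℕ →₀ ℕ)
    (ha : coeff a (coeff K₀ (dehom i j ξ (fun h => W h t) (blockSubst W f))) ≠ 0) :
    ∃ K ∈ f.support, chosenExp (fun _ => t) K ≤ a := by
  by_contra! hcon
  apply ha
  rw [f.as_sum, map_sum, map_sum, coeff_sum, coeff_sum]
  refine Finset.sum_eq_zero fun K hK => ?_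
  obtain ⟨B, hB⟩ : ∃ B, dehom i j ξ (fun h => W h t) (blockSubst W (monomial K (coeff K f))) =
      C (monomial (chosenExp (fun _ => t) K) 1) * B := by
    rw [blockSubst, aeval_monomial, map_mul, Finsupp.prod_fintype _ _ (by simp), map_prod,
      Fintype.prod_prod_type]
    have hh : ∀ h : Fin m, ∏ s, dehom i j ξ (fun h => W h t)
        ((∑ s', C (W h s s') * X (h, s')) ^ K (h, s)) =
        C (X (h : ℕ)) ^ K (h, t) * ∏ s ∈ Finset.univ.erase t, dehom i j ξ (fun h => W h t)
        ((∑ s', C (W h s s') * X (h, s')) ^ K (h, s)) := by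
      intro h
      rw [← Finset.mul_prod_erase _ _ (Finset.mem_univ t), map_pow,
        dehom_linear (v := fun h => W h t) hij hi hj]
    rw [Finset.prod_congr rfl fun h _ => hh h, Finset.prod_mul_distrib]
    have hm : (C (monomial (chosenExp (fun _ => t) K) 1) :
        MvPolynomial (Fin m × ι) (MvPolynomial ℕ ℚ)) = ∏ h : Fin m, C (X (h : ℕ)) ^ K (h, t) := by
      rw [chosenExp, monomial_sum_one, map_prod]
      exact Finset.prod_congr rfl fun h _ => by rw [← map_pow, X_pow_eq_monomial]
    rw [hm, mul_left_comm]
    exact ⟨_, rfl⟩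
  rw [hB, coeff_C_mul, coeff_monomial_mul', if_neg (hcon K hK)]

lemma coeff_dehom_monomial {i j : Fin m → ι} (hij : ∀ h, i h ≠ j h) (ξ : ℕ → ℚ)
    (v : Fin m → ι → ℚ) (I K₀ : Fin m × ι →₀ ℕ) (z : ℚ)
    (hK : K₀.degree ≤ (otherExp i j I).degree) :
    coeff K₀ (dehom i j ξ v (monomial I z)) =
      if otherExp i j I = K₀ then translate ξ (monomial (chosenExp i I) z) else 0 := by
  have hmon : dehom i j ξ v (monomial I z) =
      (C (C z) * ∏ h : Fin m, (C (X (h : ℕ) + C (ξ h)) -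
        ∑ s ∈ (Finset.univ.erase (i h)).erase (j h),
        C (C (v h s)) * X (h, s)) ^ I (h, i h)) * monomial (otherExp i j I) 1 := by
    rw [dehom, coe_eval₂Hom, eval₂_monomial, RingHom.comp_apply, mul_assoc,
      Finsupp.prod_fintype _ _ (by simp)]
    congr 1
    have hoth : (monomial (otherExp i j I) 1 : MvPolynomial (Fin m × ι) (MvPolynomial ℕ ℚ)) =
        ∏ x : Fin m × ι, if x.2 ≠ i x.1 ∧ x.2 ≠ j x.1 then X x ^ I x else 1 := by
      rw [monomial_eq, C_1, one_mul, Finsupp.prod_fintype _ _ (by simp)]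
      refine Finset.prod_congr rfl fun x _ => ?_
      rw [otherExp, Finsupp.filter_apply]
      split_ifs <;> simp
    rw [hoth, Fintype.prod_prod_type, Fintype.prod_prod_type, ← Finset.prod_mul_distrib]
    refine Finset.prod_congr rfl fun h _ => ?_
    rw [← Finset.mul_prod_erase _ _ (Finset.mem_univ (i h)),
      ← Finset.mul_prod_erase _ (fun s => if s ≠ i h ∧ s ≠ j h then _ else _)
        (Finset.mem_univ (i h))]
    simp only [if_true, ne_eq, not_true_eq_false, false_and, if_false, one_mul]
    congr 1
    refine Finset.prod_congr rfl fun s hs => ?_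
    have hsi := Finset.ne_of_mem_erase hs
    by_cases hsj : s = j h <;> simp [hsi, hsj, (hij h).symm]
  rw [hmon, coeff_mul_monomial']
  by_cases hle : otherExp i j I ≤ K₀
  · have heq : otherExp i j I = K₀ := by
      obtain ⟨c, hc⟩ := exists_add_of_le hle
      rw [hc, map_add] at hK
      have : c.degree = 0 := by omega
      rw [Finsupp.degree_eq_zero_iff] at this
      rw [hc, this, add_zero]
    rw [if_pos hle, if_pos heq, heq, tsub_self, mul_one, ← constantCoeff_eq, map_mul, map_prod]
    simp only [map_pow, map_sub, constantCoeff_C, map_sum, map_mul, constantCoeff_X, mul_zero,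
      Finset.sum_const_zero, sub_zero]
    have hmz : monomial (chosenExp i I) z = C z * monomial (chosenExp i I) 1 := by
      rw [C_mul_monomial, mul_one]
    rw [hmz, chosenExp, monomial_sum_one, map_mul (translate ξ), map_prod (translate ξ)]
    congr 1
    · simp [translate]
    · refine Finset.prod_congr rfl fun h _ => ?_
      rw [← X_pow_eq_monomial, map_pow]
      simp [translate]
  · rw [if_neg hle, if_neg fun h => hle h.le]

/-- From a multihomogeneous polynomial, extract a polynomial in one variable per block. -/
theorem exists_polynomial_of_blockSubst {i j : Fin m → ι} (hij : ∀ h, i h ≠ j h) {ξ : ℕ → ℚ}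
    {Y : Fin m → Matrix ι ι ℤ} {W : Fin m → Matrix ι ι ℚ} {t : ι}
    (hYW : ∀ h, (Y h).map (Int.castRingHom ℚ) * W h = 1)
    (hi : ∀ h, W h t (i h) = 1) (hj : ∀ h, W h t (j h) = -ξ h)
    {P : MvPolynomial (Fin m × ι) ℤ} (hP : P ≠ 0) {r : ℕ → ℕ}
    (hPr : IsWeightedHomogeneous (blockWeight m ι) P fun h : Fin m => r h) {θ : ℝ}
    (hθ : ∀ K ∈ (blockSubst Y P).support, θ ≤ ∑ h : Fin m, (K (h, t) : ℝ) / r h) :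
    ∃ F : MvPolynomial ℕ ℤ, F ≠ 0 ∧ F ∈ supported ℤ (Set.Iio m) ∧ (∀ h < m, degreeOf h F ≤ r h) ∧
      lOne F ≤ lOne P ∧ ∀ a, eval ξ (hasse a (map (Int.castRingHom ℚ) F)) ≠ 0 →
        θ ≤ Finsupp.weight (fun h => 1 / (r h : ℝ)) a := by
  obtain ⟨I₀, hI₀, hmin⟩ := Finset.exists_min_image P.support (fun I => (otherExp i j I).degree)
    (support_nonempty.mpr hP)
  set K₀ := otherExp i j I₀ with hK₀
  set S := P.support.filter fun I => otherExp i j I = K₀ with hS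
  have hSmem : ∀ I ∈ S, I ∈ P.support := fun I hI => (Finset.mem_filter.mp hI).1
  have hw : ∀ I ∈ P.support, Finsupp.weight (blockWeight m ι) I =
      fun h : Fin m => r h := fun I hI =>
    hPr (mem_support_iff.mp hI)
  set F : MvPolynomial ℕ ℤ := ∑ I ∈ S, monomial (chosenExp i I) (coeff I P) with hF
  have hsupp : ∀ c, coeff c F ≠ 0 → ∃ I ∈ S, chosenExp i I = c := by
    intro c hc
    rw [hF, coeff_sum] at hc
    obtain ⟨I, hI, hne⟩ := Finset.exists_ne_zero_of_sum_ne_zero hc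
    rw [coeff_monomial] at hne
    exact ⟨I, hI, by by_contra h; exact hne (if_neg h)⟩
  refine ⟨F, ?_, ?_, ?_, ?_, ?_⟩
  · intro h0
    have h1 := congrArg (coeff (chosenExp i I₀)) h0
    have hI₀S : I₀ ∈ S := Finset.mem_filter.mpr ⟨hI₀, rfl⟩
    rw [hF, coeff_sum, Finset.sum_eq_single_of_mem I₀ hI₀S, coeff_monomial, if_pos rfl,
      coeff_zero] at h1
    · exact mem_support_iff.mp hI₀ h1
    · intro I hI hne
      rw [coeff_monomial, if_neg]
      intro heq
      refine hne (eq_of_chosenExp_eq_of_otherExp_eq ?_ heq (Finset.mem_filter.mp hI).2)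
      rw [hw I (hSmem I hI), hw I₀ hI₀]
  · refine mem_supported_of_coeff fun c h hh hch => ?_
    by_contra hc
    obtain ⟨I, _, rfl⟩ := hsupp c hc
    exact hch (chosenExp_apply_of_le i I h (by simpa using hh))
  · intro h hh
    rw [degreeOf_le_iff]
    intro c hc
    obtain ⟨I, hI, rfl⟩ := hsupp c (mem_support_iff.mp hc)
    have h1 := congrFun (hw I (hSmem I hI)) ⟨h, hh⟩
    rw [weight_blockWeight] at h1
    have h2 := chosenExp_apply i I ⟨h, hh⟩
    rw [← h1]
    refine h2.le.trans ?_
    exact Finset.single_le_sum (f := fun s => I (⟨h, hh⟩, s)) (fun _ _ => Nat.zero_le _)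
      (Finset.mem_univ _)
  · refine (lOne_sum_le _ _).trans ?_
    rw [lOne]
    refine (Finset.sum_le_sum fun I _ => (lOne_monomial _ _).le).trans ?_
    exact Finset.sum_le_sum_of_subset_of_nonneg (Finset.filter_subset _ _)
      fun _ _ _ => norm_nonneg _
  · intro a ha
    rw [← coeff_translate] at ha
    have h1 : coeff K₀ (dehom i j ξ (fun h => W h t) (map (Int.castRingHom ℚ) P)) =
        translate ξ (map (Int.castRingHom ℚ) F) := by
      conv_lhs => rw [P.as_sum]
      rw [map_sum, map_sum, coeff_sum, hF, map_sum, map_sum, hS, Finset.sum_filter]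
      refine Finset.sum_congr rfl fun I hI => ?_
      rw [map_monomial, coeff_dehom_monomial hij _ _ _ _ _ (hmin I hI), map_monomial]
    have h2 : map (Int.castRingHom ℚ) P =
        blockSubst W (map (Int.castRingHom ℚ) (blockSubst Y P)) := by
      rw [map_blockSubst, blockSubst_blockSubst]
      simp only [hYW]
      rw [blockSubst]
      conv_lhs => rw [← aeval_X_left_apply (map (Int.castRingHom ℚ) P)]
      congr 2
      ext1 x
      simp [Matrix.one_apply]
    rw [← h1, h2] at ha
    obtain ⟨K, hK, hKa⟩ := coeff_coeff_dehom_blockSubst hij hi hj _ _ _ ha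
    have hK' : K ∈ (blockSubst Y P).support := support_map_subset _ _ hK
    refine (hθ K hK').trans ?_
    obtain ⟨c, hc⟩ := exists_add_of_le hKa
    have h3 := weight_chosenExp (fun _ => t) K fun h => 1 / (r h : ℝ)
    have h4 := weight_nonneg (w := fun h => 1 / (r h : ℝ)) (fun _ => by positivity) c
    rw [hc, map_add, h3]
    simp only [mul_one_div]
    linarith

end Extraction

end MvPolynomial

section IntegralSpan

lemma moduleFree_adjoin_range {κ : Type*} [Finite κ] (a : κ → ℝ) (ha : ∀ i, IsIntegral ℤ (a i)) :
    Module.Finite ℤ (Algebra.adjoin ℤ (Set.range a)) ∧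
      Module.Free ℤ (Algebra.adjoin ℤ (Set.range a)) := by
  have h1 : Module.Finite ℤ (Algebra.adjoin ℤ (Set.range a)) :=
    Algebra.finite_adjoin_of_finite_of_isIntegral (Set.finite_range a)
      (by rintro x ⟨i, rfl⟩; exact ha i)
  exact ⟨h1, Module.free_of_finite_type_torsion_free'⟩

/-- A Liouville type inequality for integer combinations of algebraic integers. -/
lemma exists_le_abs_sum_mul_pow {κ : Type*} [Fintype κ] (a : κ → ℝ)
    (ha : ∀ i, IsIntegral ℤ (a i)) : ∃ c > (0 : ℝ), ∃ D : ℕ, ∀ V : κ → ℤ, ∀ B : ℝ, 1 ≤ B →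
      (∀ i, |(V i : ℝ)| ≤ B) → ∑ i, V i * a i ≠ 0 → c ≤ |∑ i, V i * a i| * B ^ D := by
  classical
  obtain ⟨_, _⟩ := moduleFree_adjoin_range a ha
  set R := Algebra.adjoin ℤ (Set.range a)
  let b := Module.Free.chooseBasis ℤ R
  set τ := Module.Free.ChooseBasisIndex ℤ R
  let a' : κ → R := fun i => ⟨a i, Algebra.subset_adjoin ⟨i, rfl⟩⟩
  have hne : Nonempty τ := b.index_nonempty
  obtain ⟨j⟩ := hne
  set v : τ → ℝ := fun i => (b i : ℝ) with hv
  have hvj : v j ≠ 0 := fun h => b.ne_zero j (Subtype.ext h)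
  set K : ℝ := 1 + ∑ i, ∑ x, ∑ y, |((Algebra.leftMulMatrix b (a' i) x y : ℤ) : ℝ)| with hK
  have hK1 : 1 ≤ K := by
    rw [hK]
    have : 0 ≤ ∑ i, ∑ x, ∑ y, |((Algebra.leftMulMatrix b (a' i) x y : ℤ) : ℝ)| := by positivity
    linarith
  set D := Fintype.card τ
  set S : ℝ := ∑ i, |v i| with hS
  have hSpos : 0 < S := Finset.sum_pos' (fun _ _ => abs_nonneg _)
    ⟨j, Finset.mem_univ _, abs_pos.mpr hvj⟩
  refine ⟨|v j| / (S * (D.factorial * K ^ D)), by positivity, D, fun V B hB hV hw => ?_⟩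
  set w : R := ∑ i, V i • a' i with hwdef
  have hwr : (w : ℝ) = ∑ i, V i * a i := by
    rw [hwdef]
    push_cast
    refine Finset.sum_congr rfl fun i _ => ?_
    rw [zsmul_eq_mul]
  rw [← hwr] at hw ⊢
  set T := Algebra.leftMulMatrix b w with hT
  have hTe : ∀ x y, |((T x y : ℤ) : ℝ)| ≤ K * B := by
    intro x y
    rw [hT, hwdef, map_sum, Matrix.sum_apply]
    simp only [map_zsmul, Matrix.smul_apply, smul_eq_mul]
    push_cast
    refine (Finset.abs_sum_le_sum_abs _ _).trans ?_
    calc _ ≤ ∑ i, B * ∑ x, ∑ y, |((Algebra.leftMulMatrix b (a' i) x y : ℤ) : ℝ)| := by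
          refine Finset.sum_le_sum fun i _ => ?_
          rw [abs_mul]
          have h1 : |((Algebra.leftMulMatrix b (a' i) x y : ℤ) : ℝ)| ≤
              ∑ x, ∑ y, |((Algebra.leftMulMatrix b (a' i) x y : ℤ) : ℝ)| :=
            (Finset.single_le_sum
              (f := fun y => |((Algebra.leftMulMatrix b (a' i) x y : ℤ) : ℝ)|)
              (fun _ _ => abs_nonneg _) (Finset.mem_univ y)).trans
            (Finset.single_le_sum
              (f := fun x => ∑ y, |((Algebra.leftMulMatrix b (a' i) x y : ℤ) : ℝ)|)
              (fun _ _ => Finset.sum_nonneg fun _ _ => abs_nonneg _) (Finset.mem_univ x))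
          exact mul_le_mul (hV i) h1 (abs_nonneg _) (by linarith)
      _ ≤ K * B := by
          rw [← Finset.mul_sum, hK]
          nlinarith
  have hKB : 1 ≤ K * B := one_le_mul_of_one_le_of_one_le hK1 hB
  have hadj : ∀ x y, |((T.adjugate x y : ℤ) : ℝ)| ≤ D.factorial * (K * B) ^ D := by
    intro x y
    rw [Matrix.adjugate_apply]
    have := Matrix.det_le (A := (T.updateRow y (Pi.single x 1)).map (Int.castRingHom ℝ))
      (abv := AbsoluteValue.abs) (x := K * B) (fun i' j' => by
        rw [Matrix.map_apply, Matrix.updateRow_apply]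
        split_ifs
        · rw [Pi.single_apply]
          split_ifs <;> simp <;> linarith
        · exact hTe i' j')
    rw [← RingHom.mapMatrix_apply, ← RingHom.map_det, nsmul_eq_mul] at this
    exact this
  have hmul : ∀ y, ∑ x, v x * (T x y : ℝ) = w * v y := by
    intro y
    have h1 := congrArg (Subtype.val : R → ℝ) (b.sum_repr (w * b y))
    rw [MulMemClass.coe_mul] at h1
    rw [hv, ← h1]
    push_cast
    refine Finset.sum_congr rfl fun x _ => ?_
    rw [hT, Algebra.leftMulMatrix_eq_repr_mul, zsmul_eq_mul, mul_comm]
  have hdet : T.det ≠ 0 := by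
    rw [hT, ← Algebra.norm_eq_matrix_det b]
    exact (Algebra.norm_ne_zero_iff_of_basis b).mpr fun h => hw (by rw [h]; rfl)
  have hdetr : (T.det : ℝ) * v j = w * ∑ y, v y * (T.adjugate y j : ℝ) := by
    calc _ = ∑ x, v x * (((T * T.adjugate) x j : ℤ) : ℝ) := by
          rw [Matrix.mul_adjugate]
          simp [Matrix.smul_apply, Matrix.one_apply, mul_comm]
      _ = ∑ x, ∑ y, v x * T x y * T.adjugate y j := by
          refine Finset.sum_congr rfl fun x _ => ?_
          rw [Matrix.mul_apply]
          push_cast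
          rw [Finset.mul_sum]
          exact Finset.sum_congr rfl fun y _ => by ring
      _ = ∑ y, (∑ x, v x * T x y) * T.adjugate y j := by
          rw [Finset.sum_comm]
          exact Finset.sum_congr rfl fun y _ => by rw [Finset.sum_mul]
      _ = _ := by
          rw [Finset.mul_sum]
          exact Finset.sum_congr rfl fun y _ => by rw [hmul]; ring
  have h1 : |v j| ≤ |(T.det : ℝ) * v j| := by
    rw [abs_mul]
    have : (1 : ℝ) ≤ |(T.det : ℝ)| := by exact_mod_cast Int.one_le_abs hdet
    exact le_mul_of_one_le_left (abs_nonneg _) this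
  have h2 : |∑ y, v y * (T.adjugate y j : ℝ)| ≤ S * (D.factorial * (K * B) ^ D) := by
    refine (Finset.abs_sum_le_sum_abs _ _).trans ?_
    rw [hS, Finset.sum_mul]
    refine Finset.sum_le_sum fun y _ => ?_
    rw [abs_mul]
    exact mul_le_mul_of_nonneg_left (hadj y j) (abs_nonneg _)
  rw [div_le_iff₀ (by positivity)]
  calc |v j| ≤ |(w : ℝ)| * |∑ y, v y * (T.adjugate y j : ℝ)| := by
        rw [← abs_mul, ← hdetr]
        exact h1
    _ ≤ |(w : ℝ)| * (S * (D.factorial * (K * B) ^ D)) := by gcongr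
    _ = _ := by rw [mul_pow]; ring

open MvPolynomial in
lemma exists_auxiliary_polynomial_real {ι : Type*} [Fintype ι] [DecidableEq ι] [Nonempty ι]
    (a : Matrix ι ι ℝ) (ha : ∀ i s, IsIntegral ℤ (a i s))
    (ε : ℝ) (hε : 0 < ε) (hε1 : ε ≤ 1) : ∃ m₀ : ℕ, ∃ K : ℝ, 1 ≤ K ∧ ∀ m, m₀ ≤ m →
      ∀ r : Fin m → ℕ, (∀ h, 0 < r h) → ∃ P : MvPolynomial (Fin m × ι) ℤ, P ≠ 0 ∧
        IsWeightedHomogeneous (blockWeight m ι) P r ∧ lOne P ≤ K ^ ∑ h, r h ∧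
        ∀ J ∈ smallExponents ι r ε, coeff (blockFinsupp J)
          (blockSubst (fun _ => a) (map (Int.castRingHom ℝ) P)) = 0 := by
  obtain ⟨_, _⟩ := moduleFree_adjoin_range (fun x : ι × ι => a x.1 x.2) fun x => ha x.1 x.2
  set R := Algebra.adjoin ℤ (Set.range fun x : ι × ι => a x.1 x.2)
  let a' : Matrix ι ι R := fun i s => ⟨a i s, Algebra.subset_adjoin ⟨(i, s), rfl⟩⟩
  obtain ⟨m₀, K, hK, h⟩ := exists_auxiliary_polynomial a' ε hε hε1
  refine ⟨m₀, K, hK, fun m hm r hr => ?_⟩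
  obtain ⟨P, hP0, hPr, hPn, hPc⟩ := h m hm r hr
  refine ⟨P, hP0, hPr, hPn, fun J hJ => ?_⟩
  have h1 := congrArg (algebraMap R ℝ) (hPc J hJ)
  rw [← coeff_map, map_blockSubst, map_map, map_zero] at h1
  exact h1

end IntegralSpan

section Heights

open MvPolynomial

lemma ratHeight_neg (x : ℚ) : ratHeight (-x) = ratHeight x := by
  simp [ratHeight]

lemma ratHeight_one : ratHeight 1 = 1 := by
  simp [ratHeight]

lemma den_le_ratHeight (x : ℚ) : (x.den : ℝ) ≤ ratHeight x := by
  rw [ratHeight]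
  exact_mod_cast le_max_right _ _

lemma abs_num_le_ratHeight (x : ℚ) : |(x.num : ℝ)| ≤ ratHeight x := by
  rw [ratHeight, ← Int.cast_abs, ← Nat.cast_natAbs]
  exact_mod_cast le_max_left _ _

/-- If `V` is an integer vector with some small nonzero combination, some ratio of entries
has large height. -/
lemma exists_ratHeight_ge {κ : Type*} [Fintype κ] (a : κ → ℝ)
    (ha : ∀ i, IsIntegral ℤ (a i)) : ∃ c > (0 : ℝ), ∃ D : ℕ, ∀ V : κ → ℤ, ∀ j, V j ≠ 0 →
      ∑ i, V i * a i ≠ 0 → ∃ i, c ≤ |∑ i, V i * a i| * ratHeight (V i / V j) ^ D := by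
  classical
  obtain ⟨c, hc, D, h⟩ := exists_le_abs_sum_mul_pow a ha
  set N := Fintype.card κ with hN
  refine ⟨c, hc, N * (D + 1), fun V j hj hw => ?_⟩
  obtain ⟨i₀, _, hi₀⟩ := Finset.exists_max_image Finset.univ (fun i => ratHeight ((V i : ℚ) / V j))
    ⟨j, Finset.mem_univ j⟩
  refine ⟨i₀, ?_⟩
  set B := ratHeight ((V i₀ : ℚ) / V j)
  have hB1 : 1 ≤ B := one_le_ratHeight _
  set q : κ → ℚ := fun i => (V i : ℚ) / V j with hq
  have hqd : ∀ i, (V i : ℝ) = (q i : ℝ) * V j := by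
    intro i
    rw [hq]
    push_cast
    rw [div_mul_cancel₀]
    exact_mod_cast hj
  set W : κ → ℤ := fun i => (q i).num * ∏ i' ∈ Finset.univ.erase i, ((q i').den : ℤ) with hW
  have hWr : ∀ i, (W i : ℝ) = (∏ i', ((q i').den : ℝ)) * (q i : ℝ) := by
    intro i
    rw [hW, ← Finset.mul_prod_erase _ _ (Finset.mem_univ i)]
    push_cast
    have h1 : (q i : ℝ) = (q i).num / (q i).den := by exact_mod_cast (Rat.num_div_den (q i)).symm
    have h2 : ((q i).den : ℝ) ≠ 0 := by exact_mod_cast (q i).den_ne_zero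
    rw [h1]
    field_simp
  set P : ℝ := ∏ i', ((q i').den : ℝ) with hP
  have hPpos : 1 ≤ P := by
    rw [hP]
    exact Finset.one_le_prod fun i _ => by exact_mod_cast (q i).den_pos
  have hden : ∀ i, ((q i).den : ℝ) ≤ B := fun i =>
    (den_le_ratHeight _).trans (hi₀ i (Finset.mem_univ i))
  have hnum : ∀ i, |((q i).num : ℝ)| ≤ B := fun i => by
    exact (abs_num_le_ratHeight _).trans (hi₀ i (Finset.mem_univ i))
  have hPB : P ≤ B ^ N := by
    rw [hP]
    refine (Finset.prod_le_prod (fun _ _ => by positivity) fun i _ => hden i).trans ?_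
    simp [hN]
  have hWB : ∀ i, |(W i : ℝ)| ≤ B ^ N := by
    intro i
    rw [hW]
    push_cast
    rw [abs_mul, Finset.abs_prod, hN, ← Finset.card_univ, ← Finset.prod_const,
      ← Finset.mul_prod_erase _ _ (Finset.mem_univ i)]
    refine mul_le_mul (hnum i) (Finset.prod_le_prod (fun _ _ => abs_nonneg _) fun i' _ => ?_)
      (by positivity) (by linarith)
    rw [Nat.abs_cast]
    exact hden i'
  have hVj : (V j : ℝ) ≠ 0 := by exact_mod_cast hj
  have hsum : ∑ i, W i * a i = P / V j * ∑ i, V i * a i := by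
    rw [Finset.mul_sum]
    refine Finset.sum_congr rfl fun i _ => ?_
    rw [hWr, hqd i]
    field_simp
  have hne : ∑ i, W i * a i ≠ 0 := by
    rw [hsum]
    exact mul_ne_zero (div_ne_zero (by linarith) hVj) hw
  have h3 := h W (B ^ N) (one_le_pow₀ hB1) hWB hne
  refine h3.trans ?_
  rw [hsum, abs_mul, abs_div, abs_of_nonneg (by linarith : 0 ≤ P)]
  have h4 : P / |(V j : ℝ)| ≤ B ^ N := by
    have : (1 : ℝ) ≤ |(V j : ℝ)| := by exact_mod_cast Int.one_le_abs hj
    exact (div_le_self (by linarith) this).trans hPB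
  calc _ ≤ B ^ N * |∑ i, V i * a i| * (B ^ N) ^ D := by gcongr
    _ = _ := by rw [← pow_mul, mul_add, pow_add, mul_one]; ring

end Heights

namespace MvPolynomial

section CoeffBound

variable {m : ℕ} {ι : Type*} [Fintype ι]

lemma coeff_aeval_C_mul_X {σ R : Type*} [CommRing R] (b : σ → R)
    (F : MvPolynomial σ R) (c : σ →₀ ℕ) :
    coeff c (aeval (fun x => C (b x) * X x) F) = (c.prod fun x n => b x ^ n) * coeff c F := by
  classical
  induction F using MvPolynomial.induction_on' with
  | monomial d z =>
    have : aeval (fun x => C (b x) * X x) (monomial d z)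
        = monomial d (z * d.prod fun x n => b x ^ n) := by
      rw [aeval_monomial, algebraMap_eq]
      simp only [mul_pow, Finsupp.prod_mul, ← C_pow]
      rw [Finsupp.prod, ← map_prod, ← mul_assoc, ← C_mul, monomial_eq (s := d)]
      rfl
    rw [this, coeff_monomial, coeff_monomial]
    split_ifs with h
    · rw [h, mul_comm]
    · rw [mul_zero]
  | add p q hp hq => rw [map_add, coeff_add, coeff_add, hp, hq, mul_add]

/-- Coefficients after substituting linear forms of different sizes. -/
lemma abs_coeff_blockSubst_le (B : Fin m → Matrix ι ι ℝ) (γ β : Fin m × ι → ℝ)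
    (hβ : ∀ x, 0 < β x)
    (hB : ∀ h s t, |B h s t| ≤ γ (h, s) * β (h, t)) (G : MvPolynomial (Fin m × ι) ℝ) (U : ℝ)
    (hU : ∀ J ∈ G.support, ∏ x, (Fintype.card ι * γ x) ^ J x ≤ U) (c : Fin m × ι →₀ ℕ) :
    |coeff c (blockSubst B G)| ≤ lOne G * U * ∏ x, β x ^ c x := by
  have hdiag : aeval (fun x => C ((β x)⁻¹) * X x) (blockSubst B G)
      = aeval (fun x : Fin m × ι => ∑ s, C (B x.1 x.2 s * (β (x.1, s))⁻¹) * X (x.1, s)) G := by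
    rw [← AlgHom.comp_apply]
    congr 1
    ext1 x
    simp only [AlgHom.comp_apply, blockSubst_X, map_sum, map_mul, algHom_C, algebraMap_eq, aeval_X]
    exact Finset.sum_congr rfl fun s _ => (mul_assoc _ _ _).symm
  have hcoeff := coeff_aeval_C_mul_X (fun x => (β x)⁻¹) (blockSubst B G) c
  rw [hdiag, Finsupp.prod_fintype _ _ (by simp)] at hcoeff
  have hβc : 0 < ∏ x, β x ^ c x := Finset.prod_pos fun x _ => pow_pos (hβ x) _
  have h1 : coeff c (blockSubst B G) = (∏ x, β x ^ c x) *
      coeff c (aeval (fun x : Fin m × ι => ∑ s,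
        C (B x.1 x.2 s * (β (x.1, s))⁻¹) * X (x.1, s)) G) := by
    rw [hcoeff, ← mul_assoc, ← Finset.prod_mul_distrib, Finset.prod_eq_one, one_mul]
    intro x _
    rw [← mul_pow, mul_inv_cancel₀ (hβ x).ne', one_pow]
  rw [h1, abs_mul, abs_of_pos hβc, mul_comm]
  refine mul_le_mul_of_nonneg_right ?_ hβc.le
  rw [← Real.norm_eq_abs]
  refine (norm_coeff_le_lOne _ c).trans ?_
  conv_lhs => rw [G.as_sum, map_sum]
  refine (lOne_sum_le _ _).trans ?_
  rw [lOne, Finset.sum_mul]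
  refine Finset.sum_le_sum fun J hJ => ?_
  rw [aeval_monomial, algebraMap_eq]
  refine (lOne_mul_le _ _).trans ?_
  rw [← monomial_zero', lOne_monomial]
  refine mul_le_mul_of_nonneg_left ?_ (norm_nonneg _)
  rw [Finsupp.prod_fintype _ _ (by simp)]
  refine (lOne_prod_le _ _).trans (le_trans ?_ (hU J hJ))
  refine Finset.prod_le_prod (fun _ _ => lOne_nonneg _) fun x _ => (lOne_pow_le _ _).trans ?_
  refine pow_le_pow_left₀ (lOne_nonneg _) ?_ _
  refine (lOne_sum_C_mul_X_le (fun s => B x.1 x.2 s * (β (x.1, s))⁻¹) fun s => (x.1, s)).trans ?_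
  refine (Finset.sum_le_card_nsmul _ _ (γ x) fun s _ => ?_).trans (by simp)
  rw [norm_mul, norm_inv, Real.norm_eq_abs, Real.norm_of_nonneg (hβ _).le]
  rw [mul_inv_le_iff₀ (hβ _)]
  exact hB _ _ _

lemma lOne_blockSubst_le (a : Matrix ι ι ℝ) (K : ℝ) (hK : ∀ i, ∑ s, |a i s| ≤ K)
    {r : Fin m → ℕ} (G : MvPolynomial (Fin m × ι) ℝ)
    (hG : IsWeightedHomogeneous (blockWeight m ι) G r) :
    lOne (blockSubst (fun _ => a) G) ≤ lOne G * K ^ ∑ h, r h := by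
  conv_lhs => rw [G.as_sum, map_sum]
  refine (lOne_sum_le _ _).trans ?_
  rw [lOne, Finset.sum_mul]
  refine Finset.sum_le_sum fun J hJ => ?_
  have hd : J.degree = ∑ h, r h := by
    rw [Finsupp.degree_eq_sum, Fintype.sum_prod_type]
    refine Finset.sum_congr rfl fun h _ => ?_
    rw [← weight_blockWeight, hG (mem_support_iff.mp hJ)]
  have h1 : monomial J (coeff J G) = C (coeff J G) * monomial J 1 := by
    rw [C_mul_monomial, mul_one]
  rw [h1, map_mul, ← algebraMap_eq, AlgHom.commutes, algebraMap_eq]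
  refine (lOne_mul_le _ _).trans ?_
  rw [← monomial_zero', lOne_monomial, ← hd]
  exact mul_le_mul_of_nonneg_left
    (lOne_blockSubst_monomial_le (fun _ => a) K (fun _ i => hK i) J) (norm_nonneg _)

end CoeffBound

section SmallCoeff

variable {m : ℕ} {ι : Type*} [Fintype ι] [DecidableEq ι]

lemma sum_exponent_le [Nonempty ι] {r : Fin m → ℕ} (hr : ∀ h, 0 < r h) {J : Fin m → ι → ℕ}
    (hJ : J ∈ blockExponents ι r) {ε : ℝ} (hε : 0 ≤ ε) (hJε : J ∉ smallExponents ι r ε)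
    {e : ι → ℝ} {E δ Λ κ : ℝ} (hE : 0 ≤ E) (he : ∀ s, |e s| ≤ E) (hδ : ∑ s, e s = -δ)
    (hΛ : 0 ≤ Λ) {L : Fin m → ℝ} (hr1 : ∀ h, Λ ≤ r h * L h)
    (hr2 : ∀ h, r h * L h ≤ Λ * (1 + κ)) :
    ∑ h, ∑ s, (J h s : ℝ) * (L h * e s) ≤
      Λ * m * (-δ / Fintype.card ι + 2 * Fintype.card ι * E * ε + κ * E) := by
  set N := (Fintype.card ι : ℝ) with hN
  have hN1 : 1 ≤ N := by rw [hN]; exact_mod_cast (Fintype.card_pos : 0 < Fintype.card ι)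
  have hrpos : ∀ h, (0 : ℝ) < r h := fun h => by exact_mod_cast hr h
  rw [mem_blockExponents] at hJ
  set x : ι → ℝ := fun s => ∑ h, (J h s : ℝ) / r h with hx
  have hxsum : ∑ s, x s = m := by
    rw [hx, Finset.sum_comm]
    have : ∀ h, ∑ s, (J h s : ℝ) / r h = 1 := by
      intro h
      rw [← Finset.sum_div, div_eq_one_iff_eq (hrpos h).ne', ← hJ h]
      push_cast
      rfl
    simp [this]
  have hxlow : ∀ s, (1 / N - ε) * m ≤ x s := by
    intro s
    by_contra! h
    refine hJε ?_
    rw [smallExponents, Finset.mem_biUnion]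
    exact ⟨s, Finset.mem_univ s, Finset.mem_filter.mpr ⟨mem_blockExponents.mpr hJ, h⟩⟩
  have h1 : ∀ h s, (J h s : ℝ) * (L h * e s) ≤
      Λ * (e s * ((J h s : ℝ) / r h)) + κ * E * Λ * ((J h s : ℝ) / r h) := by
    intro h s
    have h2 : (J h s : ℝ) * (L h * e s) = (J h s : ℝ) / r h * ((r h * L h) * e s) := by
      field_simp [(hrpos h).ne']
    rw [h2]
    have h3 : (r h * L h) * e s ≤ Λ * e s + κ * E * Λ := by
      have h4 : (r h * L h - Λ) * e s ≤ (κ * Λ) * E :=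
        (mul_le_mul_of_nonneg_left ((le_abs_self _).trans (he s)) (by linarith [hr1 h])).trans
          (mul_le_mul_of_nonneg_right (by linarith [hr2 h]) hE)
      linarith
    have h5 : 0 ≤ (J h s : ℝ) / r h := by positivity
    nlinarith
  have h2 : ∑ h, ∑ s, (J h s : ℝ) * (L h * e s) ≤ Λ * ∑ s, e s * x s + κ * E * Λ * m := by
    calc _ ≤ ∑ h, ∑ s, (Λ * (e s * ((J h s : ℝ) / r h)) + κ * E * Λ * ((J h s : ℝ) / r h)) :=
          Finset.sum_le_sum fun h _ => Finset.sum_le_sum fun s _ => h1 h s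
      _ = _ := by
        rw [Finset.sum_comm, ← hxsum, Finset.mul_sum, Finset.mul_sum, ← Finset.sum_add_distrib]
        refine Finset.sum_congr rfl fun s _ => ?_
        rw [Finset.sum_add_distrib, ← Finset.mul_sum, ← Finset.mul_sum, ← Finset.mul_sum]
  set y := (1 / N - ε) * m with hy
  have h3 : ∑ s, e s * x s ≤ m * (-δ / N + 2 * N * E * ε) := by
    have h4 : ∑ s, e s * (x s - y) ≤ ∑ s, E * (x s - y) :=
      Finset.sum_le_sum fun s _ => mul_le_mul_of_nonneg_right ((le_abs_self _).trans (he s))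
        (by linarith [hxlow s])
    have h5 : ∑ s, E * (x s - y) = E * (N * ε * m) := by
      rw [← Finset.mul_sum, Finset.sum_sub_distrib, hxsum, Finset.sum_const, Finset.card_univ,
        nsmul_eq_mul, ← hN, hy]
      field_simp
      ring
    have h6 : ∑ s, e s * (x s - y) = ∑ s, e s * x s + δ * y := by
      simp only [mul_sub]
      rw [Finset.sum_sub_distrib, ← Finset.sum_mul, hδ]
      ring
    have h7 : δ ≤ N * E := by
      have h8 : ∑ s, -e s ≤ ∑ _s : ι, E := Finset.sum_le_sum fun s _ =>
        (neg_le_abs _).trans (he s)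
      rw [Finset.sum_neg_distrib, hδ, Finset.sum_const, Finset.card_univ, nsmul_eq_mul] at h8
      linarith
    have h8 : δ * ε * m ≤ N * E * ε * m := by gcongr
    have h9 : δ * y = δ / N * m - δ * ε * m := by rw [hy]; ring
    have h10 : (m : ℝ) * (-δ / N + 2 * N * E * ε) = -(δ / N * m) + 2 * (N * E * ε * m) := by ring
    rw [h10]
    linarith
  calc _ ≤ _ := h2
    _ ≤ Λ * (m * (-δ / N + 2 * N * E * ε)) + κ * E * Λ * m := by gcongr
    _ = _ := by ring

lemma abs_coeff_blockSubst_lt_one [Nonempty ι] (hm : 0 < m) {r : Fin m → ℕ} (hr : ∀ h, 0 < r h)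
    {ε : ℝ} (hε : 0 ≤ ε) {e : ι → ℝ} {E δ Λ κ T θ C K : ℝ} (hE : 0 ≤ E) (he : ∀ s, |e s| ≤ E)
    (hδ : ∑ s, e s = -δ) (hΛ : 0 < Λ) (hκ1 : κ ≤ 1) {L : Fin m → ℝ}
    (hr1 : ∀ h, Λ ≤ r h * L h) (hr2 : ∀ h, r h * L h ≤ Λ * (1 + κ)) (hT : 0 < T)
    (hLT : ∀ h, T ≤ L h) (hC : 1 ≤ C) (hK : 1 ≤ K) {G : MvPolynomial (Fin m × ι) ℝ}
    (hG : IsWeightedHomogeneous (blockWeight m ι) G r) (hGK : lOne G ≤ K ^ ∑ h, r h)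
    (hGε : ∀ J ∈ smallExponents ι r ε, coeff (blockFinsupp J) G = 0) (t : ι)
    {B : Fin m → Matrix ι ι ℝ}
    (hB : ∀ h s i, |B h s i| ≤ C * exp (L h * e s) * if i = t then exp (E * L h) else 1)
    (hnum : -δ / Fintype.card ι + 2 * Fintype.card ι * E * ε + κ * E + 2 * E * θ +
      2 * log (K * (Fintype.card ι * C)) / T < 0) {c : Fin m × ι →₀ ℕ}
    (hc : ∑ h, (c (h, t) : ℝ) / r h < θ * m) : |coeff c (blockSubst B G)| < 1 := by
  set N := (Fintype.card ι : ℝ) with hN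
  have hN1 : 1 ≤ N := by rw [hN]; exact_mod_cast (Fintype.card_pos : 0 < Fintype.card ι)
  have hrpos : ∀ h, (0 : ℝ) < r h := fun h => by exact_mod_cast hr h
  have hm' : (0 : ℝ) < m := by exact_mod_cast hm
  set D := ∑ h, r h with hD
  set u := Λ * m * (-δ / N + 2 * N * E * ε + κ * E) with hu
  have hNC : 1 ≤ N * C := one_le_mul_of_one_le_of_one_le hN1 hC
  have hU : ∀ J ∈ G.support,
      ∏ x : Fin m × ι, (N * (C * exp (L x.1 * e x.2))) ^ J x ≤ (N * C) ^ D * exp u := by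
    intro J hJ
    have hw := hG (mem_support_iff.mp hJ)
    set J' : Fin m → ι → ℕ := fun h s => J (h, s) with hJ'
    have hJJ : blockFinsupp J' = J := by ext x; rfl
    have hJb : J' ∈ blockExponents ι r := weight_blockFinsupp.mp (by rw [hJJ]; exact hw)
    have hJs : J' ∉ smallExponents ι r ε := fun h => by
      have := hGε J' h
      rw [hJJ] at this
      exact mem_support_iff.mp hJ this
    have h1 := sum_exponent_le hr hJb hε hJs hE he hδ hΛ.le hr1 hr2
    have hdeg : ∑ x, J x = D := by
      rw [Fintype.sum_prod_type, hD]
      exact Finset.sum_congr rfl fun h _ => mem_blockExponents.mp hJb h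
    have h2 : ∏ x : Fin m × ι, (N * (C * exp (L x.1 * e x.2))) ^ J x
        = (N * C) ^ D * exp (∑ h, ∑ s, (J' h s : ℝ) * (L h * e s)) := by
      rw [← hdeg, ← Finset.prod_pow_eq_pow_sum, ← Fintype.sum_prod_type'
        (fun h s => (J' h s : ℝ) * (L h * e s)), exp_sum, ← Finset.prod_mul_distrib]
      refine Finset.prod_congr rfl fun x _ => ?_
      rw [exp_nat_mul, ← mul_assoc, mul_pow]
    rw [h2]
    gcongr
  have h1 := abs_coeff_blockSubst_le B (fun x => C * exp (L x.1 * e x.2))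
    (fun x => if x.2 = t then exp (E * L x.1) else 1)
    (fun x => by split_ifs <;> positivity) hB G ((N * C) ^ D * exp u) hU c
  have hβ : ∏ x : Fin m × ι, (if x.2 = t then exp (E * L x.1) else 1) ^ c x ≤
      exp (Λ * m * (2 * E * θ)) := by
    rw [Fintype.prod_prod_type]
    have h2 : ∀ h : Fin m, ∏ i : ι, (if i = t then exp (E * L h) else 1) ^ c (h, i)
        = exp (c (h, t) * (E * L h)) := by
      intro h
      rw [Finset.prod_eq_single t (fun i _ hi => by rw [if_neg hi, one_pow]) (by simp),
        if_pos rfl, exp_nat_mul]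
    simp only [h2]
    rw [← exp_sum, exp_le_exp]
    calc ∑ h, (c (h, t) : ℝ) * (E * L h) ≤ ∑ h, (c (h, t) : ℝ) / r h * (E * (2 * Λ)) := by
          refine Finset.sum_le_sum fun h _ => ?_
          have : (c (h, t) : ℝ) * (E * L h) = (c (h, t) : ℝ) / r h * (E * (r h * L h)) := by
            field_simp [(hrpos h).ne']
          rw [this]
          have h3 : r h * L h ≤ 2 * Λ := by nlinarith [hr2 h]
          gcongr
      _ = (∑ h, (c (h, t) : ℝ) / r h) * (E * (2 * Λ)) := by rw [Finset.sum_mul]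
      _ ≤ θ * m * (E * (2 * Λ)) := by gcongr
      _ = _ := by ring
  have hDle : (D : ℝ) ≤ Λ * m * (2 / T) := by
    rw [hD]
    push_cast
    calc ∑ h, (r h : ℝ) ≤ ∑ _h : Fin m, Λ * (2 / T) := by
          refine Finset.sum_le_sum fun h _ => ?_
          rw [← mul_div_assoc, le_div_iff₀ hT]
          calc (r h : ℝ) * T ≤ r h * L h := by gcongr; exact hLT h
            _ ≤ Λ * (1 + κ) := hr2 h
            _ ≤ Λ * 2 := by gcongr; linarith
      _ = _ := by rw [Finset.sum_const, Finset.card_univ, Fintype.card_fin, nsmul_eq_mul]; ring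
  have hKNC : 1 ≤ K * (N * C) := one_le_mul_of_one_le_of_one_le hK hNC
  calc _ ≤ _ := h1
    _ ≤ K ^ D * ((N * C) ^ D * exp u) * exp (Λ * m * (2 * E * θ)) := by
        gcongr
    _ = exp (D * log (K * (N * C)) + u + Λ * m * (2 * E * θ)) := by
        rw [exp_add, exp_add, exp_nat_mul, exp_log (by linarith), mul_pow K]
        ring
    _ < 1 := by
        rw [exp_lt_one_iff]
        have h2 : D * log (K * (N * C)) ≤ Λ * m * (2 / T) * log (K * (N * C)) :=
          mul_le_mul_of_nonneg_right hDle (log_nonneg hKNC)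
        have h3 : Λ * m * (2 / T) * log (K * (N * C)) + u + Λ * m * (2 * E * θ) =
          Λ * m * (-δ / N + 2 * N * E * ε + κ * E + 2 * E * θ + 2 * log (K * (N * C)) / T) := by
          rw [hu]; ring
        have h4 : Λ * m * (-δ / N + 2 * N * E * ε + κ * E + 2 * E * θ +
          2 * log (K * (N * C)) / T) < 0 := mul_neg_of_pos_of_neg (by positivity) hnum
        linarith

end SmallCoeff

end MvPolynomial

namespace MvPolynomial

set_option maxHeartbeats 1000000 in
/-- The core of the Thue-Siegel-Roth-Schmidt method. -/
theorem false_of_approximating_matrices {ι : Type*} [Fintype ι] [DecidableEq ι] [Nonempty ι]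
    {a : Matrix ι ι ℝ} (ha : ∀ i s, IsIntegral ℤ (a i s)) {t : ι} {e : ι → ℝ}
    (hsum : ∑ s, e s < 0) {C E c₀ : ℝ} (hC : 1 ≤ C) (hE : 0 < E) (he : ∀ s, |e s| ≤ E)
    (hc₀ : 0 < c₀) {L : ℕ → ℝ} (hL : Filter.Tendsto L Filter.atTop Filter.atTop)
    {Y : ℕ → Matrix ι ι ℤ} {W : ℕ → Matrix ι ι ℚ} {B : ℕ → Matrix ι ι ℝ} {i j : ℕ → ι}
    (hYW : ∀ k, (Y k).map (Int.castRingHom ℚ) * W k = 1) (hij : ∀ k, i k ≠ j k)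
    (hi : ∀ k, W k t (i k) = 1) (hj : ∀ k, exp (c₀ * L k) ≤ ratHeight (W k t (j k)))
    (haB : ∀ k, a * B k = (Y k).map (Int.castRingHom ℝ))
    (hB : ∀ k s x, |B k s x| ≤ C * exp (L k * e s) * if x = t then exp (E * L k) else 1) :
    False := by
  obtain ⟨δ, hδ⟩ : ∃ δ, ∑ s, e s = -δ := ⟨_, (neg_neg _).symm⟩
  have hδ0 : 0 < δ := by linarith
  obtain ⟨N, hN⟩ : ∃ N : ℝ, N = Fintype.card ι := ⟨_, rfl⟩
  have hN1 : 1 ≤ N := by rw [hN]; exact_mod_cast (Fintype.card_pos : 0 < Fintype.card ι)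
  have hδE : δ ≤ N * E := by
    have h8 : ∑ s, -e s ≤ ∑ _s : ι, E := Finset.sum_le_sum fun s _ => (neg_le_abs _).trans (he s)
    rw [Finset.sum_neg_distrib, hδ, Finset.sum_const, Finset.card_univ, nsmul_eq_mul] at h8
    rw [hN]
    linarith
  have hNE : 0 < N * E := by positivity
  obtain ⟨ε, hε⟩ : ∃ ε, ε = δ / (16 * N * (N * E)) := ⟨_, rfl⟩
  obtain ⟨κ, hκ⟩ : ∃ κ, κ = δ / (8 * (N * E)) := ⟨_, rfl⟩
  obtain ⟨θ, hθ⟩ : ∃ θ, θ = δ / (16 * (N * E)) := ⟨_, rfl⟩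
  have hε0 : 0 < ε := by rw [hε]; positivity
  have hκ0 : 0 < κ := by rw [hκ]; positivity
  have hθ0 : 0 < θ := by rw [hθ]; positivity
  have hε1 : ε ≤ 1 := by
    rw [hε, div_le_one (by positivity)]
    nlinarith
  have hκ1 : κ ≤ 1 := by
    rw [hκ, div_le_one (by positivity)]
    linarith
  obtain ⟨m₀, K₀, hK₀, hP⟩ := exists_auxiliary_polynomial_real a ha ε hε0 hε1
  obtain ⟨m, hm₀, hm⟩ : ∃ m, m₀ ≤ m ∧ 0 < m := ⟨max m₀ 1, le_max_left _ _, by positivity⟩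
  have hm' : (0 : ℝ) < m := by exact_mod_cast hm
  obtain ⟨σ, hσ, -, hroth⟩ := exists_rothBound m (θ * m / 2) (by positivity)
  obtain ⟨Ka, hKa1, hKa⟩ : ∃ Ka : ℝ, 1 ≤ Ka ∧ ∀ i, ∑ s, |a i s| ≤ Ka := by
    refine ⟨1 + ∑ i, ∑ s, |a i s|, ?_, fun i => ?_⟩
    · exact le_add_of_nonneg_right (Finset.sum_nonneg fun _ _ => Finset.sum_nonneg fun _ _ =>
        abs_nonneg _)
    · have : ∑ s, |a i s| ≤ ∑ i, ∑ s, |a i s| := Finset.single_le_sum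
        (f := fun i => ∑ s, |a i s|) (fun i _ => Finset.sum_nonneg fun _ _ => abs_nonneg _)
          (Finset.mem_univ i)
      linarith
  obtain ⟨K, hK⟩ : ∃ K, K = K₀ * Ka := ⟨_, rfl⟩
  have hK1 : 1 ≤ K := hK ▸ one_le_mul_of_one_le_of_one_le hK₀ hKa1
  have hlogK : 0 ≤ log (K * (N * C)) := log_nonneg
    (one_le_mul_of_one_le_of_one_le hK1 (one_le_mul_of_one_le_of_one_le hN1 hC))
  have hlogK₀ : 0 ≤ log K₀ := log_nonneg hK₀
  obtain ⟨T, hT1, hTσ, hTK, hTR⟩ : ∃ T : ℝ, 1 ≤ T ∧ 2 / σ ≤ T ∧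
      16 * N * log (K * (N * C)) / δ ≤ T ∧ 2 * m * (log K₀ + 2 * m) / (σ * c₀) ≤ T := by
    refine ⟨1 + 2 / σ + 16 * N * log (K * (N * C)) / δ + 2 * m * (log K₀ + 2 * m) / (σ * c₀),
      ?_, ?_, ?_, ?_⟩
    all_goals
      have h1 : 0 ≤ 2 / σ := by positivity
      have h2 : 0 ≤ 16 * N * log (K * (N * C)) / δ := by positivity
      have h3 : 0 ≤ 2 * m * (log K₀ + 2 * m) / (σ * c₀) := by positivity
      linarith
  have hT : 0 < T := by linarith
  have hnum : -δ / Fintype.card ι + 2 * Fintype.card ι * E * ε + κ * E + 2 * E * θ +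
      2 * log (K * (Fintype.card ι * C)) / T < 0 := by
    rw [← hN]
    have h1 : 2 * N * E * ε = δ / N / 8 := by rw [hε]; field_simp; norm_num
    have h2 : κ * E = δ / N / 8 := by rw [hκ]; field_simp
    have h3 : 2 * E * θ = δ / N / 8 := by rw [hθ]; field_simp; norm_num
    have h4 : 2 * log (K * (N * C)) / T ≤ δ / N / 8 := by
      rw [div_le_iff₀ hT, div_div, div_mul_eq_mul_div, le_div_iff₀ (by positivity)]
      rw [div_le_iff₀ hδ0] at hTK
      linarith
    have h5 : 0 < δ / N := by positivity
    rw [h1, h2, h3, neg_div]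
    linarith
  have hchoose : ∀ x : ℝ, ∃ k, x ≤ L k := fun x => (hL.eventually_ge_atTop x).exists
  choose φ hφ using hchoose
  obtain ⟨g, hg0, hgs⟩ : ∃ g : ℕ → ℕ, T ≤ L (g 0) ∧ ∀ h, T * L (g h) ≤ L (g (h + 1)) :=
    ⟨fun h => Nat.rec (φ T) (fun _ k => φ (T * L k)) h, hφ T, fun h => hφ _⟩
  have hLT : ∀ h, T ≤ L (g h) := by
    intro h
    induction h with
    | zero => exact hg0
    | succ h ih => nlinarith [hgs h]
  have hLpos : ∀ h, 0 < L (g h) := fun h => hT.trans_le (hLT h)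
  obtain ⟨Λ, hΛ, hΛL⟩ : ∃ Λ : ℝ, 0 < Λ ∧ ∀ h < m, L (g h) ≤ κ * Λ := by
    refine ⟨(∑ h ∈ Finset.range m, L (g h)) / κ, ?_, fun h hh => ?_⟩
    · exact div_pos (Finset.sum_pos (fun h _ => hLpos h) ⟨0, by simpa using hm⟩) hκ0
    · rw [mul_div_cancel₀ _ hκ0.ne']
      exact Finset.single_le_sum (f := fun h => L (g h)) (fun h _ => (hLpos h).le)
        (Finset.mem_range.mpr hh)
  obtain ⟨r, hr⟩ : ∃ r : ℕ → ℕ, ∀ h, r h = ⌈Λ / L (g h)⌉₊ := ⟨_, fun _ => rfl⟩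
  have hrpos : ∀ h, 0 < r h := fun h => by
    rw [hr]; exact Nat.ceil_pos.mpr (div_pos hΛ (hLpos h))
  have hr1 : ∀ h, Λ ≤ r h * L (g h) := fun h => by
    rw [← div_le_iff₀ (hLpos h), hr]
    exact Nat.le_ceil _
  have hr2 : ∀ h < m, r h * L (g h) ≤ Λ * (1 + κ) := fun h hh => by
    have h1 : (r h : ℝ) ≤ Λ / L (g h) + 1 := by
      rw [hr]
      exact (Nat.ceil_lt_add_one (div_pos hΛ (hLpos h)).le).le
    calc r h * L (g h) ≤ (Λ / L (g h) + 1) * L (g h) := by gcongr; exact (hLpos h).le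
      _ = Λ + L (g h) := by rw [add_mul, div_mul_cancel₀ _ (hLpos h).ne', one_mul]
      _ ≤ _ := by linarith [hΛL h hh]
  have hr3 : ∀ h < m, r h * L (g h) ≤ 2 * Λ := fun h hh => (hr2 h hh).trans (by nlinarith)
  obtain ⟨P, hP0, hPr, hPK, hPε⟩ := hP m hm₀ (fun h => r h) fun h => hrpos h
  have hPr' : IsWeightedHomogeneous (blockWeight m ι) (map (Int.castRingHom ℝ) P)
      fun h : Fin m => r h := by
    intro c hc
    refine hPr fun h0 => hc ?_
    rw [coeff_map, h0, map_zero]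
  have hGK : lOne (blockSubst (fun _ => a) (map (Int.castRingHom ℝ) P)) ≤
      K ^ ∑ h : Fin m, r h := by
    refine (lOne_blockSubst_le a Ka hKa _ hPr').trans ?_
    rw [hK, mul_pow]
    gcongr
    refine le_trans ?_ hPK
    rw [lOne, lOne]
    refine (Finset.sum_le_sum_of_subset_of_nonneg (support_map_subset _ _) fun _ _ _ =>
      norm_nonneg _).trans (Finset.sum_le_sum fun c _ => ?_)
    rw [coeff_map]
    exact le_rfl
  have hθ : ∀ c ∈ (blockSubst (fun h : Fin m => Y (g h)) P).support,
      θ * m ≤ ∑ h : Fin m, (c (h, t) : ℝ) / r h := by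
    intro c hc
    by_contra! hlt
    have h1 := abs_coeff_blockSubst_lt_one hm (fun h : Fin m => hrpos h) hε0.le hE.le he hδ hΛ
      hκ1 (L := fun h : Fin m => L (g h)) (fun h => hr1 h) (fun h => hr2 h h.2) hT
      (fun h => hLT h) hC hK1 (hPr'.blockSubst (fun _ => a)) hGK hPε t
      (B := fun h : Fin m => B (g h)) (fun h => hB (g h)) hnum hlt
    rw [blockSubst_blockSubst] at h1
    have h2 : (fun h : Fin m => a * B (g h)) =
        fun h : Fin m => (Y (g h)).map (Int.castRingHom ℝ) := by
      ext h : 1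
      exact haB _
    rw [h2, ← map_blockSubst, coeff_map] at h1
    have h3 : |coeff c (blockSubst (fun h : Fin m => Y (g h)) P)| < 1 := by
      have h4 : |((coeff c (blockSubst (fun h : Fin m => Y (g h)) P) : ℤ) : ℝ)| < 1 := h1
      exact_mod_cast h4
    exact mem_support_iff.mp hc (Int.abs_lt_one_iff.mp h3)
  obtain ⟨F, hF0, hFs, hFd, hFP, hF⟩ := exists_polynomial_of_blockSubst
    (i := fun h : Fin m => i (g h)) (j := fun h : Fin m => j (g h)) (fun h => hij _)
    (ξ := fun h => -W (g h) t (j (g h))) (fun h : Fin m => hYW (g h)) (fun h => hi _)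
    (fun h => (neg_neg _).symm) hP0 hPr hθ
  set R : ℝ := ∑ h ∈ Finset.range m, (r h : ℝ) with hR
  have hRle : R * T ≤ 2 * m * Λ := by
    rw [hR, Finset.sum_mul]
    calc ∑ h ∈ Finset.range m, (r h : ℝ) * T ≤ ∑ _h ∈ Finset.range m, 2 * Λ :=
          Finset.sum_le_sum fun h hh =>
            (mul_le_mul_of_nonneg_left (hLT h) (Nat.cast_nonneg _)).trans
              (hr3 h (Finset.mem_range.mp hh))
      _ = _ := by rw [Finset.sum_const, Finset.card_range, nsmul_eq_mul]; ring
  have hR0 : 0 ≤ R := Finset.sum_nonneg fun _ _ => Nat.cast_nonneg _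
  have hFR : log (lOne F) ≤ R * log K₀ := by
    have h1 : lOne F ≤ K₀ ^ ∑ h : Fin m, r h := hFP.trans hPK
    have h2 : R = ((∑ h : Fin m, r h : ℕ) : ℝ) := by
      rw [hR, Finset.sum_range]
      push_cast
      rfl
    rw [h2, ← log_pow]
    exact log_le_log (by linarith [one_le_lOne F hF0]) h1
  have hrσ : ∀ h, h + 1 < m → (r (h + 1) : ℝ) ≤ σ * r h := by
    intro h hh
    have h1 : (r (h + 1) : ℝ) * (T * L (g h)) ≤ 2 * (r h * L (g h)) :=
      calc (r (h + 1) : ℝ) * (T * L (g h)) ≤ r (h + 1) * L (g (h + 1)) := by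
            gcongr
            exact hgs h
        _ ≤ 2 * Λ := hr3 _ hh
        _ ≤ _ := by linarith [hr1 h]
    have h2 : (r (h + 1) : ℝ) * T ≤ 2 * r h := by
      refine le_of_mul_le_mul_right ?_ (hLpos h)
      linarith
    rw [div_le_iff₀ hσ] at hTσ
    have h3 : (r (h + 1) : ℝ) * 2 ≤ r (h + 1) * (T * σ) := by gcongr
    have h4 : (r (h + 1) : ℝ) * T * σ ≤ 2 * r h * σ := by gcongr
    linarith
  have hAσ : ∀ h < m, R * (log K₀ + 2 * m) ≤
      σ * r h * log (ratHeight (-W (g h) t (j (g h)))) := by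
    intro h hh
    rw [ratHeight_neg]
    have h1 : c₀ * L (g h) ≤ log (ratHeight (W (g h) t (j (g h)))) := by
      rw [le_log_iff_exp_le (by linarith [one_le_ratHeight (W (g h) t (j (g h)))])]
      exact hj _
    rw [div_le_iff₀ (by positivity)] at hTR
    have h2 : R * (log K₀ + 2 * m) ≤ σ * c₀ * Λ := by
      refine le_of_mul_le_mul_right ?_ (by positivity : (0 : ℝ) < 2 * m)
      calc R * (log K₀ + 2 * m) * (2 * m) = R * (2 * m * (log K₀ + 2 * m)) := by ring
        _ ≤ R * (T * (σ * c₀)) := by gcongr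
        _ = (R * T) * (σ * c₀) := by ring
        _ ≤ (2 * m * Λ) * (σ * c₀) := by gcongr
        _ = _ := by ring
    calc _ ≤ σ * c₀ * Λ := h2
      _ ≤ σ * c₀ * (r h * L (g h)) := by gcongr; exact hr1 h
      _ = σ * r h * (c₀ * L (g h)) := by ring
      _ ≤ _ := by gcongr
  obtain ⟨b, hb, hbw⟩ := hroth r (fun h => -W (g h) t (j (g h))) F R (R * (log K₀ + 2 * m)) hF0 hFs
    (fun h _ => hrpos h) hFd hrσ le_rfl (by linarith) hAσ
  have h1 := hF b hb
  have h2 : 0 < θ * m := by positivity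
  linarith

end MvPolynomial

section AdjugateRow

variable {ι : Type*} [Fintype ι] [DecidableEq ι]

lemma abs_adjugate_apply_le (A : Matrix ι ι ℝ) (t : ι) (e : ι → ℝ) {L C : ℝ} (hC : 1 ≤ C)
    (h : ∀ s x, x ≠ t → |A s x| ≤ C * exp (L * e s)) (s : ι) :
    |A.adjugate t s| ≤ (Fintype.card ι).factorial * C ^ Fintype.card ι *
      exp (L * (∑ i, e i - e s)) := by
  rw [Matrix.adjugate_apply, Matrix.det_apply']
  refine (Finset.abs_sum_le_sum_abs _ _).trans ?_
  refine (Finset.sum_le_card_nsmul _ _ (C ^ Fintype.card ι * exp (L * (∑ i, e i - e s)))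
    fun σ _ => ?_).trans (le_of_eq ?_)
  · have hsign : |((Equiv.Perm.sign σ : ℤ) : ℝ)| = 1 := by
      rcases Int.units_eq_one_or (Equiv.Perm.sign σ) with h | h <;> simp [h]
    rw [abs_mul, hsign, one_mul, Finset.abs_prod]
    by_cases hσ : σ t = s
    · rw [← Finset.mul_prod_erase _ _ (Finset.mem_univ t), hσ]
      have h1 : ∀ x ∈ Finset.univ.erase t,
          |A.updateRow s (Pi.single t 1) (σ x) x| ≤ C * exp (L * e (σ x)) := by
        intro x hx
        have hxt := (Finset.mem_erase.mp hx).1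
        have : σ x ≠ s := fun h' => hxt (σ.injective (h'.trans hσ.symm))
        rw [Matrix.updateRow_ne this]
        exact h _ _ hxt
      have h2 : ∑ x ∈ Finset.univ.erase t, L * e (σ x) = L * (∑ i, e i - e s) := by
        rw [← Finset.mul_sum, ← Equiv.sum_comp σ, ← Finset.add_sum_erase _ _ (Finset.mem_univ t),
          hσ, add_sub_cancel_left]
      calc _ ≤ 1 * ∏ x ∈ Finset.univ.erase t, C * exp (L * e (σ x)) := by
            refine mul_le_mul (by simp) (Finset.prod_le_prod (fun _ _ => abs_nonneg _) h1)
              (Finset.prod_nonneg fun _ _ => abs_nonneg _) zero_le_one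
        _ = C ^ (Fintype.card ι - 1) * exp (L * (∑ i, e i - e s)) := by
            rw [one_mul, Finset.prod_mul_distrib, Finset.prod_const, ← exp_sum, h2,
              Finset.card_erase_of_mem (Finset.mem_univ t), Finset.card_univ]
        _ ≤ _ := by
            gcongr
            exact Nat.sub_le _ _
    · rw [Finset.prod_eq_zero (Finset.mem_univ (σ.symm s))]
      · positivity
      · have : σ.symm s ≠ t := fun h' => hσ (by rw [← h', Equiv.apply_symm_apply])
        rw [Equiv.apply_symm_apply, Matrix.updateRow_self, Pi.single_eq_of_ne this, abs_zero]
  · rw [Finset.card_univ, Fintype.card_perm, nsmul_eq_mul, mul_assoc]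

lemma adjugate_updateCol_apply {R : Type*} [CommRing R] (A : Matrix ι ι R) (t : ι) (b : ι → R)
    (s : ι) : (A.updateCol t b).adjugate t s = A.adjugate t s := by
  have h : ∀ A : Matrix ι ι R, A.adjugate t s = (A.updateCol t (Pi.single s 1)).det := by
    intro A
    rw [← Matrix.cramer_apply, Matrix.cramer_eq_adjugate_mulVec, Matrix.mulVec_single_one]
    rfl
  rw [h, h, Matrix.updateCol_idem]

lemma det_updateCol_single {R : Type*} [CommRing R] (A : Matrix ι ι R) (t j : ι) :
    (A.updateCol t (Pi.single j 1)).det = A.adjugate t j := by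
  rw [← Matrix.cramer_apply, Matrix.cramer_eq_adjugate_mulVec, Matrix.mulVec_single_one]
  rfl

lemma adjugate_mul_apply_eq {M Y : Matrix ι ι ℝ} (hM : M.det ≠ 0) (t s : ι) :
    (M * Y).adjugate t s = M.det * ∑ i, Y.adjugate t i * M⁻¹ i s := by
  have h : M.adjugate = M.det • M⁻¹ := by
    rw [Matrix.inv_def, smul_smul, Ring.mul_inverse_cancel _ (IsUnit.mk0 _ hM), one_smul]
  rw [Matrix.adjugate_mul_distrib, h, Matrix.mul_smul, Matrix.smul_apply, Matrix.mul_apply,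
    smul_eq_mul]

end AdjugateRow

section IntegralMultiple

lemma exists_int_smul_isIntegral {κ : Type*} [Finite κ] (a : κ → ℝ)
    (ha : ∀ i, IsAlgebraic ℚ (a i)) :
    ∃ g : ℤ, g ≠ 0 ∧ ∀ i, IsIntegral ℤ ((g : ℝ) * a i) := by
  cases nonempty_fintype κ
  have h : ∀ i, ∃ y ≠ (0 : ℤ), IsIntegral ℤ (y • a i) := fun i =>
    ((IsFractionRing.isAlgebraic_iff ℤ ℚ ℝ).mpr (ha i)).exists_integral_multiple
  choose y hy0 hy using h
  refine ⟨∏ i, y i, Finset.prod_ne_zero_iff.mpr fun i _ => hy0 i, fun i => ?_⟩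
  classical
  rw [← Finset.prod_erase_mul _ _ (Finset.mem_univ i)]
  push_cast
  rw [mul_assoc]
  have h1 := hy i
  rw [zsmul_eq_mul] at h1
  refine IsIntegral.mul ?_ h1
  exact_mod_cast isIntegral_algebraMap (R := ℤ) (A := ℝ) (x := ∏ x ∈ Finset.univ.erase i, y x)

end IntegralMultiple

section Subspace

open Filter

variable {ι : Type*} [Fintype ι] [DecidableEq ι]

lemma eventually_sum_adjugate_eq_zero {M : Matrix ι ι ℝ} (hM : M.det ≠ 0) {e : ι → ℝ} {δ C : ℝ}
    (hδ : 0 < δ) (hC : 1 ≤ C) {L : ℕ → ℝ} (hL : Tendsto L atTop atTop)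
    {Y : ℕ → Matrix ι ι ℤ} {t : ι} {V : ι → ℤ}
    (hV : ∀ s, -δ ≤ e s → ∑ i, V i * M⁻¹ i s = 0)
    (hb : ∀ k s x, x ≠ t → |(M * (Y k).map (Int.castRingHom ℝ)) s x| ≤ C * exp (L k * e s)) :
    ∀ᶠ k in atTop, ∀ x, x ≠ t → ∑ i, V i * Y k i x = 0 := by
  set S := ∑ s, |∑ i, V i * M⁻¹ i s| with hS
  have hlim : Tendsto (fun k => S * (C * exp (-(δ * L k)))) atTop (nhds (S * (C * 0))) :=
    ((tendsto_exp_neg_atTop_nhds_zero.comp (hL.const_mul_atTop hδ)).const_mul C).const_mul S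
  rw [mul_zero, mul_zero] at hlim
  filter_upwards [hlim.eventually_lt_const zero_lt_one, hL.eventually_ge_atTop 0] with k hk hk0 x hx
  have h1 : ((∑ i, V i * Y k i x : ℤ) : ℝ) =
      ∑ s, (∑ i, V i * M⁻¹ i s) * (M * (Y k).map (Int.castRingHom ℝ)) s x := by
    have h2 : (Y k).map (Int.castRingHom ℝ) = M⁻¹ * (M * (Y k).map (Int.castRingHom ℝ)) := by
      rw [Matrix.nonsing_inv_mul_cancel_left _ _ (IsUnit.mk0 _ hM)]
    have h3 : ∀ i, ((Y k i x : ℤ) : ℝ) =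
        ∑ s, M⁻¹ i s * (M * (Y k).map (Int.castRingHom ℝ)) s x := by
      intro i
      rw [← Matrix.mul_apply, ← h2]
      rfl
    push_cast
    simp only [h3, Finset.mul_sum, Finset.sum_mul, mul_assoc]
    exact Finset.sum_comm
  have h2 : |((∑ i, V i * Y k i x : ℤ) : ℝ)| < 1 := by
    rw [h1]
    refine (Finset.abs_sum_le_sum_abs _ _).trans_lt (lt_of_le_of_lt ?_ hk)
    rw [hS, Finset.sum_mul]
    refine Finset.sum_le_sum fun s _ => ?_
    rw [abs_mul]
    by_cases hs : -δ ≤ e s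
    · rw [hV s hs, abs_zero, zero_mul, zero_mul]
    · refine mul_le_mul_of_nonneg_left ((hb k s x hx).trans ?_) (abs_nonneg _)
      gcongr
      rw [mul_comm δ, ← mul_neg]
      exact mul_le_mul_of_nonneg_left (not_le.mp hs).le hk0
  have h3 : |∑ i, V i * Y k i x| < 1 := by exact_mod_cast h2
  exact Int.abs_lt_one_iff.mp h3

open MvPolynomial in
lemma exists_large_ratHeight [Nonempty ι] {a : Matrix ι ι ℝ} (ha : ∀ i s, IsIntegral ℤ (a i s))
    {δ C : ℝ} (hδ : 0 < δ) (hC : 0 < C) : ∃ c₀ > (0 : ℝ), ∃ L₀ : ℝ, ∀ L, L₀ ≤ L → ∀ V : ι → ℤ,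
      ∀ s, ∑ i, V i * a i s ≠ 0 → |∑ i, V i * a i s| ≤ C * exp (-(δ * L)) →
      ∃ i j, i ≠ j ∧ V i ≠ 0 ∧ exp (c₀ * L) ≤ ratHeight (V j / V i) := by
  have h := fun s => exists_ratHeight_ge (fun i => a i s) fun i => ha i s
  choose c hc D h using h
  obtain ⟨c', hc', hcc⟩ : ∃ c' > 0, ∀ s, c' ≤ c s := by
    obtain ⟨s, -, hs⟩ := Finset.exists_min_image Finset.univ c Finset.univ_nonempty
    exact ⟨c s, hc s, fun x => hs x (Finset.mem_univ x)⟩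
  set D' := 1 + ∑ s, D s with hD'
  have hDD : ∀ s, D s ≤ D' := fun s =>
    (Finset.single_le_sum (f := D) (fun _ _ => Nat.zero_le _) (Finset.mem_univ s)).trans
      (Nat.le_add_left _ _)
  have hD'0 : (0 : ℝ) < D' := by
    rw [hD']
    positivity
  refine ⟨δ / (2 * D'), by positivity, max 1 (2 / δ * log (C / c')), fun L hL V s hw hwC => ?_⟩
  have hL1 : 0 < L := one_pos.trans_le ((le_max_left _ _).trans hL)
  have hL2 : log (C / c') ≤ δ / 2 * L := by
    have := (le_max_right _ _).trans hL
    rw [div_mul_eq_mul_div, div_le_iff₀ hδ] at this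
    linarith
  obtain ⟨i, -, hi⟩ : ∃ i ∈ Finset.univ, (V i : ℝ) * a i s ≠ 0 :=
    Finset.exists_ne_zero_of_sum_ne_zero hw
  have hVi : V i ≠ 0 := fun h0 => hi (by rw [h0, Int.cast_zero, zero_mul])
  obtain ⟨j, hj⟩ := h s V i hVi hw
  set H := ratHeight ((V j : ℚ) / V i) with hH
  have hH1 : 1 ≤ H := one_le_ratHeight _
  have h2 : exp (δ / 2 * L) ≤ H ^ D' := by
    have h3 : c' ≤ C * exp (-(δ * L)) * H ^ D' := by
      refine (hcc s).trans (hj.trans ?_)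
      gcongr
      exact hDD s
    have h4 : C ≤ c' * exp (δ / 2 * L) := by
      rw [mul_comm, ← div_le_iff₀ hc', ← log_le_iff_le_exp (by positivity)]
      exact hL2
    have h5 : exp (-(δ * L)) * exp (δ / 2 * L) * exp (δ / 2 * L) = 1 := by
      rw [← exp_add, ← exp_add, ← exp_zero]
      ring_nf
    have h6 : c' ≤ c' * (exp (δ / 2 * L) * exp (-(δ * L)) * H ^ D') := by
      calc c' ≤ C * (exp (-(δ * L)) * H ^ D') := by rwa [← mul_assoc]
        _ ≤ c' * exp (δ / 2 * L) * (exp (-(δ * L)) * H ^ D') := by gcongr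
        _ = _ := by ring
    have h7 : 1 ≤ exp (δ / 2 * L) * exp (-(δ * L)) * H ^ D' :=
      le_of_mul_le_mul_left (by rwa [mul_one]) hc'
    calc exp (δ / 2 * L) = exp (δ / 2 * L) * 1 := (mul_one _).symm
      _ ≤ exp (δ / 2 * L) * (exp (δ / 2 * L) * exp (-(δ * L)) * H ^ D') := by gcongr
      _ = (exp (-(δ * L)) * exp (δ / 2 * L) * exp (δ / 2 * L)) * H ^ D' := by ring
      _ = _ := by rw [h5, one_mul]
  have h3 : exp (δ / (2 * D') * L) ≤ H := by
    refine le_of_pow_le_pow_left₀ (n := D') (by rw [hD']; omega) (by linarith) ?_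
    rw [← exp_nat_mul]
    refine le_trans (le_of_eq ?_) h2
    congr 1
    field_simp
  refine ⟨i, j, ?_, hVi, h3⟩
  rintro rfl
  rw [hH, div_self (by exact_mod_cast hVi), ratHeight_one] at h3
  have : 0 < δ / (2 * D') * L := by positivity
  linarith [add_one_lt_exp this.ne']

end Subspace

section Subspace

open Filter

variable {ι : Type*} [Fintype ι] [DecidableEq ι]

/-- Replace a column of an integer matrix to obtain approximating matrices with a large ratio in
the inverse. -/
lemma map_updateCol_mul_inv {Y : Matrix ι ι ℤ} {t i : ι} (hi : Y.adjugate t i ≠ 0) :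
    (Y.updateCol t (Pi.single i 1)).map (Int.castRingHom ℚ) *
      ((Y.updateCol t (Pi.single i 1)).map (Int.castRingHom ℚ))⁻¹ = 1 ∧
    ∀ j, ((Y.updateCol t (Pi.single i 1)).map (Int.castRingHom ℚ))⁻¹ t j =
      (Y.adjugate t j : ℚ) / Y.adjugate t i := by
  have hdet : ((Y.updateCol t (Pi.single i 1)).map (Int.castRingHom ℚ)).det = Y.adjugate t i := by
    rw [← RingHom.mapMatrix_apply, ← RingHom.map_det, det_updateCol_single]
    rfl
  have hunit : IsUnit ((Y.updateCol t (Pi.single i 1)).map (Int.castRingHom ℚ)).det := by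
    rw [hdet]
    exact IsUnit.mk0 _ (by exact_mod_cast hi)
  refine ⟨Matrix.mul_nonsing_inv _ hunit, fun j => ?_⟩
  have hadj : ((Y.updateCol t (Pi.single i 1)).map (Int.castRingHom ℚ)).adjugate t j =
      Y.adjugate t j := by
    rw [← RingHom.mapMatrix_apply, ← RingHom.map_adjugate, RingHom.mapMatrix_apply,
      Matrix.map_apply, adjugate_updateCol_apply]
    rfl
  rw [Matrix.inv_def, Matrix.smul_apply, hadj, hdet, Ring.inverse_eq_inv', smul_eq_mul,
    inv_mul_eq_div]

lemma exists_cofactors_vanish [Nonempty ι] {M : Matrix ι ι ℝ} (hM : M.det ≠ 0)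
    (halg : ∀ i s, IsAlgebraic ℚ (M⁻¹ i s)) {e : ι → ℝ} {δ C : ℝ} (hδ : 0 < δ)
    (hsum : ∑ s, e s ≤ -(2 * δ)) (hC : 1 ≤ C) {L : ℕ → ℝ} (hL : Tendsto L atTop atTop)
    (Y : ℕ → Matrix ι ι ℤ) (t : ι)
    (hb : ∀ k s x, x ≠ t → |(M * (Y k).map (Int.castRingHom ℝ)) s x| ≤ C * exp (L k * e s)) :
    ∃ k, ∀ s, -δ ≤ e s → ∑ i, (Y k).adjugate t i * M⁻¹ i s = 0 := by
  by_contra! hcon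
  obtain ⟨g, hg0, hg⟩ := exists_int_smul_isIntegral (fun x : ι × ι => M⁻¹ x.1 x.2)
    fun x => halg x.1 x.2
  have hg1 : (1 : ℝ) ≤ |(g : ℝ)| := by exact_mod_cast Int.one_le_abs hg0
  have hgR : (g : ℝ) ≠ 0 := by exact_mod_cast hg0
  set a : Matrix ι ι ℝ := (g : ℝ) • M⁻¹ with ha
  have haint : ∀ i s, IsIntegral ℤ (a i s) := fun i s => hg (i, s)
  have haw : ∀ k s, ∑ i, ((Y k).adjugate t i : ℝ) * a i s =
      g * ∑ i, ((Y k).adjugate t i : ℝ) * M⁻¹ i s := by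
    intro k s
    rw [Finset.mul_sum]
    refine Finset.sum_congr rfl fun i _ => ?_
    rw [ha, Matrix.smul_apply, smul_eq_mul]
    ring
  obtain ⟨C₁, hC₁, hw⟩ : ∃ C₁ > 0, ∀ k s, |∑ i, ((Y k).adjugate t i : ℝ) * a i s| ≤
      C₁ * exp (L k * (∑ i, e i - e s)) := by
    refine ⟨|(g : ℝ)| * (|M.det|⁻¹ * ((Fintype.card ι).factorial * C ^ Fintype.card ι)),
      by positivity, fun k s => ?_⟩
    have h1 := abs_adjugate_apply_le _ t e hC (hb k) s
    have h2 : ((Y k).map (Int.castRingHom ℝ)).adjugate =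
        (Y k).adjugate.map (Int.castRingHom ℝ) := by
      rw [← RingHom.mapMatrix_apply, ← RingHom.map_adjugate, RingHom.mapMatrix_apply]
    rw [adjugate_mul_apply_eq hM, h2, abs_mul] at h1
    rw [haw, abs_mul, mul_assoc, mul_assoc |M.det|⁻¹]
    gcongr
    rw [inv_mul_eq_div, le_div_iff₀' (abs_pos.mpr hM)]
    exact h1
  obtain ⟨c₀, hc₀, L₀, hbig⟩ := exists_large_ratHeight haint hδ hC₁
  obtain ⟨k₀, hk₀⟩ := eventually_atTop.mp
    ((hL.eventually_ge_atTop L₀).and (hL.eventually_ge_atTop 0))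
  have hdata : ∀ k, ∃ i j, i ≠ j ∧ (Y (k + k₀)).adjugate t i ≠ 0 ∧ exp (c₀ * L (k + k₀)) ≤
      MvPolynomial.ratHeight ((Y (k + k₀)).adjugate t j / (Y (k + k₀)).adjugate t i) := by
    intro k
    obtain ⟨hkL, hk0⟩ := hk₀ (k + k₀) (Nat.le_add_left _ _)
    obtain ⟨s, hs, hne⟩ := hcon (k + k₀)
    refine hbig _ hkL _ s (by rw [haw]; exact mul_ne_zero hgR hne) ((hw _ s).trans ?_)
    gcongr
    nlinarith
  choose i j hij hi hj using hdata
  obtain ⟨E, hE, he⟩ : ∃ E > 0, ∀ s, |e s| ≤ E := by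
    refine ⟨1 + ∑ s, |e s|, by positivity, fun s => ?_⟩
    have : |e s| ≤ ∑ s, |e s| :=
      Finset.single_le_sum (f := fun s => |e s|) (fun _ _ => abs_nonneg _) (Finset.mem_univ s)
    linarith
  obtain ⟨C₂, hC₂, hMC⟩ : ∃ C₂ ≥ 0, ∀ s x, |M s x| ≤ C₂ := by
    refine ⟨∑ s, ∑ x, |M s x|, by positivity, fun s x => ?_⟩
    have h1 : |M s x| ≤ ∑ x, |M s x| :=
      Finset.single_le_sum (f := fun x => |M s x|) (fun _ _ => abs_nonneg _) (Finset.mem_univ x)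
    exact h1.trans (Finset.single_le_sum (f := fun s => ∑ x, |M s x|)
      (fun _ _ => Finset.sum_nonneg fun _ _ => abs_nonneg _) (Finset.mem_univ s))
  refine MvPolynomial.false_of_approximating_matrices (a := a) haint (t := t) (e := e)
    (by linarith) (C := C + C₂) (by linarith) hE he hc₀ (L := fun k => L (k + k₀))
    (hL.comp (tendsto_add_atTop_nat k₀))
    (Y := fun k => (Y (k + k₀)).updateCol t (Pi.single (i k) 1))
    (B := fun k => (g : ℝ)⁻¹ • (M * ((Y (k + k₀)).updateCol t
      (Pi.single (i k) 1)).map (Int.castRingHom ℝ)))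
    (fun k => (map_updateCol_mul_inv (hi k)).1) hij ?_ ?_ ?_ ?_
  · intro k
    rw [(map_updateCol_mul_inv (hi k)).2, div_self (by exact_mod_cast hi k)]
  · intro k
    rw [(map_updateCol_mul_inv (hi k)).2]
    exact hj k
  · intro k
    rw [ha, Matrix.smul_mul, Matrix.mul_smul, smul_smul, mul_inv_cancel₀ hgR, one_smul,
      Matrix.nonsing_inv_mul_cancel_left _ _ (IsUnit.mk0 _ hM)]
  · intro k s x
    have hk0 := (hk₀ (k + k₀) (Nat.le_add_left _ _)).2
    rw [Matrix.smul_apply, smul_eq_mul, abs_mul, abs_inv]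
    refine (mul_le_of_le_one_left (abs_nonneg _) (inv_le_one_of_one_le₀ hg1)).trans ?_
    rw [Matrix.mul_apply]
    by_cases hx : x = t
    · subst hx
      have hentry : ∀ j, (((Y (k + k₀)).updateCol x (Pi.single (i k) 1)).map
          (Int.castRingHom ℝ)) j x = if j = i k then 1 else 0 := by
        intro j
        rw [Matrix.map_apply, Matrix.updateCol_self, Pi.single_apply]
        split_ifs <;> simp
      simp only [hentry, mul_ite, mul_one, mul_zero, Finset.sum_ite_eq', Finset.mem_univ, if_true]
      rw [mul_assoc, ← exp_add]
      refine (hMC s (i k)).trans ?_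
      have h1 : 1 ≤ exp (L (k + k₀) * e s + E * L (k + k₀)) := by
        refine one_le_exp ?_
        nlinarith [neg_abs_le (e s), he s]
      nlinarith
    · have hentry : ∀ j, (((Y (k + k₀)).updateCol t (Pi.single (i k) 1)).map
          (Int.castRingHom ℝ)) j x = ((Y (k + k₀)).map (Int.castRingHom ℝ)) j x := by
        intro j
        rw [Matrix.map_apply, Matrix.updateCol_ne hx, Matrix.map_apply]
      simp only [hentry]
      rw [← Matrix.mul_apply, if_neg hx, mul_one]
      refine (hb (k + k₀) s x hx).trans ?_
      gcongr
      linarith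

/-- The subspace-type alternative: for a sequence of integer matrices whose columns, except for
one, have small values at the linear forms, almost all of these columns lie in one hyperplane. -/
theorem exists_eventually_sum_adjugate_eq_zero [Nonempty ι] {M : Matrix ι ι ℝ} (hM : M.det ≠ 0)
    (halg : ∀ i s, IsAlgebraic ℚ (M⁻¹ i s)) {e : ι → ℝ}
    (hsum : ∑ s, e s < 0) {C : ℝ} (hC : 1 ≤ C) {L : ℕ → ℝ} (hL : Tendsto L atTop atTop)
    (Y : ℕ → Matrix ι ι ℤ) (t : ι)
    (hb : ∀ k s x, x ≠ t → |(M * (Y k).map (Int.castRingHom ℝ)) s x| ≤ C * exp (L k * e s)) :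
    ∃ k₀, ∀ᶠ k in atTop, ∀ x, x ≠ t → ∑ i, (Y k₀).adjugate t i * Y k i x = 0 := by
  have hδ : 0 < -(∑ s, e s) / 2 := by linarith
  obtain ⟨k₀, hk₀⟩ := exists_cofactors_vanish hM halg hδ (by linarith) hC hL Y t hb
  exact ⟨k₀, eventually_sum_adjugate_eq_zero hM hδ hC hL hk₀ hb⟩

end Subspace

section CompoundEstimates

lemma abs_det_le_factorial_mul {p : ℕ} {A : Matrix (Fin p) (Fin p) ℝ} {X : ℝ}
    (h : ∀ σ : Equiv.Perm (Fin p), ∏ i, |A (σ i) i| ≤ X) : |A.det| ≤ p.factorial * X := by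
  rw [Matrix.det_apply']
  refine (Finset.abs_sum_le_sum_abs _ _).trans ?_
  refine (Finset.sum_le_card_nsmul _ _ X fun σ _ => ?_).trans (le_of_eq ?_)
  · have hsign : |((Equiv.Perm.sign σ : ℤ) : ℝ)| = 1 := by
      rcases Int.units_eq_one_or (Equiv.Perm.sign σ) with h | h <;> simp [h]
    rw [abs_mul, hsign, one_mul, Finset.abs_prod]
    exact h σ
  · rw [Finset.card_univ, Fintype.card_perm, Fintype.card_fin, nsmul_eq_mul]

lemma abs_compound_le {n p : ℕ} {A : Matrix (Fin n) (Fin n) ℝ} {w : Fin n → ℝ}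
    (h : ∀ i j, |A i j| ≤ exp (w i)) (s t : Set.powersetCard (Fin n) p) :
    |compound p A s t| ≤ p.factorial * exp (∑ i, w (Set.powersetCard.ofFinEmbEquiv.symm s i)) := by
  refine abs_det_le_factorial_mul fun σ => ?_
  rw [← Equiv.sum_comp σ, exp_sum]
  exact Finset.prod_le_prod (fun _ _ => abs_nonneg _) fun i _ => h _ _

lemma exists_lt_of_ne_lastIndices {n p : ℕ} (hp : p ≤ n) {t : Set.powersetCard (Fin n) p}
    (ht : t ≠ lastIndices p hp) :
    ∃ i, (Set.powersetCard.ofFinEmbEquiv.symm t i : ℕ) < n - p := by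
  by_contra! h
  refine ht (Set.powersetCard.eq_iff_subset.mpr fun a ha => ?_)
  have ha' := (Set.powersetCard.mem_range_ofFinEmbEquiv_symm_iff_mem t a).mpr ha
  obtain ⟨i, rfl⟩ := ha'
  refine (Set.powersetCard.mem_range_ofFinEmbEquiv_symm_iff_mem _ _).mp
    ⟨⟨Set.powersetCard.ofFinEmbEquiv.symm t i - (n - p), ?_⟩, ?_⟩
  · have h1 := (Set.powersetCard.ofFinEmbEquiv.symm t i).isLt
    have h2 := h i
    omega
  · rw [lastIndices_symm_apply, Fin.ext_iff]
    simp only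
    have := h i
    omega

lemma abs_compound_lastIndices_le {n p : ℕ} (hp : p ≤ n) {A : Matrix (Fin n) (Fin n) ℝ}
    {w : Fin n → ℝ} {η : ℝ} (h : ∀ i j, |A i j| ≤ exp (w i))
    (h' : ∀ i j : Fin n, n - p ≤ i → (j : ℕ) < n - p → |A i j| ≤ exp (w i - η))
    {t : Set.powersetCard (Fin n) p} (ht : t ≠ lastIndices p hp) :
    |compound p A (lastIndices p hp) t| ≤ p.factorial *
      exp (∑ i, w (Set.powersetCard.ofFinEmbEquiv.symm (lastIndices p hp) i) - η) := by
  obtain ⟨i₀, hi₀⟩ := exists_lt_of_ne_lastIndices hp ht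
  refine abs_det_le_factorial_mul fun σ => ?_
  rw [← Equiv.sum_comp σ, ← Finset.add_sum_erase _ _ (Finset.mem_univ i₀),
    ← Finset.mul_prod_erase _ _ (Finset.mem_univ i₀), add_sub_right_comm, exp_add, exp_sum]
  refine mul_le_mul (h' _ _ ?_ hi₀) (Finset.prod_le_prod (fun _ _ => abs_nonneg _) fun i _ => h _ _)
    (Finset.prod_nonneg fun _ _ => abs_nonneg _) (exp_nonneg _)
  rw [lastIndices_symm_apply]
  exact Nat.le_add_right _ _

lemma sum_sum_ofFinEmbEquiv {n p : ℕ} (hp : 0 < p) {w : Fin n → ℝ} (hw : ∑ i, w i = 0) :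
    ∑ s : Set.powersetCard (Fin n) p, ∑ i, w (Set.powersetCard.ofFinEmbEquiv.symm s i) = 0 := by
  classical
  have h1 : ∀ s : Set.powersetCard (Fin n) p,
      ∑ i, w (Set.powersetCard.ofFinEmbEquiv.symm s i) = ∑ a ∈ s.val, w a := by
    intro s
    refine Finset.sum_bij (fun i _ => Set.powersetCard.ofFinEmbEquiv.symm s i) (fun i _ => ?_)
      (fun i _ j _ h => (Set.powersetCard.ofFinEmbEquiv.symm s).injective h) (fun a ha => ?_)
      fun _ _ => rfl
    · exact (Set.powersetCard.mem_range_ofFinEmbEquiv_symm_iff_mem s _).mp ⟨i, rfl⟩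
    · obtain ⟨i, hi⟩ := (Set.powersetCard.mem_range_ofFinEmbEquiv_symm_iff_mem s a).mpr ha
      exact ⟨i, Finset.mem_univ _, hi⟩
  have h2 : ∑ s : Set.powersetCard (Fin n) p, ∑ a ∈ s.val, w a =
      ∑ s ∈ Finset.univ.powersetCard p, ∑ a ∈ s, w a := by
    refine Finset.sum_bij (fun s _ => s.val) (fun s _ => ?_) (fun s _ t _ h => Subtype.ext h)
      (fun s hs => ?_) fun _ _ => rfl
    · exact Finset.mem_powersetCard.mpr ⟨Finset.subset_univ _, s.prop⟩
    · exact ⟨⟨s, (Finset.mem_powersetCard.mp hs).2⟩, Finset.mem_univ _, rfl⟩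
  have h3 : ∀ a : Fin n, ((Finset.univ.powersetCard p).filter (a ∈ ·)).card =
      Nat.choose (n - 1) (p - 1) := by
    intro a
    have := Finset.card_filter_powersetCard_subset {a} Finset.univ p (Finset.subset_univ _)
      (by simp; omega)
    simpa using this
  calc _ = ∑ s ∈ Finset.univ.powersetCard p, ∑ a, if a ∈ s then w a else 0 := by
        rw [Finset.sum_congr rfl fun s _ => h1 s, h2]
        refine Finset.sum_congr rfl fun s _ => ?_
        rw [← Finset.sum_filter]
        simp
    _ = ∑ a, (Nat.choose (n - 1) (p - 1) : ℝ) * w a := by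
        rw [Finset.sum_comm]
        refine Finset.sum_congr rfl fun a _ => ?_
        rw [← Finset.sum_filter, Finset.sum_const, nsmul_eq_mul, h3]
    _ = 0 := by rw [← Finset.mul_sum, hw, mul_zero]

end CompoundEstimates

section BlockTriangular

open Filter

lemma isAlgebraic_det {ι : Type*} [Fintype ι] [DecidableEq ι] {A : Matrix ι ι ℝ}
    (hA : ∀ i j, IsAlgebraic ℚ (A i j)) : IsAlgebraic ℚ A.det :=
  (IsIntegral.det fun i j => (hA i j).isIntegral).isAlgebraic

lemma isAlgebraic_inv_apply {ι : Type*} [Fintype ι] [DecidableEq ι] {A : Matrix ι ι ℝ}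
    (hA : ∀ i j, IsAlgebraic ℚ (A i j)) (i j : ι) : IsAlgebraic ℚ (A⁻¹ i j) := by
  rw [Matrix.inv_def, Matrix.smul_apply, Ring.inverse_eq_inv', smul_eq_mul, Matrix.adjugate_apply]
  refine (isAlgebraic_det hA).inv.mul (isAlgebraic_det fun x y => ?_)
  rw [Matrix.updateRow_apply]
  split_ifs
  · rw [Pi.single_apply]
    split_ifs
    · exact isAlgebraic_one
    · exact isAlgebraic_zero
  · exact hA x y

/-- If the columns of a unimodular matrix are adapted to the linear forms with a gap after the first
`k` columns, then the span of these columns is eventually constant. -/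
lemma exists_eventually_inv_mul_apply_eq_zero {n k : ℕ} (hkn : k < n)
    {M : Matrix (Fin n) (Fin n) ℝ} (hM : M.det ≠ 0) (halg : ∀ i j, IsAlgebraic ℚ (M i j))
    {γ : Fin n → ℝ} (hγ : ∑ i, γ i = 0) {η : ℝ} (hη : 0 < η) :
    ∃ κ₀ > 0, ∀ κ ≤ κ₀, ∀ (L : ℕ → ℝ), Tendsto L atTop atTop →
      ∀ U : ℕ → Matrix (Fin n) (Fin n) ℤ, (∀ m, IsUnit (U m).det) →
      (∀ m i j, |(M * (U m).map (Int.castRingHom ℝ)) i j| ≤ exp (L m * (γ i + κ))) →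
      (∀ m (i j : Fin n), k ≤ i → (j : ℕ) < k →
        |(M * (U m).map (Int.castRingHom ℝ)) i j| ≤ exp (L m * (γ i + κ - η))) →
      ∃ m₀, ∀ᶠ m in atTop, ∀ i j : Fin n, k ≤ i → (j : ℕ) < k → ((U m₀)⁻¹ * U m) i j = 0 := by
  obtain ⟨p, hp0, rfl⟩ : ∃ p, 0 < p ∧ n = k + p := ⟨n - k, by omega, by omega⟩
  have hp : p ≤ k + p := by omega
  have hkp : k + p - p = k := by omega
  set N := (Fintype.card (Set.powersetCard (Fin (k + p)) p) : ℝ) with hN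
  have hN0 : 0 ≤ N := Nat.cast_nonneg _
  refine ⟨η / (2 * (N * p + 1)), by positivity, fun κ hκ L hL U hU h1 h2 => ?_⟩
  have hκ' : N * (p * κ) < η := by
    have h3 : N * p * κ ≤ N * p * (η / (2 * (N * p + 1))) := by gcongr
    have h4 : N * p * (η / (2 * (N * p + 1))) ≤ η / 2 := by
      rw [mul_div_assoc', div_le_div_iff₀ (by positivity) (by positivity)]
      nlinarith
    rw [← mul_assoc]
    linarith
  have hne : Nonempty (Set.powersetCard (Fin (k + p)) p) := ⟨lastIndices p hp⟩
  have hcM : compound p M * compound p M⁻¹ = 1 :=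
    compound_mul_compound_of_mul_eq_one p (Matrix.mul_nonsing_inv _ (IsUnit.mk0 _ hM))
  have hsum : ∑ s : Set.powersetCard (Fin (k + p)) p,
      ((∑ i, γ (Set.powersetCard.ofFinEmbEquiv.symm s i)) + p * κ -
        if s = lastIndices p hp then η else 0) < 0 := by
    rw [Finset.sum_sub_distrib, Finset.sum_add_distrib, sum_sum_ofFinEmbEquiv hp0 hγ,
      Finset.sum_ite_eq' Finset.univ, Finset.sum_const, Finset.card_univ, nsmul_eq_mul, ← hN]
    simp only [Finset.mem_univ, if_true]
    linarith
  have hmul : ∀ m, compound p M * (compound p (U m)).map (Int.castRingHom ℝ) =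
      compound p (M * (U m).map (Int.castRingHom ℝ)) := by
    intro m
    rw [compound_mul, compound_map]
  have hexp : ∀ m (s : Set.powersetCard (Fin (k + p)) p),
      ∑ i, L m * (γ (Set.powersetCard.ofFinEmbEquiv.symm s i) + κ) =
      L m * ((∑ i, γ (Set.powersetCard.ofFinEmbEquiv.symm s i)) + p * κ) := by
    intro m s
    rw [← Finset.mul_sum, Finset.sum_add_distrib, Finset.sum_const, Finset.card_univ,
      Fintype.card_fin, nsmul_eq_mul]
  obtain ⟨m₀, hm₀⟩ := exists_eventually_sum_adjugate_eq_zero (M := compound p M)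
    (fun h => by simpa [h] using congrArg Matrix.det hcM) (fun i s => by
      rw [Matrix.inv_eq_right_inv hcM]
      exact isAlgebraic_det fun x y => isAlgebraic_inv_apply halg _ _)
    hsum (C := p.factorial) (by exact_mod_cast p.factorial_pos) hL (fun m => compound p (U m))
    (lastIndices p hp) (fun m s x hx => by
      rw [hmul]
      split_ifs with hs
      · subst hs
        have := abs_compound_lastIndices_le hp (w := fun i => L m * (γ i + κ)) (η := L m * η)
          (h1 m) (fun i j hi hj => by
            rw [hkp] at hi hj
            rw [← mul_sub]
            exact h2 m i j hi hj) hx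
        rwa [hexp, ← mul_sub] at this
      · have := abs_compound_le (w := fun i => L m * (γ i + κ)) (h1 m) s x
        rwa [hexp, ← sub_zero (_ + _ * κ)] at this)
  refine ⟨m₀, hm₀.mono fun m hm i j hi hj => ?_⟩
  have hinv : (U m₀)⁻¹ * U m₀ = 1 := Matrix.nonsing_inv_mul _ (hU m₀)
  have hcU : compound p (U m₀)⁻¹ * compound p (U m₀) = 1 :=
    compound_mul_compound_of_mul_eq_one p hinv
  have hadj : (compound p (U m₀)).adjugate =
      (compound p (U m₀)).det • compound p (U m₀)⁻¹ := by
    rw [← mul_one (compound p (U m₀)).adjugate, ← mul_eq_one_comm.mp hcU, ← mul_assoc,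
      Matrix.adjugate_mul, Matrix.smul_mul, one_mul]
  have hdet : (compound p (U m₀)).det ≠ 0 := fun h => by
    simpa [h] using congrArg Matrix.det hcU
  have hrow : ∀ t, t ≠ lastIndices p hp →
      compound p ((U m₀)⁻¹ * U m) (lastIndices p hp) t = 0 := by
    intro t ht
    have h3 := hm t ht
    rw [← Matrix.mul_apply, hadj, Matrix.smul_mul, Matrix.smul_apply, ← compound_mul,
      smul_eq_mul] at h3
    exact (mul_eq_zero.mp h3).resolve_left hdet
  have hZ : ((U m)⁻¹ * U m₀) * ((U m₀)⁻¹ * U m) = 1 := by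
    rw [mul_assoc, ← mul_assoc (U m₀), Matrix.mul_nonsing_inv _ (hU m₀), one_mul,
      Matrix.nonsing_inv_mul _ (hU m)]
  have hcZ := mul_eq_one_comm.mp (compound_mul_compound_of_mul_eq_one p hZ)
  have hlast : compound p ((U m₀)⁻¹ * U m) (lastIndices p hp) (lastIndices p hp) ≠ 0 := by
    intro h0
    have h3 := congrFun (congrFun hcZ (lastIndices p hp)) (lastIndices p hp)
    rw [Matrix.mul_apply, Matrix.one_apply_eq, Finset.sum_eq_zero] at h3
    · exact zero_ne_one h3
    · intro t _
      by_cases ht : t = lastIndices p hp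
      · rw [ht, h0, zero_mul]
      · rw [hrow t ht, zero_mul]
  have := eq_zero_of_compound_row hp (((U m₀)⁻¹ * U m).map (Int.castRingHom ℚ))
    (by
      rw [compound_map, Matrix.map_apply, eq_intCast]
      exact_mod_cast hlast)
    (fun t ht => by rw [compound_map, Matrix.map_apply, hrow t ht, map_zero]) i j
    (by omega) (by omega)
  rw [Matrix.map_apply, eq_intCast] at this
  exact_mod_cast this

end BlockTriangular

section Exponents

open Filter Topology

/-- The reduced basis theorem for the parallelepiped given by the linear forms `M` and the weights
`exp (L * c i)`, in logarithmic scale. -/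
lemma exists_reduced_basis_exp {d : ℕ} {M : Matrix (Fin (d + 1)) (Fin (d + 1)) ℝ} (hM : M.det ≠ 0)
    {c : Fin (d + 1) → ℝ} (hc : ∑ i, c i = 0) :
    ∃ K ≥ 0, ∀ L : ℝ, 1 ≤ L → ∃ (U : Matrix (Fin (d + 1)) (Fin (d + 1)) ℤ)
      (τ : Equiv.Perm (Fin (d + 1))) (b : Fin (d + 1) → ℝ), IsUnit U.det ∧
      |∑ i, b i| ≤ K / L ∧ (∀ i j, i ≤ j → b i ≤ b j + K / L) ∧ (∀ i, |b i| ≤ K) ∧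
      (∀ i j, |(M * U.map (Int.castRingHom ℝ)) (τ i) j| ≤
        exp (L * (c (τ i) + b (min i j) + K / L))) ∧
      ∀ x : Fin (d + 1) → ℤ, x ≠ 0 → ∀ δ, (∀ s, |M.mulVec (fun i => (x i : ℝ)) s| ≤
        exp (L * (c s - δ))) → b 0 ≤ K / L - δ := by
  obtain ⟨C, hC, hred⟩ := exists_reduced_basis (d + 1)
  obtain ⟨m, hm, hmin⟩ := exists_pos_le_norm_mulVec_intCast M hM
  obtain ⟨E, hE, hcE⟩ : ∃ E ≥ 0, ∀ s, |c s| ≤ E :=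
    ⟨∑ s, |c s|, by positivity, fun s =>
      Finset.single_le_sum (f := fun s => |c s|) (fun _ _ => abs_nonneg _) (Finset.mem_univ s)⟩
  have hlogC : 0 ≤ log C := log_nonneg hC
  set K₀ : ℝ := |log m| + E + 2 * log C with hK₀
  have hK₀0 : 0 ≤ K₀ := by positivity
  refine ⟨|log (|M.det|)| + (d + 1) * K₀, by positivity, fun L hL => ?_⟩
  have hL0 : 0 < L := by linarith
  set A : Matrix (Fin (d + 1)) (Fin (d + 1)) ℝ :=
    Matrix.diagonal (fun i => exp (-(L * c i))) * M with hA
  have hdetA : A.det = M.det := by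
    rw [hA, Matrix.det_mul, Matrix.det_diagonal, ← exp_sum, Finset.sum_neg_distrib,
      ← Finset.mul_sum, hc, mul_zero, neg_zero, exp_zero, one_mul]
  obtain ⟨U, τ, b, hU, hb0, hprod, hmono, hent, hfirst⟩ := hred A (by rwa [hdetA])
  rw [hdetA] at hprod
  have hAU : ∀ i j, |(M * U.map (Int.castRingHom ℝ)) i j| =
      exp (L * c i) * |(A * U.map (Int.cast : ℤ → ℝ)) i j| := by
    intro i j
    rw [hA, mul_assoc, Matrix.diagonal_mul, abs_mul, abs_exp, ← mul_assoc, ← exp_add,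
      add_neg_cancel, exp_zero, one_mul]
    rfl
  have hAx : ∀ (x : Fin (d + 1) → ℝ) i, |A.mulVec x i| = exp (-(L * c i)) * |M.mulVec x i| := by
    intro x i
    rw [hA, ← Matrix.mulVec_mulVec, Matrix.mulVec_diagonal, abs_mul, abs_exp]
  have hb0' : log m - L * E - log C ≤ log (b 0) := by
    have hx : (fun i => U i 0) ≠ 0 := by
      intro h
      have : U.det = 0 := Matrix.det_eq_zero_of_column_eq_zero 0 fun i => congrFun h i
      rw [this] at hU
      exact not_isUnit_zero hU
    have h1 : m ≤ exp (L * E) * C * b 0 := by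
      refine (hmin _ hx).trans ((pi_norm_le_iff_of_nonneg (by have := hb0 0; positivity)).mpr
        fun i => ?_)
      have h2 : M.mulVec (fun k => ((U k 0 : ℤ) : ℝ)) i = (M * U.map (Int.castRingHom ℝ)) i 0 := by
        rw [Matrix.mul_apply]
        rfl
      have h3 := hent (τ.symm i) 0
      rw [Equiv.apply_symm_apply, min_eq_right (Fin.zero_le _)] at h3
      rw [Real.norm_eq_abs, h2, hAU, mul_assoc (exp _)]
      have h4 := (abs_le.mp (hcE i)).2
      gcongr
    have h2 := log_le_log hm h1
    rw [log_mul (by positivity) (hb0 0).ne', log_mul (by positivity) (by positivity), log_exp] at h2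
    linarith
  have hlow : ∀ i, -(K₀ * L) ≤ log (b i) := by
    intro i
    have h1 := log_le_log (hb0 0) (hmono 0 i (Fin.zero_le _))
    rw [log_mul (by positivity) (hb0 i).ne'] at h1
    have h2 : |log m| ≤ |log m| * L := le_mul_of_one_le_right (abs_nonneg _) hL
    have h3 : log C ≤ log C * L := le_mul_of_one_le_right hlogC hL
    have h4 := neg_abs_le (log m)
    rw [hK₀]
    nlinarith
  have hsumlog : ∑ i, log (b i) = log (|M.det|) := by
    rw [← log_prod fun i _ => (hb0 i).ne', hprod]
  have hup : ∀ i, log (b i) ≤ |log (|M.det|)| + d * (K₀ * L) := by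
    intro i
    have h1 : ∑ j ∈ Finset.univ.erase i, -(K₀ * L) ≤ ∑ j ∈ Finset.univ.erase i, log (b j) :=
      Finset.sum_le_sum fun j _ => hlow j
    rw [Finset.sum_const, Finset.card_erase_of_mem (Finset.mem_univ i), Finset.card_univ,
      Fintype.card_fin, Nat.add_sub_cancel, nsmul_eq_mul] at h1
    rw [← Finset.add_sum_erase _ _ (Finset.mem_univ i)] at hsumlog
    have h2 := le_abs_self (log (|M.det|))
    linarith
  have hKC : log C ≤ |log (|M.det|)| + (d + 1) * K₀ := by
    have h1 := abs_nonneg (log (|M.det|))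
    have h2 : 0 ≤ d * K₀ := by positivity
    have h3 : log C ≤ K₀ := by
      have := abs_nonneg (log m)
      linarith
    linarith
  refine ⟨U, τ, fun i => log (b i) / L, hU, ?_, ?_, ?_, ?_, ?_⟩
  · rw [← Finset.sum_div, hsumlog, abs_div, abs_of_pos hL0]
    refine (div_le_div_iff_of_pos_right hL0).mpr ?_
    have : 0 ≤ (d + 1) * K₀ := by positivity
    linarith
  · intro i j hij
    rw [← add_div]
    refine (div_le_div_iff_of_pos_right hL0).mpr ?_
    have h1 := log_le_log (hb0 i) (hmono i j hij)
    rw [log_mul (by positivity) (hb0 j).ne'] at h1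
    linarith
  · intro i
    rw [abs_div, abs_of_pos hL0, div_le_iff₀ hL0, abs_le]
    have h1 := hlow i
    have h2 := hup i
    have h3 : |log (|M.det|)| ≤ |log (|M.det|)| * L := le_mul_of_one_le_right (abs_nonneg _) hL
    have h4 : 0 ≤ d * (K₀ * L) := by positivity
    have h5 : 0 ≤ K₀ * L := by positivity
    have h6 := abs_nonneg (log (|M.det|))
    constructor <;> nlinarith
  · intro i j
    have h1 : L * (c (τ i) + log (b (min i j)) / L + (|log (|M.det|)| + (d + 1) * K₀) / L) =
        L * c (τ i) + (log (b (min i j)) + (|log (|M.det|)| + (d + 1) * K₀)) := by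
      field_simp
      ring
    rw [h1, hAU, exp_add (L * _), exp_add (log _), exp_log (hb0 _), mul_comm (b _)]
    have h2 : C ≤ exp (|log (|M.det|)| + (d + 1) * K₀) := by
      rwa [← log_le_iff_le_exp (by positivity)]
    refine mul_le_mul_of_nonneg_left ((hent i j).trans ?_) (exp_nonneg _)
    exact mul_le_mul_of_nonneg_right h2 (hb0 _).le
  · intro x hx δ hδ
    obtain ⟨i, hi⟩ := hfirst x hx (Nat.succ_pos _)
    rw [hAx] at hi
    have h1 : b 0 ≤ C * exp (-(L * δ)) := by
      refine hi.trans ?_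
      gcongr
      refine (mul_le_mul_of_nonneg_left (hδ i) (exp_nonneg _)).trans (le_of_eq ?_)
      rw [← exp_add]
      congr 1
      ring
    have h2 := log_le_log (hb0 0) h1
    rw [log_mul (by positivity) (exp_ne_zero _), log_exp] at h2
    rw [div_sub' hL0.ne']
    refine (div_le_div_iff_of_pos_right hL0).mpr ?_
    linarith

/-- Passing to the limit in the exponents of the reduced bases. -/
lemma exists_limit_exponents {d : ℕ} {M : Matrix (Fin (d + 1)) (Fin (d + 1)) ℝ} (hM : M.det ≠ 0)
    {c : Fin (d + 1) → ℝ} (hc : ∑ i, c i = 0) {δ : ℝ} (hδ : 0 < δ) {L : ℕ → ℝ}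
    (hL : Tendsto L atTop atTop) {x : ℕ → Fin (d + 1) → ℤ} (hx0 : ∀ k, x k ≠ 0)
    (hx : ∀ k s, |M.mulVec (fun i => (x k i : ℝ)) s| ≤ exp (L k * (c s - δ))) :
    ∃ (τ : Equiv.Perm (Fin (d + 1))) (b : Fin (d + 1) → ℝ), Monotone b ∧ ∑ i, b i = 0 ∧ b 0 < 0 ∧
      ∀ κ > 0, ∃ᶠ k in atTop, ∃ U : Matrix (Fin (d + 1)) (Fin (d + 1)) ℤ, IsUnit U.det ∧
        ∀ i j, |(M * U.map (Int.castRingHom ℝ)) (τ i) j| ≤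
          exp (L k * (c (τ i) + b (min i j) + κ)) := by
  obtain ⟨K, hK, hred⟩ := exists_reduced_basis_exp hM hc
  have hred' : ∀ k, ∃ (U : Matrix (Fin (d + 1)) (Fin (d + 1)) ℤ)
      (τ : Equiv.Perm (Fin (d + 1))) (b : Fin (d + 1) → ℝ), 1 ≤ L k → IsUnit U.det ∧
      |∑ i, b i| ≤ K / L k ∧ (∀ i j, i ≤ j → b i ≤ b j + K / L k) ∧ (∀ i, |b i| ≤ K) ∧
      (∀ i j, |(M * U.map (Int.castRingHom ℝ)) (τ i) j| ≤
        exp (L k * (c (τ i) + b (min i j) + K / L k))) ∧ b 0 ≤ K / L k - δ := by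
    intro k
    by_cases hk : 1 ≤ L k
    · obtain ⟨U, τ, b, h1, h2, h3, h4, h5, h6⟩ := hred (L k) hk
      exact ⟨U, τ, b, fun _ => ⟨h1, h2, h3, h4, h5, h6 (x k) (hx0 k) δ (hx k)⟩⟩
    · exact ⟨0, 1, 0, fun h => absurd h hk⟩
  choose U τ b hdata using hred'
  set F : Ultrafilter ℕ := hyperfilter ℕ with hF
  have hFle : (F : Filter ℕ) ≤ atTop := Nat.hyperfilter_le_atTop
  have hLF : Tendsto L F atTop := hL.mono_left hFle
  have hL1 : ∀ᶠ k in (F : Filter ℕ), 1 ≤ L k := hLF.eventually_ge_atTop 1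
  have hKL : Tendsto (fun k => K / L k) F (𝓝 0) := hLF.const_div_atTop K
  obtain ⟨τ', hτ'⟩ := Ultrafilter.eq_pure_of_finite (F.map τ)
  have hτ : ∀ᶠ k in (F : Filter ℕ), τ k = τ' := by
    have : ({τ'} : Set _) ∈ F.map τ := by
      rw [hτ']
      exact Set.mem_singleton _
    exact this
  have hcpt : IsCompact (Set.pi Set.univ fun _ : Fin (d + 1) => Set.Icc (-K) K) :=
    isCompact_univ_pi fun _ => isCompact_Icc
  obtain ⟨b', -, hb'⟩ := hcpt.ultrafilter_le_nhds' (F.map b) (by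
    rw [Ultrafilter.mem_map]
    filter_upwards [hL1] with k hk i _
    exact abs_le.mp ((hdata k hk).2.2.2.1 i))
  have hlim : ∀ i, Tendsto (fun k => b k i) F (𝓝 (b' i)) := tendsto_pi_nhds.mp hb'
  refine ⟨τ', b', fun i j hij => ?_, ?_, ?_, fun κ hκ => ?_⟩
  · have := le_of_tendsto_of_tendsto (hlim i) ((hlim j).add hKL)
      (hL1.mono fun k hk => (hdata k hk).2.2.1 i j hij)
    rwa [add_zero] at this
  · have h1 : Tendsto (fun k => ∑ i, b k i) F (𝓝 (∑ i, b' i)) :=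
      tendsto_finsetSum _ fun i _ => hlim i
    have h2 : Tendsto (fun k => ∑ i, b k i) F (𝓝 0) :=
      squeeze_zero_norm' (hL1.mono fun k hk => (hdata k hk).2.1) hKL
    exact tendsto_nhds_unique h1 h2
  · have := le_of_tendsto_of_tendsto (hlim 0) (hKL.sub_const δ)
      (hL1.mono fun k hk => (hdata k hk).2.2.2.2.2)
    linarith
  · have h1 : ∀ᶠ k in (F : Filter ℕ), ∀ i, b k i < b' i + κ / 2 :=
      eventually_all.mpr fun i => (hlim i).eventually_lt_const (by linarith)
    have h2 : ∀ᶠ k in (F : Filter ℕ), K / L k < κ / 2 := hKL.eventually_lt_const (by linarith)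
    have h3 : ∀ᶠ k in (F : Filter ℕ), ∃ U : Matrix (Fin (d + 1)) (Fin (d + 1)) ℤ, IsUnit U.det ∧
        ∀ i j, |(M * U.map (Int.castRingHom ℝ)) (τ' i) j| ≤
          exp (L k * (c (τ' i) + b' (min i j) + κ)) := by
      filter_upwards [h1, h2, hL1, hτ] with k hk1 hk2 hk3 hk4
      refine ⟨U k, (hdata k hk3).1, fun i j => ?_⟩
      have h4 := (hdata k hk3).2.2.2.2.1 i j
      rw [hk4] at h4
      refine h4.trans (exp_le_exp.mpr (mul_le_mul_of_nonneg_left ?_ (by linarith)))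
      have := hk1 (min i j)
      linarith
    exact h3.frequently.filter_mono hFle

end Exponents

section SmallValues

open Filter Topology

lemma exists_gap {d : ℕ} {b : Fin (d + 1) → ℝ} (hb : Monotone b) (hsum : ∑ i, b i = 0)
    (h0 : b 0 < 0) : ∃ k, 0 < k ∧ k < d + 1 ∧ ∃ η > 0,
      (∀ j : Fin (d + 1), (j : ℕ) < k → b j = b 0) ∧
      ∀ i : Fin (d + 1), k ≤ i → b 0 + η ≤ b i := by
  have hex : ∃ k : ℕ, ∃ hk : k < d + 1, b 0 < b ⟨k, hk⟩ := by
    by_contra! h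
    have h1 : ∑ i, b i ≤ ∑ _i : Fin (d + 1), b 0 := Finset.sum_le_sum fun i _ => h i i.isLt
    rw [hsum, Finset.sum_const, Finset.card_univ, Fintype.card_fin, nsmul_eq_mul] at h1
    have h2 : ((d + 1 : ℕ) : ℝ) * b 0 < 0 := mul_neg_of_pos_of_neg (by positivity) h0
    linarith
  classical
  obtain ⟨hlt, hgap⟩ := Nat.find_spec hex
  refine ⟨Nat.find hex, Nat.pos_of_ne_zero fun h => ?_, hlt, b ⟨Nat.find hex, hlt⟩ - b 0,
    sub_pos.mpr hgap, fun j hj => ?_, fun i hi => ?_⟩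
  · have : (⟨Nat.find hex, hlt⟩ : Fin (d + 1)) = 0 := Fin.ext h
    rw [this] at hgap
    exact lt_irrefl _ hgap
  · have := Nat.find_min hex hj
    push Not at this
    exact le_antisymm (this j.isLt) (hb (Fin.zero_le _))
  · have : b ⟨Nat.find hex, hlt⟩ ≤ b i := hb (Fin.le_def.mpr hi)
    linarith

/-- A nonzero row of a matrix of full column rank belongs to a nonsingular maximal square
submatrix. -/
lemma exists_det_submatrix_ne_zero {n k : ℕ} {B : Matrix (Fin n) (Fin k) ℝ}
    {B' : Matrix (Fin k) (Fin n) ℝ} (hB : B' * B = 1) {i₀ : Fin n} (hi₀ : B i₀ ≠ 0) :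
    ∃ e : Fin k → Fin n, Function.Injective e ∧ i₀ ∈ Set.range e ∧
      (B.submatrix e id).det ≠ 0 := by
  classical
  have hs : LinearIndepOn ℝ B.row {i₀} := LinearIndepOn.singleton hi₀
  set I := hs.extend (Set.subset_univ _) with hI
  have hli : LinearIndependent ℝ fun x : I => B.row x := hs.linearIndepOn_extend _
  have hspan : ⊤ ≤ Submodule.span ℝ (Set.range fun x : I => B.row x) := by
    have h1 : Set.range (fun x : I => B.row x) = B.row '' I := by
      rw [Set.image_eq_range]
    rw [h1, hI, LinearIndepOn.span_image_extend_eq_span_image, Set.image_univ]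
    intro v _
    have h2 : v = ∑ i, Matrix.vecMul v B' i • B.row i := by
      conv_lhs => rw [← Matrix.vecMul_one v, ← hB, ← Matrix.vecMul_vecMul]
      ext j
      simp [Matrix.vecMul, dotProduct]
    rw [h2]
    exact Submodule.sum_mem _ fun i _ => Submodule.smul_mem _ _ (Submodule.subset_span ⟨i, rfl⟩)
  have hcard : Fintype.card I = k := by
    have := Module.finrank_eq_card_basis (Module.Basis.mk hli hspan)
    rw [Module.finrank_fin_fun] at this
    exact this.symm
  let e := (Fintype.equivFinOfCardEq hcard).symm
  refine ⟨fun x => e x, Subtype.val_injective.comp e.injective,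
    ⟨e.symm ⟨i₀, hs.subset_extend _ rfl⟩, by simp⟩, ?_⟩
  have h3 : LinearIndependent ℝ (B.submatrix (fun x => (e x : Fin n)) id).row :=
    hli.comp e e.injective
  exact ((Matrix.isUnit_iff_isUnit_det _).mp
    (Matrix.linearIndependent_rows_iff_isUnit.mp h3)).ne_zero

lemma abs_det_submatrix_le {n k : ℕ} (hkn : k ≤ n) {A : Matrix (Fin n) (Fin n) ℝ}
    {Z : Matrix (Fin n) (Fin n) ℤ} (hZ : IsUnit Z.det)
    (hZ0 : ∀ i j : Fin n, k ≤ i → (j : ℕ) < k → Z i j = 0) (e : Fin k → Fin n) :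
    |(A.submatrix e (Fin.castLE hkn)).det| ≤
      |((A * Z.map (Int.castRingHom ℝ)).submatrix e (Fin.castLE hkn)).det| := by
  set Z₁ := Z.submatrix (Fin.castLE hkn) (Fin.castLE hkn) with hZ₁
  have hmul : (A * Z.map (Int.castRingHom ℝ)).submatrix e (Fin.castLE hkn) =
      A.submatrix e (Fin.castLE hkn) * Z₁.map (Int.castRingHom ℝ) := by
    ext i j
    rw [Matrix.submatrix_apply, Matrix.mul_apply, Matrix.mul_apply]
    refine (Finset.sum_of_injOn (Fin.castLE hkn) (Fin.castLE_injective hkn).injOn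
      (fun _ _ => by simp) (fun l _ hl => ?_) fun l _ => rfl).symm
    have hlk : k ≤ l := by
      by_contra! h
      exact hl ⟨⟨l, h⟩, by simp, rfl⟩
    rw [Matrix.map_apply, hZ0 l _ hlk (by simp), map_zero, mul_zero]
  have hdet : Z₁.det ≠ 0 := by
    have h1 := Matrix.twoBlockTriangular_det Z (fun i => (i : ℕ) < k)
      fun i hi j hj => hZ0 i j (not_lt.mp hi) hj
    have h2 : Z₁.det = (Matrix.toSquareBlockProp Z fun i => (i : ℕ) < k).det := by
      rw [← Matrix.det_submatrix_equiv_self (Fin.castLEOrderIso hkn).toEquiv]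
      rfl
    rw [h2]
    intro h
    rw [h, zero_mul] at h1
    rw [h1] at hZ
    exact not_isUnit_zero hZ
  have h1 : (1 : ℝ) ≤ |(Z₁.det : ℝ)| := by exact_mod_cast Int.one_le_abs hdet
  have h2 : (Z₁.map (Int.castRingHom ℝ)).det = Z₁.det := by
    rw [← RingHom.mapMatrix_apply, ← RingHom.map_det]
    rfl
  rw [hmul, Matrix.det_mul, abs_mul, h2]
  exact le_mul_of_one_le_right (abs_nonneg _) h1

/-- A parametric subspace theorem with a conclusion of nonexistence. -/
theorem false_of_small_values {d : ℕ} {M : Matrix (Fin (d + 1)) (Fin (d + 1)) ℝ} (hM : M.det ≠ 0)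
    (halg : ∀ i j, IsAlgebraic ℚ (M i j))
    (hrow : ∀ x : Fin (d + 1) → ℤ, x ≠ 0 → M.mulVec (fun i => (x i : ℝ)) 0 ≠ 0)
    {c : Fin (d + 1) → ℝ} (hc : ∑ i, c i = 0) (hc0 : ∀ i, i ≠ 0 → 0 ≤ c i) {δ : ℝ} (hδ : 0 < δ)
    {L : ℕ → ℝ} (hL : Tendsto L atTop atTop) {x : ℕ → Fin (d + 1) → ℤ} (hx0 : ∀ k, x k ≠ 0)
    (hx : ∀ k s, |M.mulVec (fun i => (x k i : ℝ)) s| ≤ exp (L k * (c s - δ))) : False := by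
  obtain ⟨τ, b, hb, hbsum, hb0, hU⟩ := exists_limit_exponents hM hc hδ hL hx0 hx
  obtain ⟨k, hk0, hkd, η, hη, hlow, hhigh⟩ := exists_gap hb hbsum hb0
  have hMτ : (M.submatrix τ id).det ≠ 0 := by
    rw [Matrix.det_permute]
    refine mul_ne_zero ?_ hM
    rcases Int.units_eq_one_or (Equiv.Perm.sign τ) with h | h <;> simp [h]
  obtain ⟨κ₀, hκ₀, hblock⟩ := exists_eventually_inv_mul_apply_eq_zero hkd hMτ
    (fun i j => halg _ _) (γ := fun i => c (τ i) + b i)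
    (by rw [Finset.sum_add_distrib, Equiv.sum_comp τ, hc, hbsum, add_zero]) hη
  obtain ⟨κ, hκ, hκκ₀, hκb⟩ : ∃ κ > 0, κ ≤ κ₀ ∧ κ ≤ -b 0 / 2 :=
    ⟨min κ₀ (-b 0 / 2), lt_min hκ₀ (by linarith), min_le_left _ _, min_le_right _ _⟩
  obtain ⟨φ, hφ, hφU⟩ := extraction_of_frequently_atTop
    ((hU κ hκ).and_eventually (hL.eventually_ge_atTop 0))
  choose U hUdet hUle using fun m => (hφU m).1
  have hφ0 : ∀ m, 0 ≤ L (φ m) := fun m => (hφU m).2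
  have hLφ : Tendsto (fun m => L (φ m)) atTop atTop := hL.comp hφ.tendsto_atTop
  have hsub : ∀ m i j, (M.submatrix τ id * (U m).map (Int.castRingHom ℝ)) i j =
      (M * (U m).map (Int.castRingHom ℝ)) (τ i) j := fun m i j => by
    rw [Matrix.mul_apply, Matrix.mul_apply]
    rfl
  obtain ⟨m₀, hm₀⟩ := hblock κ hκκ₀ _ hLφ U hUdet (fun m i j => by
      rw [hsub]
      refine (hUle m i j).trans (exp_le_exp.mpr (mul_le_mul_of_nonneg_left ?_ (hφ0 m)))
      linarith [hb (min_le_left i j)])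
    (fun m i j hi hj => by
      rw [hsub]
      refine (hUle m i j).trans (exp_le_exp.mpr (mul_le_mul_of_nonneg_left ?_ (hφ0 m)))
      linarith [hb (min_le_right i j), hlow j hj, hhigh i hi])
  have hinv : (U m₀)⁻¹ * U m₀ = 1 := Matrix.nonsing_inv_mul _ (hUdet m₀)
  set A := M * (U m₀).map (Int.castRingHom ℝ) with hA
  have hAdet : IsUnit A.det := by
    have h1 : ((U m₀).map (Int.castRingHom ℝ)).det = (U m₀).det := by
      rw [← RingHom.mapMatrix_apply, ← RingHom.map_det]
      rfl
    rw [hA, Matrix.det_mul, h1]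
    refine IsUnit.mk0 _ (mul_ne_zero hM ?_)
    exact_mod_cast (hUdet m₀).ne_zero
  have hcol : (fun i => U m₀ i 0) ≠ 0 := by
    intro h
    exact (hUdet m₀).ne_zero (Matrix.det_eq_zero_of_column_eq_zero 0 fun i => congrFun h i)
  have hA0 : A 0 0 ≠ 0 := by
    have h1 : A 0 0 = M.mulVec (fun i => ((U m₀ i 0 : ℤ) : ℝ)) 0 := by
      rw [hA, Matrix.mul_apply]
      rfl
    rw [h1]
    exact hrow _ hcol
  obtain ⟨e, he, he0, hedet⟩ := exists_det_submatrix_ne_zero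
    (B := A.submatrix id (Fin.castLE hkd.le)) (B' := A⁻¹.submatrix (Fin.castLE hkd.le) id)
    (by rw [← Matrix.submatrix_mul _ _ _ _ _ Function.bijective_id, Matrix.nonsing_inv_mul _ hAdet,
          Matrix.submatrix_one _ (Fin.castLE_injective _)])
    (i₀ := 0) (fun h => hA0 (congrFun h ⟨0, hk0⟩))
  rw [Matrix.submatrix_submatrix] at hedet
  have hce : ∑ i, c (e i) ≤ 0 := by
    classical
    obtain ⟨i₁, hi₁⟩ := he0
    have h1 : ∑ i, c (e i) = ∑ i ∈ Finset.univ.image e, c i :=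
      (Finset.sum_image he.injOn).symm
    have h2 : ∑ i ∈ Finset.univ.image e, c i + ∑ i ∈ (Finset.univ.image e)ᶜ, c i = 0 := by
      rw [Finset.sum_add_sum_compl, hc]
    have h3 : 0 ≤ ∑ i ∈ (Finset.univ.image e)ᶜ, c i := by
      refine Finset.sum_nonneg fun i hi => hc0 i fun h => ?_
      rw [Finset.mem_compl] at hi
      exact hi (Finset.mem_image.mpr ⟨i₁, Finset.mem_univ _, by rw [hi₁, h]⟩)
    linarith
  have hbound : ∀ m, |((M * (U m).map (Int.castRingHom ℝ)).submatrix e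
      (Fin.castLE hkd.le)).det| ≤ k.factorial * exp (L (φ m) * (b 0 / 2)) := by
    intro m
    refine abs_det_le_factorial_mul fun σ => ?_
    calc _ ≤ ∏ i, exp (L (φ m) * (c (e (σ i)) + b 0 / 2)) := by
          refine Finset.prod_le_prod (fun _ _ => abs_nonneg _) fun i _ => ?_
          have h1 := hUle m (τ.symm (e (σ i))) (Fin.castLE hkd.le i)
          rw [Equiv.apply_symm_apply] at h1
          refine h1.trans (exp_le_exp.mpr (mul_le_mul_of_nonneg_left ?_ (hφ0 m)))
          linarith [hb (min_le_right (τ.symm (e (σ i))) (Fin.castLE hkd.le i)),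
            hlow (Fin.castLE hkd.le i) (by simp)]
      _ ≤ _ := by
          rw [← exp_sum, ← Finset.mul_sum, Finset.sum_add_distrib,
            Equiv.sum_comp σ (fun i => c (e i)), Finset.sum_const, Finset.card_univ,
            Fintype.card_fin, nsmul_eq_mul]
          refine exp_le_exp.mpr (mul_le_mul_of_nonneg_left ?_ (hφ0 m))
          have h1 : (1 : ℝ) ≤ k := by exact_mod_cast hk0
          nlinarith
  have hlim : Tendsto (fun m => (k.factorial : ℝ) * exp (L (φ m) * (b 0 / 2))) atTop (𝓝 0) := by
    rw [← mul_zero (k.factorial : ℝ)]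
    refine (tendsto_exp_atBot.comp ?_).const_mul _
    exact hLφ.atTop_mul_const_of_neg (by linarith)
  refine (abs_pos.mpr hedet).not_ge (ge_of_tendsto hlim (hm₀.mono fun m hm => ?_))
  have hUm : U m₀ * ((U m₀)⁻¹ * U m) = U m := by
    rw [← mul_assoc, Matrix.mul_nonsing_inv _ (hUdet m₀), one_mul]
  have hZ : IsUnit ((U m₀)⁻¹ * U m).det := by
    rw [Matrix.det_mul]
    exact (Matrix.isUnit_nonsing_inv_det _ (hUdet m₀)).mul (hUdet m)
  refine (abs_det_submatrix_le hkd.le hZ hm e).trans ((le_of_eq ?_).trans (hbound m))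
  rw [hA, mul_assoc, ← Matrix.map_mul, hUm]

end SmallValues

section LinearForm

open Filter Topology

lemma one_le_prod_max {d : ℕ} (h : Fin d → ℤ) : 1 ≤ ∏ i, max 1 |(h i : ℝ)| :=
  Finset.one_le_prod fun _ _ => le_max_left _ _

lemma abs_le_prod_max {d : ℕ} (h : Fin d → ℤ) (i : Fin d) :
    |(h i : ℝ)| ≤ ∏ i, max 1 |(h i : ℝ)| := by
  rw [← Finset.mul_prod_erase _ _ (Finset.mem_univ i)]
  have h1 : 1 ≤ ∏ j ∈ Finset.univ.erase i, max 1 |(h j : ℝ)| :=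
    Finset.one_le_prod fun _ _ => le_max_left _ _
  exact (le_max_right _ _).trans (le_mul_of_one_le_right (by positivity) h1)

/-- A weak lower bound for values of a linear form with algebraic coefficients. -/
lemma exists_le_abs_linear_form_pow {d : ℕ} {α : Fin d → ℝ} (halg : ∀ i, IsAlgebraic ℚ (α i)) :
    ∃ c > 0, ∃ D : ℕ, ∀ (h : Fin d → ℤ) (h₀ : ℤ), (h₀ + ∑ i, h i * α i : ℝ) ≠ 0 →
      |(h₀ + ∑ i, h i * α i : ℝ)| ≤ 1 →
      c ≤ |(h₀ + ∑ i, h i * α i : ℝ)| * (∏ i, max 1 |(h i : ℝ)|) ^ D := by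
  obtain ⟨g, hg0, hg⟩ := exists_int_smul_isIntegral (Fin.cons 1 α : Fin (d + 1) → ℝ) (fun i => by
    refine Fin.cases ?_ (fun i => ?_) i
    · exact isAlgebraic_one
    · exact halg i)
  obtain ⟨c, hc, D, hcD⟩ := exists_le_abs_sum_mul_pow _ hg
  have hg' : 0 < |(g : ℝ)| := abs_pos.mpr (by exact_mod_cast hg0)
  set S : ℝ := 1 + ∑ i, |α i| with hS
  have hS1 : 1 ≤ S := by
    have : 0 ≤ ∑ i, |α i| := Finset.sum_nonneg fun _ _ => abs_nonneg _
    linarith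
  refine ⟨c / (|(g : ℝ)| * S ^ D), by positivity, D, fun h h₀ hne hle => ?_⟩
  have hP := one_le_prod_max h
  set P := ∏ i, max 1 |(h i : ℝ)| with hPdef
  have hform : ∑ i, ((Fin.cons h₀ h : Fin (d + 1) → ℤ) i : ℝ) *
      ((g : ℝ) * (Fin.cons 1 α : Fin (d + 1) → ℝ) i) = g * (h₀ + ∑ i, h i * α i) := by
    rw [Fin.sum_univ_succ, mul_add, Finset.mul_sum]
    simp only [Fin.cons_zero, Fin.cons_succ]
    congr 1
    · ring
    · exact Finset.sum_congr rfl fun i _ => by ring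
  have hsum : |∑ i, h i * α i| ≤ (∑ i, |α i|) * P := by
    refine (Finset.abs_sum_le_sum_abs _ _).trans ?_
    rw [Finset.sum_mul]
    refine Finset.sum_le_sum fun i _ => ?_
    rw [abs_mul, mul_comm]
    exact mul_le_mul_of_nonneg_left (abs_le_prod_max h i) (abs_nonneg _)
  have hB : ∀ i, |((Fin.cons h₀ h : Fin (d + 1) → ℤ) i : ℝ)| ≤ S * P := by
    intro i
    refine Fin.cases ?_ (fun i => ?_) i
    · rw [Fin.cons_zero]
      have h1 : |(h₀ : ℝ)| ≤ |(h₀ + ∑ i, h i * α i : ℝ)| + |∑ i, h i * α i| := by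
        have := abs_sub (h₀ + ∑ i, h i * α i : ℝ) (∑ i, h i * α i)
        rwa [add_sub_cancel_right] at this
      rw [hS]
      linarith
    · rw [Fin.cons_succ]
      exact (abs_le_prod_max h i).trans (le_mul_of_one_le_left (by linarith) hS1)
  have := hcD _ (S * P) (one_le_mul_of_one_le_of_one_le hS1 hP) hB
    (by rw [hform]; exact mul_ne_zero (by exact_mod_cast hg0) hne)
  rw [hform, abs_mul, mul_pow] at this
  rw [div_le_iff₀ (by positivity)]
  linarith

/-- The matrix of the linear forms `x 0 + ∑ i, α i * x (i + 1)` and `x i`, `1 ≤ i`. -/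
def linearFormMatrix {d : ℕ} (α : Fin d → ℝ) : Matrix (Fin (d + 1)) (Fin (d + 1)) ℝ :=
  Matrix.updateRow 1 0 (Fin.cons 1 α)

lemma linearFormMatrix_mulVec_zero {d : ℕ} (α : Fin d → ℝ) (h₀ : ℤ) (h : Fin d → ℤ) :
    (linearFormMatrix α).mulVec (fun i => ((Fin.cons h₀ h : Fin (d + 1) → ℤ) i : ℝ)) 0 =
      h₀ + ∑ i, h i * α i := by
  rw [Matrix.mulVec, dotProduct, Fin.sum_univ_succ]
  simp [linearFormMatrix, mul_comm]

lemma linearFormMatrix_mulVec_succ {d : ℕ} (α : Fin d → ℝ) (h₀ : ℤ) (h : Fin d → ℤ) (i : Fin d) :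
    (linearFormMatrix α).mulVec (fun i => ((Fin.cons h₀ h : Fin (d + 1) → ℤ) i : ℝ)) i.succ =
      h i := by
  have h1 : ∀ j, linearFormMatrix α i.succ j =
      (1 : Matrix (Fin (d + 1)) (Fin (d + 1)) ℝ) i.succ j :=
    fun j => by rw [linearFormMatrix, Matrix.updateRow_ne (Fin.succ_ne_zero i)]
  rw [Matrix.mulVec, dotProduct]
  simp only [h1]
  rw [← dotProduct, ← Matrix.mulVec, Matrix.one_mulVec, Fin.cons_succ]

lemma det_linearFormMatrix {d : ℕ} (α : Fin d → ℝ) : (linearFormMatrix α).det = 1 := by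
  rw [Matrix.det_of_isUpperTriangular]
  · rw [Fin.prod_univ_succ]
    simp [linearFormMatrix]
  · intro i j hij
    have hji : j < i := hij
    have hi : i ≠ 0 := by
      rintro rfl
      exact absurd hji (Fin.not_lt_zero _)
    rw [linearFormMatrix, Matrix.updateRow_ne hi, Matrix.one_apply_ne hji.ne']

lemma linear_form_ne_zero {d : ℕ} {α : Fin d → ℝ}
    (hli : LinearIndependent ℚ (Fin.cons 1 α : Fin (d + 1) → ℝ)) {h₀ : ℤ} {h : Fin d → ℤ}
    (hne : (Fin.cons h₀ h : Fin (d + 1) → ℤ) ≠ 0) : (h₀ + ∑ i, h i * α i : ℝ) ≠ 0 := by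
  intro h0
  refine hne (funext fun i => ?_)
  have := Fintype.linearIndependent_iff.mp hli
    (fun i => ((Fin.cons h₀ h : Fin (d + 1) → ℤ) i : ℚ)) (by
      rw [Fin.sum_univ_succ]
      simpa [Rat.smul_def] using h0) i
  exact_mod_cast this

lemma isAlgebraic_linearFormMatrix {d : ℕ} {α : Fin d → ℝ} (halg : ∀ i, IsAlgebraic ℚ (α i))
    (i j : Fin (d + 1)) : IsAlgebraic ℚ (linearFormMatrix α i j) := by
  rw [linearFormMatrix, Matrix.updateRow_apply]
  split_ifs
  · refine Fin.cases ?_ (fun j => ?_) j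
    · exact isAlgebraic_one
    · exact halg j
  · rw [Matrix.one_apply]
    split_ifs
    · exact isAlgebraic_one
    · exact isAlgebraic_zero

/-- **Schmidt's theorem** on linear forms with algebraic coefficients. -/
theorem exists_le_abs_linear_form {d : ℕ} {α : Fin d → ℝ} (halg : ∀ i, IsAlgebraic ℚ (α i))
    (hli : LinearIndependent ℚ (Fin.cons 1 α : Fin (d + 1) → ℝ)) {ε : ℝ} (hε : 0 < ε) :
    ∃ c > 0, ∀ (h : Fin d → ℤ), h ≠ 0 → ∀ h₀ : ℤ,
      c ≤ |(h₀ + ∑ i, h i * α i : ℝ)| * (∏ i, max 1 |(h i : ℝ)|) ^ (1 + ε) := by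
  by_contra! hcon
  choose h hh h₀ hsmall using fun k : ℕ => hcon (1 / ((k : ℝ) + 1)) (by positivity)
  have hcons : ∀ k, (Fin.cons (h₀ k) (h k) : Fin (d + 1) → ℤ) ≠ 0 := fun k h0 =>
    hh k (funext fun i => congrFun h0 i.succ)
  have hne : ∀ k, (h₀ k + ∑ i, h k i * α i : ℝ) ≠ 0 := fun k => linear_form_ne_zero hli (hcons k)
  have hP : ∀ k, 1 ≤ ∏ i, max 1 |(h k i : ℝ)| := fun k => one_le_prod_max (h k)
  obtain ⟨L, hLdef⟩ : ∃ L : ℕ → ℝ, ∀ k, L k = log (∏ i, max 1 |(h k i : ℝ)|) := ⟨_, fun _ => rfl⟩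
  have hL0 : ∀ k, 0 ≤ L k := fun k => by
    rw [hLdef]
    exact log_nonneg (hP k)
  have hPexp : ∀ k, ∏ i, max 1 |(h k i : ℝ)| = exp (L k) := fun k => by
    rw [hLdef, exp_log (by linarith [hP k])]
  have hform : ∀ k, |(h₀ k + ∑ i, h k i * α i : ℝ)| ≤ exp (L k * (-1 - ε)) / (k + 1) := by
    intro k
    have h1 := (hsmall k).le
    rw [hPexp, ← exp_mul] at h1
    rw [le_div_iff₀ (by positivity)]
    rw [le_div_iff₀ (by positivity)] at h1
    calc _ = |(h₀ k + ∑ i, h k i * α i : ℝ)| * exp (L k * (1 + ε)) * (k + 1) *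
          exp (L k * (-1 - ε)) := by
            have : exp (L k * (1 + ε)) * exp (L k * (-1 - ε)) = 1 := by
              rw [← exp_add, ← mul_add]
              simp
            linear_combination (-|(h₀ k + ∑ i, h k i * α i : ℝ)| * (k + 1)) * this
      _ ≤ 1 * exp (L k * (-1 - ε)) := by gcongr
      _ = _ := one_mul _
  have hexp1 : ∀ k, exp (L k * (-1 - ε)) ≤ 1 := fun k =>
    exp_le_one_iff.mpr (mul_nonpos_of_nonneg_of_nonpos (hL0 k) (by linarith))
  have hform1 : ∀ k, |(h₀ k + ∑ i, h k i * α i : ℝ)| ≤ exp (L k * (-1 - ε)) := fun k =>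
    (hform k).trans (div_le_self (exp_nonneg _) (by linarith [Nat.cast_nonneg (α := ℝ) k]))
  have hL : Tendsto L atTop atTop := by
    obtain ⟨c, hc, D, hD⟩ := exists_le_abs_linear_form_pow halg
    have h1 : ∀ k : ℕ, log (c * (k + 1)) / (D + 1) ≤ L k := by
      intro k
      have h2 := hD (h k) (h₀ k) (hne k) ((hform1 k).trans (hexp1 k))
      have h3 : c * (k + 1) ≤ exp (L k * D) := by
        rw [← le_div_iff₀ (by positivity)]
        refine h2.trans ?_
        rw [hPexp, ← exp_nat_mul, mul_comm (D : ℝ), ← one_div_mul_eq_div]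
        exact mul_le_mul_of_nonneg_right ((hform k).trans
          ((div_le_div_iff_of_pos_right (by positivity)).mpr (hexp1 k))) (exp_nonneg _)
      have h4 := (log_le_iff_le_exp (by positivity)).mpr h3
      rw [div_le_iff₀ (by positivity)]
      linarith [hL0 k]
    refine tendsto_atTop_mono h1 (Tendsto.atTop_div_const (by positivity) ?_)
    refine tendsto_log_atTop.comp (Tendsto.const_mul_atTop hc ?_)
    exact tendsto_atTop_add_const_right _ _ tendsto_natCast_atTop_atTop
  set w : ℕ → Fin d → ℝ := fun k i => log (max 1 |(h k i : ℝ)|) / L k with hw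
  have hw0 : ∀ k i, 0 ≤ w k i := fun k i => div_nonneg (log_nonneg (le_max_left _ _)) (hL0 k)
  have hsumlog : ∀ k, ∑ i, log (max 1 |(h k i : ℝ)|) = L k := by
    intro k
    rw [hLdef, log_prod fun i _ => by positivity]
  have hw1 : ∀ k, 0 < L k → ∑ i, w k i = 1 := by
    intro k hk
    rw [← Finset.sum_div, hsumlog, div_self hk.ne']
  have hwle : ∀ k i, w k i ≤ 1 := by
    intro k i
    refine div_le_one_of_le₀ ?_ (hL0 k)
    rw [← hsumlog k]
    exact Finset.single_le_sum (f := fun i => log (max 1 |(h k i : ℝ)|))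
      (fun i _ => log_nonneg (le_max_left _ _)) (Finset.mem_univ i)
  obtain ⟨a, ha, φ, hφ, hφa⟩ :=
    (isCompact_univ_pi fun _ : Fin d => isCompact_Icc (a := (0 : ℝ)) (b := 1)).tendsto_subseq
      (x := w) fun k i _ => ⟨hw0 k i, hwle k i⟩
  have hai : ∀ i, Tendsto (fun k => w (φ k) i) atTop (𝓝 (a i)) := tendsto_pi_nhds.mp hφa
  have hLφ : Tendsto (fun k => L (φ k)) atTop atTop := hL.comp hφ.tendsto_atTop
  have hasum : ∑ i, a i = 1 := by
    refine tendsto_nhds_unique (tendsto_finsetSum _ fun i _ => hai i)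
      (tendsto_const_nhds.congr' ?_)
    exact (hLφ.eventually_gt_atTop 0).mono fun k hk => (hw1 _ hk).symm
  obtain ⟨κ, hκ, hκd⟩ : ∃ κ > 0, (d + 1) * κ = ε := ⟨ε / (d + 1), by positivity, by field_simp⟩
  obtain ⟨k₀, hk₀⟩ := eventually_atTop.mp ((eventually_all.mpr fun i =>
    (hai i).eventually_lt_const (show a i < a i + κ / 2 by linarith)).and
    (hLφ.eventually_gt_atTop 0))
  refine false_of_small_values (M := linearFormMatrix α) (by rw [det_linearFormMatrix]; norm_num)
    (isAlgebraic_linearFormMatrix halg) (fun x hx => ?_)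
    (c := Fin.cons (-1 - ε + κ) fun i => a i + κ) ?_ (fun i => ?_) (δ := κ / 2) (by linarith)
    (hLφ.comp (tendsto_add_atTop_nat k₀))
    (x := fun k => Fin.cons (h₀ (φ (k + k₀))) (h (φ (k + k₀)))) (fun k => hcons _) fun k s => ?_
  · rw [← Fin.cons_self_tail x] at hx ⊢
    rw [linearFormMatrix_mulVec_zero]
    exact linear_form_ne_zero hli hx
  · rw [Fin.sum_univ_succ]
    simp only [Fin.cons_zero, Fin.cons_succ]
    rw [Finset.sum_add_distrib, hasum, Finset.sum_const, Finset.card_univ, Fintype.card_fin,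
      nsmul_eq_mul]
    linarith
  · refine Fin.cases (fun h0 => absurd rfl h0) (fun i _ => ?_) i
    have := (ha i (Set.mem_univ i)).1
    rw [Fin.cons_succ]
    linarith
  · obtain ⟨hk1, hk2⟩ := hk₀ (k + k₀) (Nat.le_add_left _ _)
    refine Fin.cases ?_ (fun i => ?_) s
    · rw [linearFormMatrix_mulVec_zero, Fin.cons_zero]
      refine (hform1 _).trans (exp_le_exp.mpr (mul_le_mul_of_nonneg_left ?_ hk2.le))
      linarith
    · rw [linearFormMatrix_mulVec_succ, Fin.cons_succ]
      have h1 : |(h (φ (k + k₀)) i : ℝ)| ≤ exp (L (φ (k + k₀)) * w (φ (k + k₀)) i) := by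
        rw [hw, mul_div_cancel₀ _ hk2.ne', exp_log (by positivity)]
        exact le_max_right _ _
      refine h1.trans (exp_le_exp.mpr (mul_le_mul_of_nonneg_left ?_ hk2.le))
      have := hk1 i
      linarith

end LinearForm

section KroneckerSum

lemma exists_sum_one_div_abs_le {τ : ℝ} (hτ : 0 < τ) :
    ∃ K > 0, ∀ {ι : Type} (S : Finset ι) (x : ι → ℝ) {s : ℝ}, 0 < s →
      (∀ i ∈ S, s ≤ |x i| ∧ |x i| ≤ 1) → (∀ i ∈ S, ∀ j ∈ S, i ≠ j → s ≤ |x i - x j|) →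
      ∑ i ∈ S, 1 / |x i| ≤ K * s ^ (-(1 + τ)) := by
  have hsum : Summable fun j : ℤ => |(j : ℝ)| ^ (-(1 + τ)) :=
    summable_abs_int_rpow (by linarith)
  have hnn : ∀ j : ℤ, 0 ≤ |(j : ℝ)| ^ (-(1 + τ)) := fun j => by positivity
  refine ⟨∑' j : ℤ, |(j : ℝ)| ^ (-(1 + τ)) + 1, ?_, ?_⟩
  · have : 0 ≤ ∑' j : ℤ, |(j : ℝ)| ^ (-(1 + τ)) := tsum_nonneg hnn
    linarith
  intro ι S x s hs hx hxx
  obtain ⟨f, hf⟩ : ∃ f : ι → ℤ, ∀ i, f i = if 0 ≤ x i then ⌊x i / s⌋ else -⌊-x i / s⌋ :=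
    ⟨_, fun _ => rfl⟩
  have hpos : ∀ i ∈ S, 0 ≤ x i → 1 ≤ ⌊x i / s⌋ := by
    intro i hi h0
    have := (hx i hi).1
    rw [abs_of_nonneg h0] at this
    rw [Int.le_floor, Int.cast_one, one_le_div hs]
    exact this
  have hneg : ∀ i ∈ S, ¬ 0 ≤ x i → 1 ≤ ⌊-x i / s⌋ := by
    intro i hi h0
    have := (hx i hi).1
    rw [abs_of_neg (not_le.mp h0)] at this
    rw [Int.le_floor, Int.cast_one, one_le_div hs]
    exact this
  have hinj : Set.InjOn f S := by
    intro i hi j hj hij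
    by_contra hne
    have hsep := hxx i hi j hj hne
    rw [hf, hf] at hij
    split_ifs at hij with h1 h2 h2
    · have := Int.abs_sub_lt_one_of_floor_eq_floor hij
      rw [← sub_div, abs_div, abs_of_pos hs, div_lt_one hs] at this
      linarith
    · have := hpos i hi h1
      have := hneg j hj h2
      omega
    · have := hneg i hi h1
      have := hpos j hj h2
      omega
    · have := Int.abs_sub_lt_one_of_floor_eq_floor (neg_inj.mp hij)
      rw [← sub_div, abs_div, abs_of_pos hs, div_lt_one hs,
        show -x i - -x j = -(x i - x j) by ring, abs_neg] at this
      linarith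
  have hterm : ∀ i ∈ S, 1 / |x i| ≤ s ^ (-(1 + τ)) * |(f i : ℝ)| ^ (-(1 + τ)) := by
    intro i hi
    have hxi : 0 < |x i| := hs.trans_le (hx i hi).1
    have h1 : |(f i : ℝ)| ≤ |x i| / s ∧ 1 ≤ |(f i : ℝ)| := by
      rw [hf]
      split_ifs with h0
      · have h2 : (1 : ℝ) ≤ (⌊x i / s⌋ : ℝ) := by exact_mod_cast hpos i hi h0
        rw [abs_of_nonneg (by linarith), abs_of_nonneg h0]
        exact ⟨Int.floor_le _, h2⟩
      · have h2 : (1 : ℝ) ≤ (⌊-x i / s⌋ : ℝ) := by exact_mod_cast hneg i hi h0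
        rw [Int.cast_neg, abs_neg, abs_of_nonneg (by linarith), abs_of_neg (not_le.mp h0)]
        exact ⟨Int.floor_le _, h2⟩
    rw [← mul_rpow hs.le (abs_nonneg _)]
    calc 1 / |x i| = |x i| ^ (-1 : ℝ) := by rw [rpow_neg_one, one_div]
      _ ≤ |x i| ^ (-(1 + τ)) :=
        rpow_le_rpow_of_exponent_ge hxi (hx i hi).2 (by linarith)
      _ ≤ _ := by
        refine rpow_le_rpow_of_nonpos (mul_pos hs (by linarith [h1.2])) ?_ (by linarith)
        rw [← le_div_iff₀' hs]
        exact h1.1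
  refine (Finset.sum_le_sum hterm).trans ?_
  rw [← Finset.mul_sum, mul_comm]
  refine mul_le_mul_of_nonneg_right ?_ (by positivity)
  rw [← Finset.sum_image (f := fun j : ℤ => |(j : ℝ)| ^ (-(1 + τ))) hinj]
  linarith [hsum.sum_le_tsum (S.image f) fun j _ => hnn j]

lemma max_one_natAbs_log {z : ℤ} {k : ℕ} (hz : Nat.log 2 z.natAbs = k) :
    (2 : ℝ) ^ k ≤ max 1 |(z : ℝ)| ∧ |(z : ℝ)| ≤ 2 * 2 ^ k := by
  subst hz
  have habs : |(z : ℝ)| = (z.natAbs : ℝ) := by rw [Nat.cast_natAbs, Int.cast_abs]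
  rw [habs]
  constructor
  · rcases eq_or_ne z.natAbs 0 with h0 | h0
    · simp [h0]
    · refine le_trans ?_ (le_max_right _ _)
      exact_mod_cast Nat.pow_log_le_self 2 h0
  · have := (Nat.lt_pow_succ_log_self one_lt_two z.natAbs).le
    rw [pow_succ'] at this
    exact_mod_cast this

/-- The signed distance from `∑ i, h i * α i` to the nearest integer. -/
noncomputable def linearFormMod {d : ℕ} (α : Fin d → ℝ) (h : Fin d → ℤ) : ℝ :=
  ∑ i, h i * α i - round (∑ i, h i * α i)

lemma exists_sum_block_le {d : ℕ} {α : Fin d → ℝ} (halg : ∀ i, IsAlgebraic ℚ (α i))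
    (hli : LinearIndependent ℚ (Fin.cons 1 α : Fin (d + 1) → ℝ)) {τ : ℝ} (hτ : 0 < τ) :
    ∃ K > 0, ∀ (k : Fin d → ℕ) (S : Finset (Fin d → ℤ)),
      (∀ h ∈ S, h ≠ 0 ∧ ∀ i, Nat.log 2 (h i).natAbs = k i) →
      ∑ h ∈ S, 1 / |linearFormMod α h| ≤ K * (∏ i, (2 : ℝ) ^ k i) ^ ((1 + τ) * (1 + τ)) := by
  obtain ⟨c, hc, hcl⟩ := exists_le_abs_linear_form halg hli hτ
  obtain ⟨K, hK, hKS⟩ := exists_sum_one_div_abs_le hτ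
  refine ⟨K * (c / ((4 : ℝ) ^ d) ^ (1 + τ)) ^ (-(1 + τ)), by positivity, fun k S hS => ?_⟩
  obtain ⟨R, hR⟩ : ∃ R : ℝ, R = ∏ i, (2 : ℝ) ^ k i := ⟨_, rfl⟩
  have hR0 : 0 < R := by
    rw [hR]
    positivity
  have hlow : ∀ (g : Fin d → ℤ) (m : ℤ), g ≠ 0 → (∀ i, |(g i : ℝ)| ≤ 4 * 2 ^ k i) →
      c / ((4 : ℝ) ^ d) ^ (1 + τ) * R ^ (-(1 + τ)) ≤ |∑ i, g i * α i - m| := by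
    intro g m hg hgk
    have h1 := hcl g hg (-m)
    rw [Int.cast_neg, neg_add_eq_sub] at h1
    have h2 : ∏ i, max 1 |(g i : ℝ)| ≤ 4 ^ d * R := by
      calc ∏ i, max 1 |(g i : ℝ)| ≤ ∏ i, (4 * (2 : ℝ) ^ k i) := by
            refine Finset.prod_le_prod (fun _ _ => by positivity) fun i _ => max_le ?_ (hgk i)
            have : (1 : ℝ) ≤ 2 ^ k i := one_le_pow₀ one_le_two
            linarith
        _ = 4 ^ d * R := by
            rw [Finset.prod_mul_distrib, Finset.prod_const, Finset.card_univ, Fintype.card_fin, hR]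
    rw [rpow_neg hR0.le, ← div_eq_mul_inv, div_div, ← mul_rpow (by positivity) hR0.le,
      div_le_iff₀ (by positivity)]
    refine h1.trans (mul_le_mul_of_nonneg_left ?_ (abs_nonneg _))
    exact rpow_le_rpow (Finset.prod_nonneg fun _ _ => by positivity) h2 (by linarith)
  have hs : 0 < c / ((4 : ℝ) ^ d) ^ (1 + τ) * R ^ (-(1 + τ)) := by positivity
  refine (hKS S (linearFormMod α) hs (fun h hh => ⟨?_, ?_⟩) fun h hh g hg hne => ?_).trans
    (le_of_eq ?_)
  · refine hlow h _ (hS h hh).1 fun i => ?_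
    have := (max_one_natAbs_log ((hS h hh).2 i)).2
    have : (0 : ℝ) ≤ 2 ^ k i := by positivity
    linarith
  · exact (abs_sub_round _).trans (by norm_num)
  · have h1 : linearFormMod α h - linearFormMod α g = ∑ i, ((h - g) i : ℤ) * α i -
        ((round (∑ i, h i * α i) - round (∑ i, g i * α i) : ℤ) : ℝ) := by
      simp only [linearFormMod, Pi.sub_apply, Int.cast_sub, sub_mul, Finset.sum_sub_distrib]
      ring
    rw [h1]
    refine hlow _ _ (sub_ne_zero.mpr hne) fun i => ?_
    have h2 := (max_one_natAbs_log ((hS h hh).2 i)).2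
    have h3 := (max_one_natAbs_log ((hS g hg).2 i)).2
    rw [Pi.sub_apply, Int.cast_sub]
    linarith [abs_sub (h i : ℝ) (g i)]
  · rw [← hR, mul_rpow (by positivity) (by positivity), ← rpow_mul hR0.le, neg_mul_neg, mul_assoc]

/-- Weighted reciprocals of the distances to the nearest integer of the linear form have bounded
sums. -/
lemma exists_sum_weight_le {d : ℕ} {α : Fin d → ℝ} (halg : ∀ i, IsAlgebraic ℚ (α i))
    (hli : LinearIndependent ℚ (Fin.cons 1 α : Fin (d + 1) → ℝ)) {δ : ℝ} (hδ : 0 < δ)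
    (hδ1 : δ ≤ 1) :
    ∃ K > 0, ∀ S : Finset (Fin d → ℤ), (∀ h ∈ S, h ≠ 0) →
      ∑ h ∈ S, (∏ i, max 1 |(h i : ℝ)| ^ (-(1 + δ))) * (1 / |linearFormMod α h|) ≤ K := by
  obtain ⟨K, hK, hKS⟩ := exists_sum_block_le halg hli (τ := δ / 8) (by linarith)
  obtain ⟨r, hr⟩ : ∃ r : ℝ, r = 2 ^ (-(δ / 2)) := ⟨_, rfl⟩
  have hr0 : 0 < r := by rw [hr]; positivity
  have hr1 : r < 1 := by rw [hr]; exact rpow_lt_one_of_one_lt_of_neg one_lt_two (by linarith)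
  refine ⟨K * ((1 - r)⁻¹) ^ d, by have := sub_pos.mpr hr1; positivity, fun S hS => ?_⟩
  obtain ⟨key, hkey⟩ : ∃ key : (Fin d → ℤ) → Fin d → ℕ, ∀ h i,
      key h i = Nat.log 2 (h i).natAbs := ⟨_, fun _ _ => rfl⟩
  rw [← Finset.sum_fiberwise_of_maps_to (t := S.image key) (g := key)
    fun h hh => Finset.mem_image_of_mem key hh]
  have hblock : ∀ k ∈ S.image key, ∑ h ∈ S with key h = k,
      (∏ i, max 1 |(h i : ℝ)| ^ (-(1 + δ))) * (1 / |linearFormMod α h|) ≤ K * ∏ i, r ^ k i := by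
    intro k _
    have hmem : ∀ h ∈ S.filter (key · = k), h ≠ 0 ∧ ∀ i, Nat.log 2 (h i).natAbs = k i := by
      intro h hh
      rw [Finset.mem_filter] at hh
      exact ⟨hS h hh.1, fun i => by rw [← hkey, hh.2]⟩
    obtain ⟨R, hR⟩ : ∃ R : ℝ, R = ∏ i, (2 : ℝ) ^ k i := ⟨_, rfl⟩
    have hR1 : 1 ≤ R := by
      rw [hR]
      exact Finset.one_le_prod fun i _ => one_le_pow₀ one_le_two
    have hR0 : 0 < R := by linarith
    calc _ ≤ ∑ h ∈ S with key h = k, R ^ (-(1 + δ)) * (1 / |linearFormMod α h|) := by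
          refine Finset.sum_le_sum fun h hh => mul_le_mul_of_nonneg_right ?_ (by positivity)
          rw [hR, ← finsetProd_rpow _ _ fun _ _ => by positivity]
          refine Finset.prod_le_prod (fun _ _ => by positivity) fun i _ => ?_
          exact rpow_le_rpow_of_nonpos (by positivity)
            (max_one_natAbs_log ((hmem h hh).2 i)).1 (by linarith)
      _ ≤ R ^ (-(1 + δ)) * (K * R ^ ((1 + δ / 8) * (1 + δ / 8))) := by
          rw [← Finset.mul_sum, hR]
          exact mul_le_mul_of_nonneg_left (hKS k _ hmem) (by positivity)
      _ = K * R ^ (-(1 + δ) + (1 + δ / 8) * (1 + δ / 8)) := by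
          rw [rpow_add hR0]
          ring
      _ ≤ K * R ^ (-(δ / 2)) := by
          refine mul_le_mul_of_nonneg_left (rpow_le_rpow_of_exponent_le hR1 ?_) hK.le
          nlinarith
      _ = K * ∏ i, r ^ k i := by
          rw [hR, ← finsetProd_rpow _ _ fun _ _ => by positivity, hr]
          congr 1
          refine Finset.prod_congr rfl fun i _ => ?_
          rw [← rpow_natCast, ← rpow_natCast, ← rpow_mul two_pos.le, ← rpow_mul two_pos.le,
            mul_comm]
  refine (Finset.sum_le_sum hblock).trans ?_
  rw [← Finset.mul_sum]
  refine mul_le_mul_of_nonneg_left ?_ hK.le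
  obtain ⟨n, hn⟩ : ∃ n : ℕ, S.image key ⊆ Fintype.piFinset fun _ => Finset.range n := by
    refine ⟨(S.image key).sup (fun k => Finset.univ.sup k) + 1, fun k hk => ?_⟩
    rw [Fintype.mem_piFinset]
    intro i
    rw [Finset.mem_range, Nat.lt_succ_iff]
    exact (Finset.le_sup (f := k) (Finset.mem_univ i)).trans
      (Finset.le_sup (f := fun k : Fin d → ℕ => Finset.univ.sup k) hk)
  refine (Finset.sum_le_sum_of_subset_of_nonneg hn fun _ _ _ => by positivity).trans ?_
  rw [← Finset.prod_univ_sum (fun _ : Fin d => Finset.range n) fun _ j => r ^ j]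
  rw [Finset.prod_const, Finset.card_univ, Fintype.card_fin]
  refine pow_le_pow_left₀ (Finset.sum_nonneg fun _ _ => by positivity) ?_ d
  rw [← tsum_geometric_of_lt_one hr0.le hr1]
  exact (summable_geometric_of_lt_one hr0.le hr1).sum_le_tsum _ fun _ _ => by positivity

end KroneckerSum

section Trapezoid

open Filter Topology

/-- The primitive of the floor function vanishing at `0`. -/
noncomputable def floorPrimitive (y : ℝ) : ℝ := ⌊y⌋ * y - ⌊y⌋ * (⌊y⌋ + 1) / 2

lemma le_floorPrimitive (k : ℤ) (z : ℝ) : k * z - k * (k + 1) / 2 ≤ floorPrimitive z := by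
  have h1 := Int.floor_le z
  have h2 := Int.lt_floor_add_one z
  rw [floorPrimitive]
  generalize ⌊z⌋ = m at h1 h2
  rcases lt_trichotomy m k with h | rfl | h
  · have h3 : (m : ℝ) + 1 ≤ k := by exact_mod_cast h
    nlinarith
  · exact le_rfl
  · have h3 : (k : ℝ) + 1 ≤ m := by exact_mod_cast h
    nlinarith

lemma floorPrimitive_eq {k : ℤ} {z : ℝ} (h1 : k ≤ z) (h2 : z ≤ k + 1) :
    floorPrimitive z = k * z - k * (k + 1) / 2 := by
  rcases h2.lt_or_eq with h | rfl
  · rw [floorPrimitive, Int.floor_eq_iff.mpr ⟨h1, h⟩]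
  · rw [floorPrimitive, Int.floor_add_one, Int.floor_intCast]
    push_cast
    ring

lemma floorPrimitive_add_sub_le {y y' s : ℝ} (hs : 0 ≤ s) (h : y + s ≤ y') :
    floorPrimitive (y + s) - floorPrimitive y ≤ floorPrimitive (y' + s) - floorPrimitive y' := by
  have h1 := le_floorPrimitive ⌊y + s⌋ y
  have h2 : floorPrimitive (y + s) = _ :=
    floorPrimitive_eq (Int.floor_le (y + s)) (Int.lt_floor_add_one _).le
  have h3 := le_floorPrimitive ⌊y'⌋ (y' + s)
  have h4 : floorPrimitive y' = _ := floorPrimitive_eq (Int.floor_le y') (Int.lt_floor_add_one _).le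
  have h5 : (⌊y + s⌋ : ℝ) ≤ ⌊y'⌋ := by exact_mod_cast Int.floor_le_floor h
  nlinarith

lemma floorPrimitive_add_sub_mono {y y' s : ℝ} (hs : 0 ≤ s) (h : y ≤ y') :
    floorPrimitive (y + s) - floorPrimitive y ≤ floorPrimitive (y' + s) - floorPrimitive y' := by
  rcases le_total (y + s) y' with h1 | h1
  · exact floorPrimitive_add_sub_le hs h1
  · have := floorPrimitive_add_sub_le (sub_nonneg.mpr h) (show y + (y' - y) ≤ y + s by linarith)
    rw [show y + (y' - y) = y' by ring, show y + s + (y' - y) = y' + s by ring] at this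
    linarith

/-- The periodic trapezoid which is `1` on `[p, q]` and `0` off `[p - η, q + η]`. -/
noncomputable def trapezoid (p q η x : ℝ) : ℝ :=
  (floorPrimitive (x - p + η) - floorPrimitive (x - p) - floorPrimitive (x - q) +
    floorPrimitive (x - q - η)) / η

lemma trapezoid_nonneg {p q η : ℝ} (hη : 0 < η) (h : 0 ≤ q - p + η) (x : ℝ) :
    0 ≤ trapezoid p q η x := by
  have := floorPrimitive_add_sub_mono hη.le (show x - q - η ≤ x - p by linarith)
  rw [sub_add_cancel] at this
  exact div_nonneg (by linarith) hη.le

lemma one_le_trapezoid {p q η x : ℝ} (hη : 0 < η) (hp : 0 ≤ p) (hpx : p ≤ x) (hxq : x ≤ q)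
    (hq : q ≤ 1) : 1 ≤ trapezoid p q η x := by
  have h1 := floorPrimitive_eq (k := 0) (z := x - p) (by simpa using hpx) (by
    push_cast
    linarith)
  have h2 := floorPrimitive_eq (k := -1) (z := x - q) (by
    push_cast
    linarith) (by
    push_cast
    linarith)
  have h3 := le_floorPrimitive 0 (x - p + η)
  have h4 := le_floorPrimitive (-1) (x - q - η)
  rw [trapezoid, one_le_div hη]
  push_cast at h1 h2 h3 h4
  linarith

lemma trapezoid_le_ite {a b η x : ℝ} (hη : 0 < η) (ha : 0 ≤ a) (hab : a ≤ b) (hb : b ≤ 1)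
    (hx0 : 0 ≤ x) (hx1 : x < 1) :
    trapezoid (a + η) (b - η) η x ≤ if a ≤ x ∧ x < b then 1 else 0 := by
  rw [trapezoid, show x - (a + η) + η = x - a by ring, show x - (b - η) - η = x - b by ring,
    div_le_iff₀ hη]
  have hlow : ∀ k : ℤ, k ≤ x - a → x - a ≤ k + 1 → floorPrimitive (x - a) = _ :=
    fun k h h' => floorPrimitive_eq h h'
  have hupp : ∀ k : ℤ, k ≤ x - b → x - b ≤ k + 1 → floorPrimitive (x - b) = _ :=
    fun k h h' => floorPrimitive_eq h h'
  have h0 := hlow 0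
  have h1 := hlow (-1)
  have h2 := hupp 0
  have h3 := hupp (-1)
  have h4 := le_floorPrimitive 0 (x - (a + η))
  have h5 := le_floorPrimitive (-1) (x - (a + η))
  have h6 := le_floorPrimitive 0 (x - (b - η))
  have h7 := le_floorPrimitive (-1) (x - (b - η))
  push_cast at h0 h1 h2 h3 h4 h5 h6 h7
  rcases lt_or_ge x a with hxa | hxa
  · rw [if_neg fun h => absurd h.1 (not_le.mpr hxa), h1 (by linarith) (by linarith),
      h3 (by linarith) (by linarith)]
    linarith
  · rcases lt_or_ge x b with hxb | hxb
    · rw [if_pos ⟨hxa, hxb⟩, h0 (by linarith) (by linarith), h3 (by linarith) (by linarith)]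
      linarith
    · rw [if_neg fun h => absurd h.2 (not_lt.mpr hxb), h0 (by linarith) (by linarith),
        h2 (by linarith) (by linarith)]
      linarith

/-- The additive character `t ↦ exp (2πit)`. -/
noncomputable def expTwoPi (t : ℝ) : ℂ := Complex.exp (Complex.I * ((2 * π * t : ℝ) : ℂ))

lemma expTwoPi_add (s t : ℝ) : expTwoPi (s + t) = expTwoPi s * expTwoPi t := by
  rw [expTwoPi, expTwoPi, expTwoPi, ← Complex.exp_add]
  congr 1
  push_cast
  ring

lemma norm_expTwoPi (t : ℝ) : ‖expTwoPi t‖ = 1 := by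
  rw [expTwoPi, mul_comm, Complex.norm_exp_ofReal_mul_I]

lemma expTwoPi_zero : expTwoPi 0 = 1 := by simp [expTwoPi]

lemma expTwoPi_intCast (n : ℤ) : expTwoPi n = 1 := by
  rw [expTwoPi, Complex.exp_eq_one_iff]
  refine ⟨n, ?_⟩
  push_cast
  ring

lemma expTwoPi_nat_mul (n : ℕ) (t : ℝ) : expTwoPi (n * t) = expTwoPi t ^ n := by
  rw [expTwoPi, expTwoPi, ← Complex.exp_nat_mul]
  congr 1
  push_cast
  ring

lemma expTwoPi_sum {ι : Type*} (s : Finset ι) (f : ι → ℝ) :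
    expTwoPi (∑ i ∈ s, f i) = ∏ i ∈ s, expTwoPi (f i) := by
  simp only [expTwoPi]
  rw [← Complex.exp_sum, ← Finset.mul_sum, Finset.mul_sum]
  push_cast
  rfl

lemma expTwoPi_int_mul_fract (n : ℤ) (t : ℝ) : expTwoPi (n * Int.fract t) = expTwoPi (n * t) := by
  have h : (n : ℝ) * t = n * Int.fract t + ((n * ⌊t⌋ : ℤ) : ℝ) := by
    push_cast
    rw [← mul_add, Int.fract_add_floor]
  rw [h, expTwoPi_add, expTwoPi_intCast, mul_one]

lemma norm_expTwoPi_sub_one (t : ℝ) : ‖expTwoPi t - 1‖ = 2 * |sin (π * t)| := by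
  rw [expTwoPi, Complex.norm_exp_I_mul_ofReal_sub_one, norm_mul, norm_eq_abs, norm_eq_abs,
    abs_two]
  congr 3
  ring

lemma norm_expTwoPi_sub_one_le (t : ℝ) : ‖expTwoPi t - 1‖ ≤ 2 * min 1 (π * |t|) := by
  rw [norm_expTwoPi_sub_one]
  refine mul_le_mul_of_nonneg_left (le_min (abs_sin_le_one _) ?_) two_pos.le
  refine abs_sin_le_abs.trans ?_
  rw [abs_mul, abs_of_pos pi_pos]

lemma norm_sum_expTwoPi_le {θ : ℝ} (hθ : θ - round θ ≠ 0) (N : ℕ) :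
    ‖∑ n ∈ Finset.range N, expTwoPi (n * θ)‖ ≤ 1 / |θ - round θ| := by
  have h1 : expTwoPi θ = expTwoPi (θ - round θ) := by
    conv_lhs => rw [← sub_add_cancel θ (round θ : ℝ)]
    rw [expTwoPi_add, expTwoPi_intCast, mul_one]
  have h2 : 4 * |θ - round θ| ≤ ‖expTwoPi θ - 1‖ := by
    rw [h1, norm_expTwoPi_sub_one]
    have h3 : |π * (θ - round θ)| ≤ π / 2 := by
      rw [abs_mul, abs_of_pos pi_pos]
      nlinarith [abs_sub_round θ, pi_pos]
    have h4 := mul_abs_le_abs_sin h3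
    rw [abs_mul, abs_of_pos pi_pos, ← mul_assoc, div_mul_cancel₀ _ pi_ne_zero] at h4
    linarith
  have h3 := abs_pos.mpr hθ
  have h4 : expTwoPi θ ≠ 1 := by
    intro h
    rw [h, sub_self, norm_zero] at h2
    linarith
  simp only [expTwoPi_nat_mul]
  rw [geom_sum_eq h4, norm_div, div_le_div_iff₀ (by linarith) h3]
  have h5 : ‖expTwoPi θ ^ N - 1‖ ≤ 2 := by
    refine (norm_sub_le _ _).trans ?_
    rw [norm_pow, norm_expTwoPi, one_pow, norm_one]
    norm_num
  nlinarith

lemma hasSum_expTwoPi_floorPrimitive (y : ℝ) :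
    HasSum (fun n : ℤ => 1 / (n : ℂ) ^ 2 * expTwoPi (n * y))
      ((2 * π ^ 2 * (y ^ 2 - y + 1 / 6 - 2 * floorPrimitive y) : ℝ) : ℂ) := by
  have h := hasSum_one_div_pow_mul_fourier_mul_bernoulliFun (k := 2) le_rfl
    (x := Int.fract y) ⟨Int.fract_nonneg y, (Int.fract_lt_one y).le⟩
  convert h using 1
  · funext n
    rw [fourier_coe_apply, ← expTwoPi_int_mul_fract, expTwoPi]
    congr 2
    push_cast
    ring
  · have h1 : y ^ 2 - y + 1 / 6 - 2 * floorPrimitive y = bernoulliFun 2 (Int.fract y) := by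
      rw [bernoulliFun_two, floorPrimitive, Int.fract]
      ring
    rw [h1, mul_pow, Complex.I_sq]
    push_cast
    rw [show ((2 : ℕ).factorial : ℂ) = 2 by norm_num [Nat.factorial]]
    ring

/-- The Fourier coefficients of `trapezoid`. -/
noncomputable def trapezoidCoeff (p q η : ℝ) (n : ℤ) : ℂ :=
  (if n = 0 then ((q - p + η : ℝ) : ℂ) else 0) - ((1 / (4 * π ^ 2 * η) : ℝ) : ℂ) *
    (1 / (n : ℂ) ^ 2 * (expTwoPi (n * (-p)) * (expTwoPi (n * η) - 1) +
      expTwoPi (n * (-q)) * (expTwoPi (n * (-η)) - 1)))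

lemma trapezoidCoeff_zero (p q η : ℝ) : trapezoidCoeff p q η 0 = ((q - p + η : ℝ) : ℂ) := by
  simp [trapezoidCoeff]

lemma hasSum_trapezoid (p q : ℝ) {η : ℝ} (hη : 0 < η) (x : ℝ) :
    HasSum (fun n : ℤ => trapezoidCoeff p q η n * expTwoPi (n * x)) (trapezoid p q η x : ℂ) := by
  have h0 : HasSum (fun n : ℤ => if n = 0 then ((q - p + η : ℝ) : ℂ) else 0)
      ((q - p + η : ℝ) : ℂ) := hasSum_ite_eq 0 _
  have h := h0.sub (((((hasSum_expTwoPi_floorPrimitive (x - p + η)).sub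
    (hasSum_expTwoPi_floorPrimitive (x - p))).sub (hasSum_expTwoPi_floorPrimitive (x - q))).add
    (hasSum_expTwoPi_floorPrimitive (x - q - η))).mul_left ((1 / (4 * π ^ 2 * η) : ℝ) : ℂ))
  convert! h using 1
  · funext n
    have e1 : expTwoPi (n * (x - p + η)) =
        expTwoPi (n * x) * expTwoPi (n * (-p)) * expTwoPi (n * η) := by
      rw [← expTwoPi_add, ← expTwoPi_add]
      congr 1
      ring
    have e2 : expTwoPi (n * (x - p)) = expTwoPi (n * x) * expTwoPi (n * (-p)) := by
      rw [← expTwoPi_add]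
      congr 1
      ring
    have e3 : expTwoPi (n * (x - q)) = expTwoPi (n * x) * expTwoPi (n * (-q)) := by
      rw [← expTwoPi_add]
      congr 1
      ring
    have e4 : expTwoPi (n * (x - q - η)) =
        expTwoPi (n * x) * expTwoPi (n * (-q)) * expTwoPi (n * (-η)) := by
      rw [← expTwoPi_add, ← expTwoPi_add]
      congr 1
      ring
    rw [e1, e2, e3, e4, trapezoidCoeff, sub_mul]
    congr 1
    · split_ifs with hn
      · rw [hn, Int.cast_zero, zero_mul, expTwoPi_zero, mul_one]
      · rw [zero_mul]
    · ring
  · have hpi := pi_ne_zero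
    have hη' := hη.ne'
    simp only [← Complex.ofReal_sub, ← Complex.ofReal_add, ← Complex.ofReal_mul]
    rw [trapezoid]
    congr 1
    field_simp
    ring

lemma norm_trapezoidCoeff_le {p q η δ : ℝ} (hη : 0 < η) (hη1 : η ≤ 1) (h0 : 0 ≤ q - p + η)
    (h2 : q - p + η ≤ 2) (hδ : 0 ≤ δ) (hδ1 : δ ≤ 1) (n : ℤ) :
    ‖trapezoidCoeff p q η n‖ ≤ 2 * η ^ (-δ) * max 1 |(n : ℝ)| ^ (-(1 + δ)) := by
  rcases eq_or_ne n 0 with rfl | hn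
  · rw [trapezoidCoeff_zero, Complex.norm_real, norm_eq_abs, abs_of_nonneg h0, Int.cast_zero,
      abs_zero, max_eq_left zero_le_one, one_rpow, mul_one]
    have : 1 ≤ η ^ (-δ) := one_le_rpow_of_pos_of_le_one_of_nonpos hη hη1 (by linarith)
    linarith
  · have hn1 : (1 : ℝ) ≤ |(n : ℝ)| := by exact_mod_cast Int.one_le_abs hn
    have hm0 : 0 < |(n : ℝ)| := by linarith
    rw [max_eq_right hn1]
    obtain ⟨m, hm⟩ : ∃ m, m = |(n : ℝ)| := ⟨_, rfl⟩
    have hbr : ‖expTwoPi (n * (-p)) * (expTwoPi (n * η) - 1) +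
        expTwoPi (n * (-q)) * (expTwoPi (n * (-η)) - 1)‖ ≤ 4 * min 1 (π * (m * η)) := by
      refine (norm_add_le _ _).trans ?_
      rw [norm_mul, norm_mul, norm_expTwoPi, norm_expTwoPi, one_mul, one_mul]
      have h3 := norm_expTwoPi_sub_one_le (n * η)
      have h4 := norm_expTwoPi_sub_one_le (n * (-η))
      rw [abs_mul, abs_of_pos hη, ← hm] at h3
      rw [abs_mul, abs_neg, abs_of_pos hη, ← hm] at h4
      linarith
    rw [← hm] at hm0 hn1 ⊢
    rw [trapezoidCoeff, if_neg hn, zero_sub, norm_neg, norm_mul, norm_mul, norm_div, norm_one,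
      norm_pow, Complex.norm_intCast, ← hm, Complex.norm_real, norm_eq_abs,
      abs_of_nonneg (by positivity)]
    have hpi : 3 < π := pi_gt_three
    have hmη : 0 < m * η := by positivity
    have hmin : min 1 (π * (m * η)) ≤ π * (m * η) ^ (1 - δ) := by
      rcases le_total 1 (m * η) with h | h
      · have : 1 ≤ (m * η) ^ (1 - δ) := one_le_rpow h (by linarith)
        exact (min_le_left _ _).trans (by nlinarith)
      · refine (min_le_right _ _).trans (mul_le_mul_of_nonneg_left ?_ pi_pos.le)
        conv_lhs => rw [← rpow_one (m * η)]
        exact rpow_le_rpow_of_exponent_ge hmη h (by linarith)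
    have hpow : (m * η) ^ (1 - δ) = m ^ 2 * η * (η ^ (-δ) * m ^ (-(1 + δ))) := by
      rw [mul_rpow hm0.le hη.le, sub_eq_add_neg, rpow_add hη, rpow_one,
        show 1 + -δ = (2 : ℕ) + -(1 + δ) by push_cast; ring, rpow_add hm0, rpow_natCast]
      ring
    rw [hpow] at hmin
    obtain ⟨w, hw⟩ : ∃ w, w = η ^ (-δ) * m ^ (-(1 + δ)) := ⟨_, rfl⟩
    have hw0 : 0 < w := by rw [hw]; positivity
    rw [← hw] at hmin
    rw [mul_assoc 2, ← hw]
    calc _ ≤ 1 / (4 * π ^ 2 * η) * (1 / m ^ 2 * (4 * (π * (m ^ 2 * η * w)))) := by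
          refine mul_le_mul_of_nonneg_left (mul_le_mul_of_nonneg_left ?_ (by positivity))
            (by positivity)
          linarith
      _ = w / π := by
          field_simp
      _ ≤ 2 * w := by
          rw [div_le_iff₀ pi_pos]
          nlinarith

end Trapezoid

section Discrepancy

open Filter Topology

lemma exists_norm_sum_fourier_le {d : ℕ} {α : Fin d → ℝ} (halg : ∀ i, IsAlgebraic ℚ (α i))
    (hli : LinearIndependent ℚ (Fin.cons 1 α : Fin (d + 1) → ℝ)) {δ : ℝ} (hδ : 0 < δ)
    (hδ1 : δ ≤ 1) :
    ∃ K > 0, ∀ (A : ℝ) (N : ℕ) (f : Fin d → ℝ → ℂ) (c : Fin d → ℤ → ℂ),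
      0 ≤ A → (∀ i h, ‖c i h‖ ≤ A * max 1 |(h : ℝ)| ^ (-(1 + δ))) →
      (∀ i x, HasSum (fun h => c i h * expTwoPi (h * x)) (f i x)) →
      ‖∑ n ∈ Finset.range N, ∏ i, f i (n * α i) - N * ∏ i, c i 0‖ ≤ A ^ d * K := by
  obtain ⟨K, hK, hKS⟩ := exists_sum_weight_le halg hli hδ hδ1
  refine ⟨K, hK, fun A N f c hA hc hf => ?_⟩
  have hlim : Tendsto (fun M : ℕ => ‖∑ n ∈ Finset.range N, ∏ i, ∑ h ∈ Finset.Icc (-(M : ℤ)) M,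
      c i h * expTwoPi (h * (n * α i)) - N * ∏ i, c i 0‖) atTop
      (𝓝 ‖∑ n ∈ Finset.range N, ∏ i, f i (n * α i) - N * ∏ i, c i 0‖) := by
    refine (Tendsto.sub_const (tendsto_finsetSum _ fun n _ => tendsto_finsetProd _ fun i _ => ?_)
      _).norm
    exact (hf i (n * α i)).comp (Finset.tendsto_Icc_neg (R := ℤ))
  refine le_of_tendsto hlim (Eventually.of_forall fun M => ?_)
  have hexpand : ∑ n ∈ Finset.range N, ∏ i, ∑ h ∈ Finset.Icc (-(M : ℤ)) M,
      c i h * expTwoPi (h * (n * α i)) =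
      ∑ h ∈ Fintype.piFinset fun _ : Fin d => Finset.Icc (-(M : ℤ)) M,
        (∏ i, c i (h i)) * ∑ n ∈ Finset.range N, expTwoPi (n * ∑ i, h i * α i) := by
    simp only [Finset.mul_sum]
    rw [Finset.sum_comm]
    refine Finset.sum_congr rfl fun n _ => ?_
    rw [Finset.prod_univ_sum]
    refine Finset.sum_congr rfl fun h _ => ?_
    rw [← Finset.mul_sum, Finset.prod_mul_distrib, ← expTwoPi_sum, Finset.mul_sum]
    congr 2
    exact Finset.sum_congr rfl fun i _ => by ring
  have h0 : (0 : Fin d → ℤ) ∈ Fintype.piFinset fun _ : Fin d => Finset.Icc (-(M : ℤ)) M := by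
    rw [Fintype.mem_piFinset]
    intro i
    simp
  rw [hexpand, ← Finset.add_sum_erase _ _ h0]
  have hmain : (∏ i, c i ((0 : Fin d → ℤ) i)) *
      ∑ n ∈ Finset.range N, expTwoPi (n * ∑ i, ((0 : Fin d → ℤ) i : ℝ) * α i) =
      N * ∏ i, c i 0 := by
    simp [expTwoPi_zero, mul_comm]
  rw [hmain, add_sub_cancel_left]
  calc _ ≤ ∑ h ∈ (Fintype.piFinset fun _ : Fin d => Finset.Icc (-(M : ℤ)) M).erase 0,
        A ^ d * ((∏ i, max 1 |(h i : ℝ)| ^ (-(1 + δ))) * (1 / |linearFormMod α h|)) := by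
        refine (norm_sum_le _ _).trans (Finset.sum_le_sum fun h hh => ?_)
        have hh0 : (Fin.cons (-round (∑ i, h i * α i)) h : Fin (d + 1) → ℤ) ≠ 0 := fun h1 =>
          (Finset.mem_erase.mp hh).1 (funext fun i => congrFun h1 i.succ)
        have hne := linear_form_ne_zero hli hh0
        rw [Int.cast_neg, neg_add_eq_sub] at hne
        rw [norm_mul, norm_prod, ← mul_assoc]
        refine mul_le_mul ?_ (norm_sum_expTwoPi_le hne N) (norm_nonneg _) ?_
        · refine (Finset.prod_le_prod (fun _ _ => norm_nonneg _) fun i _ => hc i (h i)).trans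
            (le_of_eq ?_)
          rw [Finset.prod_mul_distrib, Finset.prod_const, Finset.card_univ, Fintype.card_fin]
        · positivity
    _ ≤ A ^ d * K := by
        rw [← Finset.mul_sum]
        exact mul_le_mul_of_nonneg_left (hKS _ fun h hh => (Finset.mem_erase.mp hh).1)
          (pow_nonneg hA d)

lemma exists_abs_sum_trapezoid_le {d : ℕ} {α : Fin d → ℝ} (halg : ∀ i, IsAlgebraic ℚ (α i))
    (hli : LinearIndependent ℚ (Fin.cons 1 α : Fin (d + 1) → ℝ)) {ε : ℝ} (hε : 0 < ε) :
    ∃ K > 0, ∀ (p q : Fin d → ℝ) (N : ℕ), 1 ≤ N →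
      (∀ i, 0 ≤ q i - p i + 1 / (N : ℝ) ∧ q i - p i ≤ 1) →
      |∑ n ∈ Finset.range N, ∏ i, trapezoid (p i) (q i) (1 / N) (Int.fract (n * α i)) -
        N * ∏ i, (q i - p i + 1 / (N : ℝ))| ≤ K * (N : ℝ) ^ ε := by
  obtain ⟨δ, hδ, hδ1, hδd⟩ : ∃ δ > 0, δ ≤ 1 ∧ δ * d ≤ ε := by
    refine ⟨min 1 (ε / (d + 1)), by positivity, min_le_left _ _, ?_⟩
    calc _ ≤ ε / (d + 1) * d :=
          mul_le_mul_of_nonneg_right (min_le_right _ _) (Nat.cast_nonneg d)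
      _ ≤ ε := by
          rw [div_mul_eq_mul_div, div_le_iff₀ (by positivity)]
          linarith
  obtain ⟨K, hK, hKf⟩ := exists_norm_sum_fourier_le halg hli hδ hδ1
  refine ⟨2 ^ d * K, by positivity, fun p q N hN hpq => ?_⟩
  have hN1 : (1 : ℝ) ≤ N := by exact_mod_cast hN
  have hN0 : (0 : ℝ) < N := by linarith
  have hη0 : 0 < 1 / (N : ℝ) := by positivity
  have hη1 : 1 / (N : ℝ) ≤ 1 := (div_le_one hN0).mpr hN1
  have h := hKf (2 * (N : ℝ) ^ δ) N
    (fun i x => (trapezoid (p i) (q i) (1 / N) (Int.fract x) : ℂ))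
    (fun i => trapezoidCoeff (p i) (q i) (1 / N)) (by positivity) (fun i m => ?_) fun i x => ?_
  · simp only [trapezoidCoeff_zero] at h
    norm_cast at h
    rw [norm_eq_abs] at h
    refine h.trans ?_
    rw [mul_pow, ← rpow_natCast ((N : ℝ) ^ δ), ← rpow_mul hN0.le, mul_right_comm]
    exact mul_le_mul_of_nonneg_left (rpow_le_rpow_of_exponent_le hN1 hδd) (by positivity)
  · have := norm_trapezoidCoeff_le hη0 hη1 (hpq i).1 (by linarith [(hpq i).2]) hδ.le hδ1 m
    rwa [one_div, inv_rpow hN0.le, ← rpow_neg hN0.le, neg_neg, ← one_div] at this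
  · simpa only [expTwoPi_int_mul_fract] using hasSum_trapezoid (p i) (q i) hη0 (Int.fract x)

lemma abs_prod_sub_prod_le {ι : Type*} (s : Finset ι) {x y : ι → ℝ} {η : ℝ}
    (hx : ∀ i ∈ s, |x i| ≤ 2) (hy : ∀ i ∈ s, |y i| ≤ 2) (hxy : ∀ i ∈ s, |x i - y i| ≤ η) :
    |∏ i ∈ s, x i - ∏ i ∈ s, y i| ≤ s.card * 2 ^ s.card * η := by
  classical
  induction s using Finset.induction_on with
  | empty => simp
  | insert a s ha ih =>
    have h1 := ih (fun i hi => hx i (Finset.mem_insert_of_mem hi))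
      (fun i hi => hy i (Finset.mem_insert_of_mem hi))
      fun i hi => hxy i (Finset.mem_insert_of_mem hi)
    have h2 : |∏ i ∈ s, y i| ≤ 2 ^ s.card := by
      rw [Finset.abs_prod, ← Finset.prod_const]
      exact Finset.prod_le_prod (fun _ _ => abs_nonneg _)
        fun i hi => hy i (Finset.mem_insert_of_mem hi)
    have h3 := hx a (Finset.mem_insert_self a s)
    have h4 := hxy a (Finset.mem_insert_self a s)
    have h5 : 0 ≤ η := (abs_nonneg _).trans h4
    rw [Finset.prod_insert ha, Finset.prod_insert ha, Finset.card_insert_of_notMem ha]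
    calc _ = |x a * (∏ i ∈ s, x i - ∏ i ∈ s, y i) + (x a - y a) * ∏ i ∈ s, y i| := by
          congr 1
          ring
      _ ≤ |x a| * |∏ i ∈ s, x i - ∏ i ∈ s, y i| + |x a - y a| * |∏ i ∈ s, y i| := by
          rw [← abs_mul, ← abs_mul]
          exact abs_add_le _ _
      _ ≤ 2 * (s.card * 2 ^ s.card * η) + η * 2 ^ s.card := by
          gcongr
      _ ≤ _ := by
          have : 0 ≤ η * 2 ^ s.card := by positivity
          push_cast
          rw [pow_succ]
          linarith

lemma natCard_box_eq_sum {d : ℕ} (z : ℕ → Fin d → ℝ) (u v : Fin d → ℝ) (N : ℕ) :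
    (Nat.card {n : ℕ // n < N ∧ ∀ i, u i ≤ z n i ∧ z n i < v i} : ℝ) =
      ∑ n ∈ Finset.range N, ∏ i, if u i ≤ z n i ∧ z n i < v i then (1 : ℝ) else 0 := by
  classical
  rw [Nat.subtype_card ((Finset.range N).filter fun n => ∀ i, u i ≤ z n i ∧ z n i < v i)
    fun n => by rw [Finset.mem_filter, Finset.mem_range]]
  rw [Finset.card_filter]
  push_cast
  refine Finset.sum_congr rfl fun n _ => ?_
  rw [Finset.prod_ite_zero]
  simp

lemma exists_abs_natCard_box_sub_le {d : ℕ} {α : Fin d → ℝ} (halg : ∀ i, IsAlgebraic ℚ (α i))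
    (hli : LinearIndependent ℚ (Fin.cons 1 α : Fin (d + 1) → ℝ)) {ε : ℝ} (hε : 0 < ε) :
    ∃ C > 0, ∀ (u v : Fin d → ℝ) (N : ℕ), 1 ≤ N → (∀ i, 0 ≤ u i ∧ u i ≤ v i ∧ v i ≤ 1) →
      |(Nat.card {n : ℕ // n < N ∧ ∀ i, u i ≤ Int.fract (n * α i) ∧
        Int.fract (n * α i) < v i} : ℝ) - N * ∏ i, (v i - u i)| ≤ C * (N : ℝ) ^ ε := by
  obtain ⟨K, hK, hKp⟩ := exists_abs_sum_trapezoid_le halg hli hε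
  refine ⟨K + d * 2 ^ d + 1, by positivity, fun u v N hN huv => ?_⟩
  rw [natCard_box_eq_sum fun n i => Int.fract (n * α i)]
  have hN1 : (1 : ℝ) ≤ N := by exact_mod_cast hN
  have hN0 : (0 : ℝ) < N := by linarith
  have hNη : N * (1 / (N : ℝ)) = 1 := mul_one_div_cancel hN0.ne'
  have hη0 : 0 < 1 / (N : ℝ) := by positivity
  have hη1 : 1 / (N : ℝ) ≤ 1 := (div_le_one hN0).mpr hN1
  have hNε : 1 ≤ (N : ℝ) ^ ε := one_le_rpow hN1 hε.le
  have hdε : d * 2 ^ d ≤ d * 2 ^ d * (N : ℝ) ^ ε := le_mul_of_one_le_right (by positivity) hNε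
  have hrange : ∀ i, 0 ≤ v i - u i ∧ v i - u i ≤ 1 := fun i =>
    ⟨by linarith [(huv i).2.1], by linarith [(huv i).1, (huv i).2.2]⟩
  have hprod : ∀ w : Fin d → ℝ, (∀ i, |w i| ≤ 2) → (∀ i, |w i - (v i - u i)| ≤ 1 / N) →
      |N * ∏ i, w i - N * ∏ i, (v i - u i)| ≤ d * 2 ^ d := by
    intro w hw2 hw
    have h1 := abs_prod_sub_prod_le Finset.univ (x := w) (y := fun i => v i - u i)
      (fun i _ => hw2 i) (fun i _ => by
        rw [abs_of_nonneg (hrange i).1]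
        linarith [(hrange i).2]) fun i _ => hw i
    rw [Finset.card_univ, Fintype.card_fin] at h1
    rw [← mul_sub, abs_mul, abs_of_pos hN0]
    calc _ ≤ N * (d * 2 ^ d * (1 / (N : ℝ))) := mul_le_mul_of_nonneg_left h1 hN0.le
      _ = d * 2 ^ d * (N * (1 / (N : ℝ))) := by ring
      _ = _ := by rw [hNη, mul_one]
  rw [abs_le]
  constructor
  · by_cases hw : ∀ i, 1 / (N : ℝ) ≤ v i - u i
    · have h1 := hKp (fun i => u i + 1 / N) (fun i => v i - 1 / N) N hN fun i =>
        ⟨by linarith [hw i], by linarith [hw i, (hrange i).2]⟩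
      have h2 := hprod (fun i => v i - 1 / N - (u i + 1 / N) + 1 / N) (fun i => by
        rw [abs_le]
        constructor <;> linarith [hw i, (hrange i).2]) fun i => by
        rw [abs_le]
        constructor <;> linarith
      have h3 : ∑ n ∈ Finset.range N, ∏ i,
          trapezoid (u i + 1 / N) (v i - 1 / N) (1 / N) (Int.fract (n * α i)) ≤
          ∑ n ∈ Finset.range N, ∏ i,
            if u i ≤ Int.fract (n * α i) ∧ Int.fract (n * α i) < v i then (1 : ℝ) else 0 :=
        Finset.sum_le_sum fun n _ => Finset.prod_le_prod
          (fun i _ => trapezoid_nonneg hη0 (by linarith [hw i]) _)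
          fun i _ => trapezoid_le_ite hη0 (huv i).1 (huv i).2.1 (huv i).2.2
            (Int.fract_nonneg _) (Int.fract_lt_one _)
      have h4 := (abs_le.mp h1).1
      have h5 := (abs_le.mp h2).1
      linarith
    · push Not at hw
      obtain ⟨j, hj⟩ := hw
      have h1 : ∏ i, (v i - u i) ≤ 1 / N := by
        rw [← Finset.mul_prod_erase _ _ (Finset.mem_univ j)]
        exact (mul_le_of_le_one_right (hrange j).1 (Finset.prod_le_one
          (fun i _ => (hrange i).1) fun i _ => (hrange i).2)).trans hj.le
      have h2 : N * ∏ i, (v i - u i) ≤ 1 := hNη ▸ mul_le_mul_of_nonneg_left h1 hN0.le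
      have h3 : 0 ≤ ∑ n ∈ Finset.range N, ∏ i,
          if u i ≤ Int.fract (n * α i) ∧ Int.fract (n * α i) < v i then (1 : ℝ) else 0 :=
        Finset.sum_nonneg fun n _ => Finset.prod_nonneg fun i _ => by positivity
      have : 0 ≤ (K + d * 2 ^ d) * (N : ℝ) ^ ε := by positivity
      linarith
  · have h1 := hKp u v N hN fun i => ⟨by linarith [(hrange i).1], (hrange i).2⟩
    have h2 := hprod (fun i => v i - u i + 1 / N) (fun i => by
      rw [abs_le]
      constructor <;> linarith [hrange i]) fun i => by
      rw [abs_le]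
      constructor <;> linarith
    have h3 : ∑ n ∈ Finset.range N, ∏ i,
        (if u i ≤ Int.fract (n * α i) ∧ Int.fract (n * α i) < v i then (1 : ℝ) else 0) ≤
        ∑ n ∈ Finset.range N, ∏ i, trapezoid (u i) (v i) (1 / N) (Int.fract (n * α i)) := by
      refine Finset.sum_le_sum fun n _ => Finset.prod_le_prod (fun i _ => by positivity)
        fun i _ => ?_
      split_ifs with h
      · exact one_le_trapezoid hη0 (huv i).1 h.1 h.2.le (huv i).2.2
      · exact trapezoid_nonneg hη0 (by linarith [(hrange i).1]) _
    have h4 := (abs_le.mp h1).2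
    have h5 := (abs_le.mp h2).2
    linarith

end Discrepancy

theorem stmt15 (d : ℕ) (α : Fin d → ℝ) (halg : ∀ i, IsAlgebraic ℚ (α i))
    (hli : LinearIndependent ℚ (Fin.cons 1 α : Fin (d + 1) → ℝ)) :
    ∀ ε > (0 : ℝ), ∃ C > 0, ∀ N : ℕ, 1 ≤ N →
      disc (fun n i => Int.fract (n * α i)) N ≤ C * (N : ℝ) ^ (ε - 1) := by
  intro ε hε
  obtain ⟨C, hC, hbox⟩ := exists_abs_natCard_box_sub_le halg hli hε
  refine ⟨C, hC, fun N hN => csSup_le ⟨_, 0, 0, by simp, rfl⟩ ?_⟩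
  rintro r ⟨u, v, huv, rfl⟩
  have hN0 : (0 : ℝ) < N := by exact_mod_cast hN
  have h := hbox u v N hN huv
  rw [rpow_sub_one hN0.ne', ← mul_div_assoc, le_div_iff₀ hN0]
  refine le_trans (le_of_eq ?_) h
  rw [← abs_of_pos hN0, ← abs_mul, abs_of_pos hN0, sub_mul, div_mul_cancel₀ _ hN0.ne',
    mul_comm _ (N : ℝ)]
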